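/- Let N_CO(x) be the number of ternary integers n = pqr ≤ x (with 3 ≤ p < q < r odd primes) such that the height of the n-th inverse cyclotomic polynomial Ψ_n equals p - 1. Then N_CO(x) = C₁·x/(log x)² + O(x·log log x/(log x)³) as x → ∞, where C₁ = 4·Σ_{p odd prime} (1/(p(p-1)²))·log((p-1)/(p-2)). -/

import Mathlib

open Real Filter Polynomial

/-- The height of a polynomial over `ℤ`: the maximum of the absolute values of
its coefficients. -/
noncomputable def polyHeight (f : Polynomial ℤ) : ℕ :=
  f.support.sup fun k => (f.coeff k).natAbs

/-- The `n`-th inverse cyclotomic polynomial `Ψ_n = (x^n - 1)/Φ_n`. -/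
noncomputable def invCyclotomic (n : ℕ) : Polynomial ℤ :=
  (X ^ n - 1) /ₘ Polynomial.cyclotomic n ℤ

/-- The constant `C₁ = 4 Σ_{p odd prime} (1/(p(p-1)²)) log((p-1)/(p-2))`. -/
noncomputable def C1 : ℝ :=
  4 * ∑' p : {p : ℕ // p.Prime ∧ 3 ≤ p},
    (1 / ((p.1 : ℝ) * ((p.1 : ℝ) - 1) ^ 2)) * Real.log (((p.1 : ℝ) - 1) / ((p.1 : ℝ) - 2))

/-- `N_CO(x)`: the number of ternary `n = pqr ≤ x` (with `3 ≤ p < q < r` odd primes)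
such that `h(Ψ_n) = p - 1`, i.e. `Ψ_n` is coefficient optimal. -/
noncomputable def NCOcount (x : ℝ) : ℕ :=
  {n : ℕ | ∃ p q r : ℕ, p.Prime ∧ q.Prime ∧ r.Prime ∧
    3 ≤ p ∧ p < q ∧ q < r ∧ n = p * q * r ∧ (n : ℝ) ≤ x ∧
    polyHeight (invCyclotomic n) = p - 1}.ncard

namespace NCO

/-- Truncated Dirichlet series with remainder, continued to `0 < re s`. -/
theorem tail_bound (a : ℕ → ℂ) (c : ℂ) (K : ℝ) (N : ℕ) (hN : 1 ≤ N) (E : ℂ → ℂ)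
    (ha : ∀ n, ‖a n‖ ≤ 1)
    (hK : ∀ u : ℝ, (N : ℝ) ≤ u →
      ‖(∑ k ∈ Finset.Icc 1 ⌊u⌋₊, (if k ≤ N then 0 else a k)) - c * ((u : ℂ) - N)‖ ≤ K)
    (hE : DifferentiableOn ℂ E {s | 0 < s.re})
    (hEL : ∀ s : ℂ, 1 < s.re → E s = (s - 1) * LSeries a s)
    (s : ℂ) (hs : 0 < s.re) :
    ‖E s - (s - 1) * ∑ n ∈ Finset.Icc 1 N, a n * (n : ℂ) ^ (-s) - c * (N : ℂ) ^ (1 - s)‖ ≤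
      ‖s - 1‖ * ‖s‖ * (K * (N : ℝ) ^ (-s.re) / s.re) := by
  set b : ℕ → ℂ := fun k => if k ≤ N then 0 else a k with hb
  have hN0 : (0 : ℝ) < N := by exact_mod_cast hN
  have hK0 : 0 ≤ K := (norm_nonneg _).trans (hK N le_rfl)
  set G : ℝ → ℂ := fun u => if (N : ℝ) < u then
    (∑ k ∈ Finset.Icc 1 ⌊u⌋₊, b k) - c * ((u : ℂ) - N) else 0 with hG
  have hGle : ∀ u, ‖G u‖ ≤ K := by
    intro u
    simp only [hG]
    split_ifs with h
    · exact hK u h.le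
    · simpa using hK0
  have hmeas : Measurable G := by
    refine Measurable.ite measurableSet_Ioi ?_ measurable_const
    refine Measurable.sub ?_ (by fun_prop)
    exact (measurable_from_nat (f := fun m : ℕ => ∑ k ∈ Finset.Icc 1 m, b k)).comp
      Nat.measurable_floor
  have hloc : MeasureTheory.LocallyIntegrableOn G (Set.Ioi 0) := by
    have h1 : MeasureTheory.MemLp G ⊤ MeasureTheory.volume :=
      MeasureTheory.memLp_top_of_bound hmeas.aestronglyMeasurable K (MeasureTheory.ae_of_all _ hGle)
    exact (h1.locallyIntegrable (by simp)).locallyIntegrableOn _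
  have htop : G =O[atTop] (fun x : ℝ => x ^ (-(0:ℝ))) := by
    refine Asymptotics.IsBigO.of_bound K (Eventually.of_forall fun u => ?_)
    simpa using hGle u
  have hbot : ∀ b' : ℝ, G =O[nhdsWithin 0 (Set.Ioi 0)] (fun x : ℝ => x ^ (-b')) := by
    intro b'
    have : G =ᶠ[nhdsWithin 0 (Set.Ioi 0)] 0 := by
      filter_upwards [mem_nhdsWithin_of_mem_nhds (Iio_mem_nhds hN0)] with u hu
      simp only [hG, Pi.zero_apply]
      rw [if_neg (not_lt.mpr (le_of_lt hu))]
    exact this.trans_isBigO (Asymptotics.isBigO_zero _ _)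
  have hmd : ∀ s : ℂ, 0 < s.re → DifferentiableAt ℂ (fun z => mellin G (-z)) s := by
    intro s hs
    have h1 : DifferentiableAt ℂ (mellin G) (-s) :=
      mellin_differentiableAt_of_isBigO_rpow hloc htop (by simpa using hs) (hbot (-s.re - 1))
        (by simp)
    exact h1.comp (f := fun z => -z) s differentiableAt_id.neg
  have hmc : ∀ s : ℂ, 0 < s.re → MellinConvergent G (-s) := by
    intro s hs
    exact mellinConvergent_of_isBigO_rpow hloc htop (by simpa using hs) (hbot (-s.re - 1))
        (by simp)
  -- the mellin transform as integral over Ioi N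
  have hmel : ∀ s : ℂ, mellin G (-s) = ∫ u in Set.Ioi (N : ℝ), (u : ℂ) ^ (-s - 1) * G u := by
    intro s
    rw [mellin]
    simp only [smul_eq_mul]
    refine (MeasureTheory.setIntegral_eq_of_subset_of_forall_sdiff_eq_zero measurableSet_Ioi
      (Set.Ioi_subset_Ioi hN0.le) ?_)
    intro u hu
    have : ¬ ((N : ℝ) < u) := fun h => hu.2 h
    simp [hG, this]
  -- norm bound
  have hbound : ‖mellin G (-s)‖ ≤ K * (N : ℝ) ^ (-s.re) / s.re := by
    rw [hmel]
    have h1 : ∀ u ∈ Set.Ioi (N : ℝ), ‖(u : ℂ) ^ (-s - 1) * G u‖ ≤ u ^ (-s.re - 1) * K := by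
      intro u hu
      have hu0 : 0 < u := hN0.trans hu
      rw [norm_mul, Complex.norm_cpow_eq_rpow_re_of_pos hu0]
      simp only [Complex.sub_re, Complex.neg_re, Complex.one_re]
      gcongr
      exact hGle u
    have hintg : MeasureTheory.IntegrableOn (fun u : ℝ => u ^ (-s.re - 1) * K) (Set.Ioi (N : ℝ)) :=
      (integrableOn_Ioi_rpow_of_lt (by linarith) hN0).mul_const K
    refine (MeasureTheory.norm_integral_le_of_norm_le hintg
      ((MeasureTheory.ae_restrict_iff' measurableSet_Ioi).mpr (MeasureTheory.ae_of_all _ h1))).trans ?_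
    rw [MeasureTheory.integral_mul_const, integral_Ioi_rpow_of_lt (by linarith) hN0]
    have : -s.re - 1 + 1 = -s.re := by ring
    rw [this, neg_div_neg_eq]
    apply le_of_eq; ring
  -- identity
  have hid : ∀ s : ℂ, 1 < s.re → E s = (s - 1) * ∑ n ∈ Finset.Icc 1 N, a n * (n : ℂ) ^ (-s)
      + c * (N : ℂ) ^ (1 - s) + (s - 1) * s * mellin G (-s) := by
    intro s hs
    have hs0 : s ≠ 0 := by rintro rfl; simp at hs; linarith
    have hs1 : s - 1 ≠ 0 := by
      intro h; have : s = 1 := by linear_combination h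
      rw [this] at hs; simp at hs
    have hNc : (N : ℂ) ≠ 0 := by exact_mod_cast hN0.ne'
    have hsa : LSeriesSummable a s :=
      LSeriesSummable_of_bounded_of_one_lt_re (m := 1) (fun n _ => ha n) hs
    have hbn : ∀ n, ‖b n‖ ≤ 1 := by
      intro n; simp only [hb]; split_ifs <;> simp [ha]
    have hsb : LSeriesSummable b s :=
      LSeriesSummable_of_bounded_of_one_lt_re (m := 1) (fun n _ => hbn n) hs
    have hsplit : LSeries a s = ∑ n ∈ Finset.Icc 1 N, a n * (n : ℂ) ^ (-s) + LSeries b s := by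
      have h1 : LSeries a s - LSeries b s = LSeries (a - b) s := (LSeries_sub hsa hsb).symm
      have h2 : LSeries (a - b) s = ∑ n ∈ Finset.Icc 1 N, LSeries.term (a - b) s n := by
        refine tsum_eq_sum (fun n hn => ?_)
        rcases Nat.eq_zero_or_pos n with rfl | hpos
        · simp
        · have : ¬ n ≤ N := fun h => hn (Finset.mem_Icc.mpr ⟨hpos, h⟩)
          rw [LSeries.term_of_ne_zero hpos.ne']
          simp [hb, this]
      have h3 : ∑ n ∈ Finset.Icc 1 N, LSeries.term (a - b) s n =
          ∑ n ∈ Finset.Icc 1 N, a n * (n : ℂ) ^ (-s) := by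
        refine Finset.sum_congr rfl fun n hn => ?_
        have hn' := Finset.mem_Icc.mp hn
        rw [LSeries.term_of_ne_zero (by omega)]
        simp [hb, hn'.2, Complex.cpow_neg, div_eq_mul_inv]
      rw [← h3, ← h2, ← h1]; ring
    have hO : (fun n ↦ ∑ k ∈ Finset.Icc 1 n, b k) =O[atTop] fun n : ℕ ↦ (n : ℝ) ^ (1 : ℝ) := by
      refine Asymptotics.IsBigO.of_bound 1 (Eventually.of_forall fun n => ?_)
      calc ‖∑ k ∈ Finset.Icc 1 n, b k‖ ≤ ∑ k ∈ Finset.Icc 1 n, (1 : ℝ) :=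
            norm_sum_le_of_le _ (fun k _ => hbn k)
        _ = 1 * ‖(n : ℝ) ^ (1 : ℝ)‖ := by simp
    have hLb := LSeries_eq_mul_integral b zero_le_one hs hsb hO
    have hI1 : ∫ t in Set.Ioi (1 : ℝ), (∑ k ∈ Finset.Icc 1 ⌊t⌋₊, b k) * (t : ℂ) ^ (-(s + 1)) =
        ∫ t in Set.Ioi (N : ℝ), (∑ k ∈ Finset.Icc 1 ⌊t⌋₊, b k) * (t : ℂ) ^ (-(s + 1)) := by
      refine (MeasureTheory.setIntegral_eq_of_subset_of_forall_sdiff_eq_zero measurableSet_Ioi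
        (Set.Ioi_subset_Ioi (by exact_mod_cast hN)) ?_)
      intro u hu
      have hu2 : u ≤ N := not_lt.mp hu.2
      have : ∑ k ∈ Finset.Icc 1 ⌊u⌋₊, b k = 0 := by
        refine Finset.sum_eq_zero fun k hk => ?_
        have h1 := (Finset.mem_Icc.mp hk).2
        have h2 : ⌊u⌋₊ ≤ N := Nat.floor_le_of_le hu2
        simp [hb, h1.trans h2]
      rw [this, zero_mul]
    have hre1 : (-s).re < -1 := by simpa using hs
    have hre2 : (-s - 1).re < -1 := by simp; linarith
    have hi1 := integrableOn_Ioi_cpow_of_lt hre1 hN0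
    have hi2 := integrableOn_Ioi_cpow_of_lt hre2 hN0
    have hiG : MeasureTheory.IntegrableOn (fun u : ℝ => (u : ℂ) ^ (-s - 1) * G u)
        (Set.Ioi (N : ℝ)) := by
      have := hmc s (by linarith)
      exact MeasureTheory.IntegrableOn.mono_set (by simpa [MellinConvergent] using this)
        (Set.Ioi_subset_Ioi hN0.le)
    have hI2 : ∫ t in Set.Ioi (N : ℝ), (∑ k ∈ Finset.Icc 1 ⌊t⌋₊, b k) * (t : ℂ) ^ (-(s + 1)) =
        ∫ u in Set.Ioi (N : ℝ), ((u : ℂ) ^ (-s - 1) * G u +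
          (c * (u : ℂ) ^ (-s) - (c * N) * (u : ℂ) ^ (-s - 1))) := by
      refine MeasureTheory.setIntegral_congr_fun measurableSet_Ioi fun u hu => ?_
      have hu0 : (u : ℂ) ≠ 0 := by exact_mod_cast (hN0.trans hu).ne'
      have h1 : (u : ℂ) ^ (-s) = (u : ℂ) ^ (-s - 1) * u := by
        rw [Complex.cpow_sub _ _ hu0]; simp [hu0]
      have h2 : -(s + 1) = -s - 1 := by ring
      simp only [hG]
      rw [if_pos (show (N : ℝ) < u from hu), h1, h2]; ring
    have hi3 := hi1.const_mul c
    have hi4 := hi2.const_mul (c * N)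
    have hi34 : MeasureTheory.IntegrableOn (fun u : ℝ => c * (u : ℂ) ^ (-s) -
        (c * N) * (u : ℂ) ^ (-s - 1)) (Set.Ioi (N : ℝ)) := hi3.sub hi4
    have hcalc : LSeries b s = s * (mellin G (-s) + (c * ((N : ℂ) ^ (1 - s) / (s - 1)) -
        c * N * ((N : ℂ) ^ (-s) / s))) := by
      rw [hLb, hI1, hI2, MeasureTheory.integral_add hiG hi34,
        MeasureTheory.integral_sub hi3 hi4,
        MeasureTheory.integral_const_mul, MeasureTheory.integral_const_mul, ← hmel,
        integral_Ioi_cpow_of_lt hre1 hN0, integral_Ioi_cpow_of_lt hre2 hN0]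
      have e1 : -s + 1 = 1 - s := by ring
      have e2 : -s - 1 + 1 = -s := by ring
      rw [e1, e2]
      have hs2 : (1 : ℂ) - s ≠ 0 := by intro h; apply hs1; linear_combination -h
      have e5 : -((N : ℝ) : ℂ) ^ (1 - s) / (1 - s) = (N : ℂ) ^ (1 - s) / (s - 1) := by
        push_cast
        field_simp
        ring
      have e6 : -((N : ℝ) : ℂ) ^ (-s) / (-s) = (N : ℂ) ^ (-s) / s := by
        push_cast
        field_simp
      rw [e5, e6]
    have e4 : (N : ℂ) ^ (1 - s) = N * (N : ℂ) ^ (-s) := by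
      rw [show (1 - s) = 1 + -s by ring, Complex.cpow_add _ _ hNc, Complex.cpow_one]
    rw [hEL s hs, hsplit, hcalc, e4]
    field_simp
    ring
  -- analytic continuation
  have hopen : IsOpen {s : ℂ | 0 < s.re} := isOpen_lt continuous_const Complex.continuous_re
  have hconv : Convex ℝ {s : ℂ | 0 < s.re} := convex_halfSpace_re_gt 0
  have hd2 : DifferentiableOn ℂ (fun s => (s - 1) * ∑ n ∈ Finset.Icc 1 N, a n * (n : ℂ) ^ (-s)
      + c * (N : ℂ) ^ (1 - s) + (s - 1) * s * mellin G (-s)) {s | 0 < s.re} := by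
    intro z hz
    refine DifferentiableAt.differentiableWithinAt ?_
    have hNc : (N : ℂ) ≠ 0 := by exact_mod_cast hN0.ne'
    have h1 : DifferentiableAt ℂ (fun s : ℂ => ∑ n ∈ Finset.Icc 1 N, a n * (n : ℂ) ^ (-s)) z := by
      refine DifferentiableAt.fun_sum fun n hn => ?_
      have hn' : (n : ℂ) ≠ 0 := by
        have := (Finset.mem_Icc.mp hn).1
        exact_mod_cast (by omega : n ≠ 0)
      exact (DifferentiableAt.const_cpow (by fun_prop) (Or.inl hn')).const_mul _
    have h2 : DifferentiableAt ℂ (fun s : ℂ => (N : ℂ) ^ (1 - s)) z :=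
      DifferentiableAt.const_cpow (by fun_prop) (Or.inl hNc)
    have h3 := hmd z hz
    fun_prop
  have heq := AnalyticOnNhd.eqOn_of_preconnected_of_eventuallyEq (hE.analyticOnNhd hopen)
    (hd2.analyticOnNhd hopen) hconv.isPreconnected (z₀ := 2) (by simp)
    (by
      have : {s : ℂ | 1 < s.re} ∈ nhds (2 : ℂ) :=
        (isOpen_lt continuous_const Complex.continuous_re).mem_nhds (by simp)
      filter_upwards [this] with z hz using hid z hz)
  have h := heq (show s ∈ {s : ℂ | 0 < s.re} from hs)
  simp only at h
  rw [h]
  have : (s - 1) * ∑ n ∈ Finset.Icc 1 N, a n * (n : ℂ) ^ (-s) + c * (N : ℂ) ^ (1 - s) +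
      (s - 1) * s * mellin G (-s) - (s - 1) * ∑ n ∈ Finset.Icc 1 N, a n * (n : ℂ) ^ (-s) -
      c * (N : ℂ) ^ (1 - s) = (s - 1) * s * mellin G (-s) := by ring
  rw [this, norm_mul, norm_mul]
  gcongr

end NCO

namespace NCO

theorem char_sum_period {p : ℕ} [NeZero p] (χ : DirichletCharacter ℂ p) (hχ : χ ≠ 1) (m : ℕ) :
    ∑ i ∈ Finset.range p, χ ((m + i : ℕ) : ZMod p) = 0 := by
  have h1 : ∑ x : ZMod p, χ ((m : ZMod p) + x) = 0 := by
    rw [← MulChar.sum_eq_zero_of_ne_one hχ]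
    exact Equiv.sum_comp (Equiv.addLeft (m : ZMod p)) (fun x => χ x)
  rw [← h1]
  refine Finset.sum_nbij' (fun i => (i : ZMod p)) (fun x => x.val) ?_ ?_ ?_ ?_ ?_
  · intro i _; exact Finset.mem_univ _
  · intro x _; exact Finset.mem_range.mpr (ZMod.val_lt x)
  · intro i hi; exact ZMod.val_natCast_of_lt (Finset.mem_range.mp hi)
  · intro x _; exact ZMod.natCast_zmod_val x
  · intro i _; push_cast; rfl

theorem char_prefix {p : ℕ} [NeZero p] (χ : DirichletCharacter ℂ p) (hχ : χ ≠ 1) (m : ℕ) :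
    ∑ i ∈ Finset.range m, χ (i : ZMod p) = ∑ i ∈ Finset.range (m % p), χ (i : ZMod p) := by
  induction m using Nat.strong_induction_on with
  | _ m ih =>
    rcases lt_or_ge m p with h | h
    · rw [Nat.mod_eq_of_lt h]
    · obtain ⟨k, rfl⟩ := Nat.exists_eq_add_of_le h
      have hp := Nat.pos_of_ne_zero (NeZero.ne p)
      rw [add_comm p k, Finset.sum_range_add, char_sum_period χ hχ k, add_zero, ih k (by omega),
        Nat.add_mod_right]

theorem char_prefix_le {p : ℕ} [NeZero p] (χ : DirichletCharacter ℂ p) (hχ : χ ≠ 1) (m : ℕ) :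
    ‖∑ i ∈ Finset.range m, χ (i : ZMod p)‖ ≤ p := by
  rw [char_prefix χ hχ m]
  refine (norm_sum_le_of_le _ (fun (k : ℕ) _ => χ.norm_le_one (k : ZMod p))).trans ?_
  simp only [Finset.sum_const, Finset.card_range, nsmul_eq_mul, mul_one]
  exact_mod_cast (Nat.mod_lt _ (Nat.pos_of_ne_zero (NeZero.ne p))).le

theorem sum_trunc (a : ℕ → ℂ) (N m : ℕ) (h : N ≤ m) :
    ∑ k ∈ Finset.Icc 1 m, (if k ≤ N then 0 else a k) =
      ∑ k ∈ Finset.range (m + 1), a k - ∑ k ∈ Finset.range (N + 1), a k := by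
  rw [← Finset.sum_range_add_sum_Ico _ (show N + 1 ≤ m + 1 by omega)]
  rw [add_sub_cancel_left]
  have : Finset.Ico (N + 1) (m + 1) = (Finset.Icc 1 m).filter (fun k => ¬ k ≤ N) := by
    ext k; simp; omega
  rw [this, Finset.sum_filter]
  refine Finset.sum_congr rfl fun k _ => ?_
  by_cases hk : k ≤ N <;> simp [hk]

/-- partial sum bound -/
theorem partial_le (a : ℕ → ℂ) (ha : ∀ n, ‖a n‖ ≤ 1) (N : ℕ) (hN : 3 ≤ N) (s : ℂ)
    (hs : 1 - 1 / log N ≤ s.re) :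
    ‖∑ n ∈ Finset.Icc 1 N, a n * (n : ℂ) ^ (-s)‖ ≤ exp 1 * (1 + log N) := by
  have hl : 0 < log N := log_pos (by exact_mod_cast (by omega : 1 < N))
  have h1 : ∀ n ∈ Finset.Icc 1 N, ‖a n * (n : ℂ) ^ (-s)‖ ≤ exp 1 * (n : ℝ)⁻¹ := by
    intro n hn
    obtain ⟨hn1, hn2⟩ := Finset.mem_Icc.mp hn
    have hn0 : (0 : ℝ) < n := by exact_mod_cast hn1
    rw [norm_mul, Complex.norm_natCast_cpow_of_pos hn1]
    have h2 : (n : ℝ) ^ (-s).re ≤ exp 1 * (n : ℝ)⁻¹ := by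
      rw [rpow_def_of_pos hn0]
      have : (n : ℝ)⁻¹ = exp (- log n) := by rw [exp_neg, exp_log hn0]
      rw [this, ← exp_add]
      apply exp_le_exp.mpr
      have h3 : log n ≤ log N := log_le_log hn0 (by exact_mod_cast hn2)
      have h4 : 0 ≤ log n := log_natCast_nonneg n
      have h5 : log n * (-s).re ≤ log n * (1 / log N - 1) := by
        apply mul_le_mul_of_nonneg_left _ h4
        simp; simp at hs; linarith
      have h6 : log n * (1 / log N) ≤ 1 := by
        rw [mul_one_div, div_le_one hl]; exact h3
      linarith
    calc ‖a n‖ * (n : ℝ) ^ (-s).re ≤ 1 * (exp 1 * (n : ℝ)⁻¹) := by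
          gcongr
          exact ha n
      _ = _ := one_mul _
  refine (norm_sum_le_of_le _ h1).trans ?_
  rw [← Finset.mul_sum]
  gcongr
  have := harmonic_le_one_add_log N
  rw [harmonic_eq_sum_Icc] at this
  push_cast at this
  exact this

theorem rpow_neg_le (N : ℕ) (hN : 3 ≤ N) (σ : ℝ) (hs : 1 - 1 / log N ≤ σ) :
    (N : ℝ) ^ (-σ) ≤ exp 1 / N := by
  have hl : 0 < log N := log_pos (by exact_mod_cast (by omega : 1 < N))
  have hN0 : (0 : ℝ) < N := by exact_mod_cast (by omega : 0 < N)
  rw [rpow_def_of_pos hN0, ← exp_log hN0, ← exp_sub, exp_log hN0]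
  apply exp_le_exp.mpr
  have : log N * (1 / log N) = 1 := by field_simp
  nlinarith

theorem one_le_log (N : ℕ) (hN : 3 ≤ N) : 1 ≤ log N := by
  rw [le_log_iff_exp_le (by exact_mod_cast (by omega : 0 < N))]
  have : (3 : ℝ) ≤ N := by exact_mod_cast hN
  have := exp_one_lt_d9
  linarith

theorem zeta_upper (N : ℕ) (hN : 3 ≤ N) (s : ℂ) (hs : 1 - 1 / log N ≤ s.re) (hs2 : 1 / 2 ≤ s.re)
    (h : ‖s‖ ≤ N) (hs1 : s ≠ 1) : ‖riemannZeta s‖ ≤ 11 * log N + 3 / ‖s - 1‖ := by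
  have hN0 : (0 : ℝ) < N := by exact_mod_cast (by omega : 0 < N)
  have key := tail_bound (fun _ => 1) 1 1 N (by omega) riemannZeta₁ (by simp) ?_
    (differentiable_riemannZeta₁.differentiableOn) ?_ s (by linarith)
  · have h0 : s - 1 ≠ 0 := sub_ne_zero.mpr hs1
    have h0' : 0 < ‖s - 1‖ := norm_pos_iff.mpr h0
    have e1 := one_le_log N hN
    have e2 : ‖(s - 1) * ∑ n ∈ Finset.Icc 1 N, (1 : ℂ) * (n : ℂ) ^ (-s)‖ ≤
        ‖s - 1‖ * (exp 1 * (1 + log N)) := by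
      rw [norm_mul]
      gcongr
      exact partial_le (fun _ => 1) (by simp) N hN s hs
    have e3 : ‖(1 : ℂ) * (N : ℂ) ^ (1 - s)‖ ≤ exp 1 := by
      rw [one_mul, Complex.norm_natCast_cpow_of_pos (by omega)]
      have := rpow_neg_le N hN s.re hs
      simp only [Complex.sub_re, Complex.one_re]
      rw [sub_eq_add_neg, rpow_add hN0, rpow_one]
      calc (N : ℝ) * (N : ℝ) ^ (-s.re) ≤ N * (exp 1 / N) := by gcongr
        _ = exp 1 := by field_simp
    have e4 : ‖s - 1‖ * ‖s‖ * (1 * (N : ℝ) ^ (-s.re) / s.re) ≤ ‖s - 1‖ * (2 * exp 1) := by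
      rw [mul_assoc]
      refine mul_le_mul_of_nonneg_left ?_ (norm_nonneg _)
      have := rpow_neg_le N hN s.re hs
      rw [one_mul]
      calc ‖s‖ * ((N : ℝ) ^ (-s.re) / s.re) ≤ N * ((exp 1 / N) / (1 / 2)) := by gcongr
        _ = 2 * exp 1 := by field_simp
    have e5 : riemannZeta₁ s = (s - 1) * riemannZeta s := by
      rw [riemannZeta_eq_inv_sub_mul hs1]; field_simp
    rw [e5] at key
    have e6 : ‖(s - 1) * riemannZeta s‖ ≤ ‖s - 1‖ * (2 * exp 1) +
        ‖s - 1‖ * (exp 1 * (1 + log N)) + exp 1 := by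
      have := norm_add₃_le (a := (s - 1) * riemannZeta s - (s - 1) * ∑ n ∈ Finset.Icc 1 N,
        (1 : ℂ) * (n : ℂ) ^ (-s) - 1 * (N : ℂ) ^ (1 - s))
        (b := (s - 1) * ∑ n ∈ Finset.Icc 1 N, (1 : ℂ) * (n : ℂ) ^ (-s))
        (c := 1 * (N : ℂ) ^ (1 - s))
      rw [show (s - 1) * riemannZeta s - (s - 1) * ∑ n ∈ Finset.Icc 1 N,
        (1 : ℂ) * (n : ℂ) ^ (-s) - 1 * (N : ℂ) ^ (1 - s) + (s - 1) * ∑ n ∈ Finset.Icc 1 N,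
        (1 : ℂ) * (n : ℂ) ^ (-s) + 1 * (N : ℂ) ^ (1 - s) = (s - 1) * riemannZeta s by ring] at this
      linarith
    rw [norm_mul] at e6
    have e7 := exp_one_lt_d9
    have e8 : ‖riemannZeta s‖ ≤ 2 * exp 1 + exp 1 * (1 + log N) + exp 1 / ‖s - 1‖ := by
      rw [← mul_le_mul_iff_right₀ h0']
      refine e6.trans (le_of_eq ?_)
      field_simp
    have e9 : exp 1 / ‖s - 1‖ ≤ 3 / ‖s - 1‖ := by gcongr; linarith
    nlinarith
  · intro u hu
    have hu0 : 0 ≤ u := hN0.le.trans hu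
    rw [sum_trunc _ _ _ (Nat.le_floor hu)]
    simp only [Finset.sum_const, Finset.card_range, nsmul_eq_mul, mul_one, one_mul]
    have : ((⌊u⌋₊ + 1 : ℕ) : ℂ) - ((N + 1 : ℕ) : ℂ) - ((u : ℂ) - N) =
        (((⌊u⌋₊ : ℝ) - u : ℝ) : ℂ) := by push_cast; ring
    rw [this, Complex.norm_real, Real.norm_eq_abs, abs_le]
    have h1 := Nat.floor_le hu0
    have h2 := Nat.lt_floor_add_one u
    constructor <;> linarith
  · intro s hs
    have hs1 : s ≠ 1 := by rintro rfl; simp at hs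
    rw [show (fun _ : ℕ => (1 : ℂ)) = 1 from rfl, LSeries_one_eq_riemannZeta hs,
      riemannZeta_eq_inv_sub_mul hs1]
    have : s - 1 ≠ 0 := sub_ne_zero.mpr hs1
    field_simp

theorem L_trunc {p : ℕ} [NeZero p] (χ : DirichletCharacter ℂ p) (hχ : χ ≠ 1)
    (N : ℕ) (hN : 1 ≤ N) (s : ℂ) (hs : 0 < s.re) :
    ‖χ.LFunction s - ∑ n ∈ Finset.Icc 1 N, χ n * (n : ℂ) ^ (-s)‖ ≤
      ‖s‖ * (2 * p * (N : ℝ) ^ (-s.re) / s.re) := by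
  have hN0 : (0 : ℝ) < N := by exact_mod_cast (by omega : 0 < N)
  have hd : Differentiable ℂ χ.LFunction := DirichletCharacter.differentiable_LFunction hχ
  have k1 : ∀ s : ℂ, 0 < s.re → s ≠ 1 →
    ‖χ.LFunction s - ∑ n ∈ Finset.Icc 1 N, χ n * (n : ℂ) ^ (-s)‖ ≤
    ‖s‖ * (2 * p * (N : ℝ) ^ (-s.re) / s.re) := by
    intro s hs hs1
    have h0' : 0 < ‖s - 1‖ := norm_pos_iff.mpr (sub_ne_zero.mpr hs1)
    have := tail_bound (fun n => χ n) 0 (2 * p) N (by omega) (fun s => (s - 1) * χ.LFunction s)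
      (fun n => χ.norm_le_one _) ?_ (by fun_prop) ?_ s hs
    · rw [zero_mul, sub_zero, ← mul_sub, norm_mul, mul_assoc] at this
      exact le_of_mul_le_mul_left this h0'
    · intro u hu
      rw [sum_trunc _ _ _ (Nat.le_floor hu), zero_mul, sub_zero]
      refine (norm_sub_le _ _).trans ?_
      have h1 := char_prefix_le χ hχ (⌊u⌋₊ + 1)
      have h2 := char_prefix_le χ hχ (N + 1)
      linarith
    · intro s hs
      rw [DirichletCharacter.LFunction_eq_LSeries χ hs]
  rcases eq_or_ne s 1 with rfl | hs1
  · have hc1 : ContinuousAt (fun s : ℂ => ‖χ.LFunction s -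
        ∑ n ∈ Finset.Icc 1 N, χ n * (n : ℂ) ^ (-s)‖) 1 := by
      have h1 : ContinuousAt (fun s : ℂ => ∑ n ∈ Finset.Icc 1 N, χ n * (n : ℂ) ^ (-s)) 1 := by
        refine tendsto_finsetSum _ fun n hn => ?_
        have hn' : (n : ℂ) ≠ 0 := by
          have := (Finset.mem_Icc.mp hn).1
          exact_mod_cast (by omega : n ≠ 0)
        refine tendsto_const_nhds.mul ?_
        have : DifferentiableAt ℂ (fun s : ℂ => (n : ℂ) ^ (-s)) 1 :=
          DifferentiableAt.const_cpow (by fun_prop) (Or.inl hn')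
        exact this.continuousAt
      exact (hd.continuous.continuousAt.sub h1).norm
    have hc2 : ContinuousAt (fun s : ℂ => ‖s‖ * (2 * p * (N : ℝ) ^ (-s.re) / s.re)) 1 := by
      have : ContinuousAt (fun s : ℂ => (N : ℝ) ^ (-s.re)) 1 := by
        refine ContinuousAt.rpow continuousAt_const ?_ (Or.inl hN0.ne')
        exact (Complex.continuous_re.neg).continuousAt
      refine continuous_norm.continuousAt.mul ((continuousAt_const.mul this).div
        Complex.continuous_re.continuousAt (by simp))
    refine le_of_tendsto_of_tendsto (b := nhdsWithin (1 : ℂ) {1}ᶜ)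
      (hc1.tendsto.mono_left nhdsWithin_le_nhds) (hc2.tendsto.mono_left nhdsWithin_le_nhds) ?_
    have h1 : ∀ᶠ s : ℂ in nhdsWithin (1 : ℂ) {1}ᶜ, 0 < s.re :=
      nhdsWithin_le_nhds ((isOpen_lt continuous_const Complex.continuous_re).mem_nhds (by simp))
    filter_upwards [h1, self_mem_nhdsWithin] with z hz hz1 using k1 z hz hz1
  · exact k1 s hs hs1

theorem L_upper {p : ℕ} [NeZero p] (χ : DirichletCharacter ℂ p) (hχ : χ ≠ 1)
    (N : ℕ) (hN : 3 ≤ N) (s : ℂ) (hs : 1 - 1 / log N ≤ s.re) (hs2 : 1 / 2 ≤ s.re)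
    (h : 2 * p * ‖s‖ ≤ N) : ‖χ.LFunction s‖ ≤ 11 * log N := by
  have hN0 : (0 : ℝ) < N := by exact_mod_cast (by omega : 0 < N)
  have h1 := L_trunc χ hχ N (by omega) s (by linarith)
  have h2 := partial_le (fun n => χ n) (fun n => χ.norm_le_one _) N hN s hs
  have h3 := rpow_neg_le N hN s.re hs
  have h4 : ‖s‖ * (2 * p * (N : ℝ) ^ (-s.re) / s.re) ≤ 2 * exp 1 := by
    calc ‖s‖ * (2 * p * (N : ℝ) ^ (-s.re) / s.re)
        ≤ ‖s‖ * (2 * p * (exp 1 / N) / (1 / 2)) := by gcongr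
      _ = 2 * exp 1 / N * (2 * p * ‖s‖) := by ring
      _ ≤ 2 * exp 1 / N * N := by gcongr
      _ = _ := by field_simp
  have h5 := norm_le_norm_add_norm_sub (∑ n ∈ Finset.Icc 1 N, χ n * (n : ℂ) ^ (-s)) (χ.LFunction s)
  rw [norm_sub_rev] at h5
  have e1 := one_le_log N hN
  have e7 := exp_one_lt_d9
  nlinarith

end NCO

namespace NCO

theorem logderiv_second (f : ℂ → ℂ) (z : ℂ) (hf : AnalyticAt ℂ f z) (h0 : f z ≠ 0) :
    deriv (deriv (fun s => -deriv f s / f s)) z =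
      -(iteratedDeriv 3 f z / f z - 3 * iteratedDeriv 2 f z * deriv f z / f z ^ 2
        + 2 * deriv f z ^ 3 / f z ^ 3) := by
  have e1 : ∀ᶠ s in nhds z, AnalyticAt ℂ f s ∧ f s ≠ 0 :=
    hf.eventually_analyticAt.and (hf.continuousAt.eventually_ne h0)
  have e2 : deriv (fun s => -deriv f s / f s) =ᶠ[nhds z]
      fun s => -(deriv (deriv f) s / f s - deriv f s ^ 2 / f s ^ 2) := by
    filter_upwards [e1] with s hs
    have d1 : HasDerivAt f (deriv f s) s := hs.1.differentiableAt.hasDerivAt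
    have d2 : HasDerivAt (deriv f) (deriv (deriv f) s) s :=
      hs.1.deriv.differentiableAt.hasDerivAt
    have h := (d2.neg.div d1 hs.2).deriv
    have h' : deriv (fun s => -deriv f s / f s) s = (-deriv (deriv f) s * f s -
      -deriv f s * deriv f s) / f s ^ 2 := h
    rw [h']
    have := hs.2
    field_simp
    ring
  rw [e2.deriv_eq]
  have d1 : HasDerivAt f (deriv f z) z := hf.differentiableAt.hasDerivAt
  have d2 : HasDerivAt (deriv f) (deriv (deriv f) z) z := hf.deriv.differentiableAt.hasDerivAt
  have d3 : HasDerivAt (deriv (deriv f)) (deriv (deriv (deriv f)) z) z :=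
    hf.deriv.deriv.differentiableAt.hasDerivAt
  have h := ((d3.div d1 h0).sub ((d2.pow 2).div (d1.pow 2) (pow_ne_zero 2 h0))).neg.deriv
  have h' : deriv (fun s => -(deriv (deriv f) s / f s - deriv f s ^ 2 / f s ^ 2)) z = _ := h
  rw [h']
  simp only [iteratedDeriv_succ, iteratedDeriv_zero, Pi.pow_apply]
  field_simp
  push_cast
  ring

theorem logderiv_bound (f : ℂ → ℂ) (z : ℂ) (ρ M m : ℝ) (hρ : 0 < ρ) (hm : 0 < m)
    (hd : ∀ w ∈ Metric.closedBall z ρ, DifferentiableAt ℂ f w)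
    (hM : ∀ w ∈ Metric.closedBall z ρ, ‖f w‖ ≤ M) (hmz : m ≤ ‖f z‖) :
    ‖deriv (deriv (fun s => -deriv f s / f s)) z‖ ≤ 14 * (M / (ρ * m)) ^ 3 := by
  have hdo : DifferentiableOn ℂ f (Metric.closedBall z ρ) :=
    fun w hw => (hd w hw).differentiableWithinAt
  have hfa : AnalyticAt ℂ f z := hdo.analyticAt (Metric.closedBall_mem_nhds z hρ)
  have h0 : f z ≠ 0 := by intro h; rw [h, norm_zero] at hmz; linarith
  have hc : DiffContOnCl ℂ f (Metric.ball z ρ) :=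
    (hdo.mono Metric.closure_ball_subset_closedBall).diffContOnCl
  have hs : ∀ w ∈ Metric.sphere z ρ, ‖f w‖ ≤ M := fun w hw => hM w (Metric.sphere_subset_closedBall hw)
  have c1 := Complex.norm_iteratedDeriv_le_of_forall_mem_sphere_norm_le 1 hρ hc hs
  have c2 := Complex.norm_iteratedDeriv_le_of_forall_mem_sphere_norm_le 2 hρ hc hs
  have c3 := Complex.norm_iteratedDeriv_le_of_forall_mem_sphere_norm_le 3 hρ hc hs
  rw [iteratedDeriv_one] at c1
  simp only [Nat.factorial] at c1 c2 c3
  norm_num at c1 c2 c3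
  have hmM : m ≤ M := hmz.trans (hM z (Metric.mem_closedBall_self hρ.le))
  have hM0 : 0 < M := hm.trans_le hmM
  rw [logderiv_second f z hfa h0, norm_neg]
  set Q := M / (ρ * m) with hQ
  have q1 : ‖deriv f z‖ / ‖f z‖ ≤ Q := by
    calc ‖deriv f z‖ / ‖f z‖ ≤ (M / ρ) / m := by gcongr
      _ = Q := by rw [hQ, div_div]
  have hm1 : M / m ≥ 1 := by rw [ge_iff_le, le_div_iff₀ hm]; linarith
  have q2 : ‖iteratedDeriv 2 f z‖ / ‖f z‖ ≤ 2 * Q ^ 2 := by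
    calc ‖iteratedDeriv 2 f z‖ / ‖f z‖ ≤ (2 * M / ρ ^ 2) / m := by gcongr
      _ = 2 * (M / m) / ρ ^ 2 := by field_simp
      _ ≤ 2 * ((M / m) * (M / m)) / ρ ^ 2 := by
        gcongr
        nlinarith
      _ = 2 * Q ^ 2 := by rw [hQ]; field_simp
  have q3 : ‖iteratedDeriv 3 f z‖ / ‖f z‖ ≤ 6 * Q ^ 3 := by
    calc ‖iteratedDeriv 3 f z‖ / ‖f z‖ ≤ (6 * M / ρ ^ 3) / m := by gcongr
      _ = 6 * (M / m) / ρ ^ 3 := by field_simp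
      _ ≤ 6 * ((M / m) ^ 3) / ρ ^ 3 := by
        gcongr
        exact le_self_pow₀ hm1 (by norm_num)
      _ = 6 * Q ^ 3 := by rw [hQ]; field_simp
  have hQ0 : 0 < Q := by positivity
  have hp1 : 0 ≤ ‖deriv f z‖ / ‖f z‖ := by positivity
  have hp2 : 0 ≤ ‖iteratedDeriv 2 f z‖ / ‖f z‖ := by positivity
  calc _ ≤ ‖iteratedDeriv 3 f z / f z‖ + ‖3 * iteratedDeriv 2 f z * deriv f z / f z ^ 2‖ +
        ‖2 * deriv f z ^ 3 / f z ^ 3‖ :=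
        (norm_add_le _ _).trans (by gcongr; exact norm_sub_le _ _)
    _ = ‖iteratedDeriv 3 f z‖ / ‖f z‖ +
        3 * ((‖iteratedDeriv 2 f z‖ / ‖f z‖) * (‖deriv f z‖ / ‖f z‖)) +
        2 * (‖deriv f z‖ / ‖f z‖) ^ 3 := by
        simp only [norm_div, norm_mul, norm_pow]
        norm_num
        ring
    _ ≤ 6 * Q ^ 3 + 3 * ((2 * Q ^ 2) * Q) + 2 * Q ^ 3 := by gcongr
    _ = 14 * Q ^ 3 := by ring

/-- Lower bound from a 3-4-1 inequality and Lipschitz continuity. -/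
theorem lower_341 (g : ℝ → ℝ) (A D : ℝ) (hA : 1 ≤ A) (hD : 1 ≤ D) (hg : ∀ x, 0 ≤ g x)
    (h341 : ∀ x, 0 < x → x ≤ 1 → 1 ≤ (3 / x) ^ 3 * g x ^ 4 * A)
    (hlip : ∀ x y, 0 < x → x ≤ y → y ≤ 1 → g y - g x ≤ D * (y - x)) (x : ℝ) (hx : 0 < x)
    (hx1 : x ≤ 1) : 1 / (432 * A * D ^ 3) ≤ g x := by
  set x1 := 1 / (432 * A * D ^ 4) with hx1d
  have hA0 : 0 < A := by linarith
  have hD0 : 0 < D := by linarith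
  have hD4 : 1 ≤ D ^ 4 := one_le_pow₀ hD
  have hx10 : 0 < x1 := by positivity
  have hx11 : x1 ≤ 1 := by
    rw [hx1d, div_le_one (by positivity)]
    nlinarith [mul_le_mul hA hD4 (by norm_num) (by linarith)]
  have e1 : x1 * D = 1 / (432 * A * D ^ 3) := by rw [hx1d]; field_simp
  rw [← e1]
  have big : ∀ y, x1 ≤ y → y ≤ 1 → 2 * (x1 * D) ≤ g y := by
    intro y hy hy1
    have hy0 : 0 < y := hx10.trans_le hy
    have h := h341 y hy0 hy1
    have h2 : (2 * (x1 * D)) ^ 4 ≤ g y ^ 4 := by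
      have h3 : y ^ 3 ≤ 27 * A * g y ^ 4 := by
        have : (3 / y) ^ 3 * g y ^ 4 * A * y ^ 3 = 27 * A * g y ^ 4 := by field_simp; ring
        rw [← this]
        exact le_mul_of_one_le_left (by positivity) h
      have h4 : x1 ^ 3 ≤ y ^ 3 := by gcongr
      have h5 : (2 * (x1 * D)) ^ 4 * (27 * A) = x1 ^ 3 := by
        have : x1 * (432 * A * D ^ 4) = 1 := by rw [hx1d]; field_simp
        linear_combination x1 ^ 3 * this
      nlinarith
    exact le_of_pow_le_pow_left₀ (by norm_num) (hg y) h2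
  rcases le_total x1 x with h | h
  · have := big x h hx1
    have : 0 < x1 * D := by positivity
    linarith
  · have h1 := big x1 le_rfl hx11
    have h2 := hlip x x1 hx h hx11
    nlinarith

end NCO

namespace NCO

theorem LSeries_le (a : ℕ → ℂ) (ha : ∀ n, ‖a n‖ ≤ 1) (s : ℂ) (x : ℝ) (hx : 0 < x) (hx1 : x ≤ 1)
    (hs : s.re = 1 + x) : ‖LSeries a s‖ ≤ 3 / x := by
  have hsum : Summable (fun n : ℕ => 1 / (n : ℝ) ^ (1 + x)) :=
    Real.summable_one_div_nat_rpow.mpr (by linarith)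
  have h1 : ‖LSeries a s‖ ≤ ∑' n : ℕ, 1 / (n : ℝ) ^ (1 + x) := by
    refine tsum_of_norm_bounded hsum.hasSum fun n => ?_
    rw [LSeries.norm_term_eq, hs]
    split_ifs with h
    · positivity
    · gcongr
      exact ha n
  have h2 : riemannZeta ((1 + x : ℝ) : ℂ) = ((∑' n : ℕ, 1 / (n : ℝ) ^ (1 + x) : ℝ) : ℂ) := by
    rw [zeta_eq_tsum_one_div_nat_cpow (by simp; linarith), Complex.ofReal_tsum]
    refine tsum_congr fun n => ?_
    rw [Complex.ofReal_div, Complex.ofReal_cpow (Nat.cast_nonneg n)]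
    simp
  have h3 := tail_bound (fun _ => 1) 1 1 1 (by omega) riemannZeta₁ (by simp) ?_
    (differentiable_riemannZeta₁.differentiableOn) ?_ ((1 + x : ℝ) : ℂ) (by simp; linarith)
  · have hne : ((1 + x : ℝ) : ℂ) ≠ 1 := by
      intro h
      have : (1 + x : ℝ) = 1 := by exact_mod_cast h
      linarith
    have e5 : riemannZeta₁ ((1 + x : ℝ) : ℂ) = (x : ℂ) * riemannZeta ((1 + x : ℝ) : ℂ) := by
      rw [riemannZeta_eq_inv_sub_mul hne]; push_cast
      have : (x : ℂ) ≠ 0 := by exact_mod_cast hx.ne'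
      field_simp
      ring_nf
      field_simp
    rw [e5, h2] at h3
    set S := ∑' n : ℕ, 1 / (n : ℝ) ^ (1 + x) with hS
    have e6 : ((x : ℂ) * (S : ℂ) - (((1 + x : ℝ) : ℂ) - 1) *
        ∑ n ∈ Finset.Icc (1 : ℕ) 1, (1 : ℂ) * (n : ℂ) ^ (-((1 + x : ℝ) : ℂ)) -
        1 * ((1 : ℕ) : ℂ) ^ (1 - ((1 + x : ℝ) : ℂ))) = ((x * S - x - 1 : ℝ) : ℂ) := by
      simp
    rw [e6, Complex.norm_real] at h3
    have e7 : ((1 + x : ℝ) : ℂ) - 1 = (x : ℂ) := by push_cast; ring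
    rw [e7, Complex.norm_real, Complex.norm_real] at h3
    simp only [Complex.ofReal_re, Nat.cast_one, one_rpow, Real.norm_eq_abs] at h3
    rw [abs_of_pos hx, abs_of_pos (by linarith : 0 < 1 + x)] at h3
    have e8 : x * (1 + x) * (1 * 1 / (1 + x)) = x := by field_simp
    rw [e8] at h3
    have h4 := (abs_le.mp h3).2
    refine h1.trans ?_
    rw [le_div_iff₀ hx]
    nlinarith
  · intro u hu
    have hu0 : 0 ≤ u := le_trans (by simp) hu
    rw [sum_trunc _ _ _ (Nat.le_floor hu)]
    simp only [Finset.sum_const, Finset.card_range, nsmul_eq_mul, mul_one, one_mul]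
    have : ((⌊u⌋₊ + 1 : ℕ) : ℂ) - ((1 + 1 : ℕ) : ℂ) - ((u : ℂ) - (1 : ℕ)) =
        (((⌊u⌋₊ : ℝ) - u : ℝ) : ℂ) := by push_cast; ring
    rw [this, Complex.norm_real, Real.norm_eq_abs, abs_le]
    have h1 := Nat.floor_le hu0
    have h2 := Nat.lt_floor_add_one u
    constructor <;> linarith
  · intro s hs
    have hs1 : s ≠ 1 := by rintro rfl; simp at hs
    rw [show (fun _ : ℕ => (1 : ℂ)) = 1 from rfl, LSeries_one_eq_riemannZeta hs,
      riemannZeta_eq_inv_sub_mul hs1]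
    have : s - 1 ≠ 0 := sub_ne_zero.mpr hs1
    field_simp

theorem L_le_abs {p : ℕ} [NeZero p] (χ : DirichletCharacter ℂ p) (s : ℂ) (x : ℝ) (hx : 0 < x)
    (hx1 : x ≤ 1) (hs : s.re = 1 + x) : ‖χ.LFunction s‖ ≤ 3 / x := by
  rw [DirichletCharacter.LFunction_eq_LSeries χ (by rw [hs]; linarith)]
  exact LSeries_le _ (fun n => χ.norm_le_one _) s x hx hx1 hs

theorem h341 {p : ℕ} [NeZero p] (χ : DirichletCharacter ℂ p) (x t : ℝ) (hx : 0 < x) (hx1 : x ≤ 1) :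
    1 ≤ (3 / x) ^ 3 * ‖χ.LFunction (1 + x + Complex.I * t)‖ ^ 4 *
      ‖(χ ^ 2).LFunction (1 + x + 2 * Complex.I * t)‖ := by
  have h := DirichletCharacter.norm_LFunction_product_ge_one χ hx t
  rw [norm_mul, norm_mul, norm_pow, norm_pow] at h
  refine h.le.trans ?_
  gcongr
  exact L_le_abs 1 _ x hx hx1 (by simp)

theorem lip_bound (f : ℂ → ℂ) (W : Set ℂ) (hW : Convex ℝ W) (ρ M : ℝ) (hρ : 0 < ρ)
    (hd : ∀ s ∈ W, ∀ w ∈ Metric.closedBall s ρ, DifferentiableAt ℂ f w ∧ ‖f w‖ ≤ M)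
    (s1 s2 : ℂ) (h1 : s1 ∈ W) (h2 : s2 ∈ W) : ‖f s2 - f s1‖ ≤ M / ρ * ‖s2 - s1‖ := by
  refine Convex.norm_image_sub_le_of_norm_deriv_le
    (fun s hs => (hd s hs s (Metric.mem_closedBall_self hρ.le)).1) ?_ hW h1 h2
  intro s hs
  refine Complex.norm_deriv_le_of_forall_mem_sphere_norm_le hρ ?_
    fun w hw => (hd s hs w (Metric.sphere_subset_closedBall hw)).2
  have hdo : DifferentiableOn ℂ f (Metric.closedBall s ρ) :=
    fun w hw => (hd s hs w hw).1.differentiableWithinAt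
  exact (hdo.mono Metric.closure_ball_subset_closedBall).diffContOnCl

/-- combine: lower bound and second derivative bound on a vertical line -/
theorem core_bound (f : ℂ → ℂ) (t ρ M A : ℝ) (hρ : 0 < ρ) (hρ1 : ρ ≤ 1) (hM : 1 ≤ M) (hA : 1 ≤ A)
    (hd : ∀ s : ℂ, 1 ≤ s.re → s.re ≤ 2 → s.im = t → ∀ w ∈ Metric.closedBall s ρ,
      DifferentiableAt ℂ f w ∧ ‖f w‖ ≤ M)
    (h : ∀ x : ℝ, 0 < x → x ≤ 1 → 1 ≤ (3 / x) ^ 3 * ‖f (1 + x + Complex.I * t)‖ ^ 4 * A)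
    (x : ℝ) (hx : 0 < x) (hx1 : x ≤ 1) :
    1 / (432 * A * (M / ρ) ^ 3) ≤ ‖f (1 + x + Complex.I * t)‖ := by
  refine lower_341 (fun x => ‖f (1 + x + Complex.I * t)‖) A (M / ρ) hA ?_ (fun _ => norm_nonneg _)
    h ?_ x hx hx1
  · rw [one_le_div hρ]; linarith
  · intro x y hx hxy hy
    set W : Set ℂ := {s | 1 ≤ s.re ∧ s.re ≤ 2 ∧ s.im = t} with hWd
    have hW : Convex ℝ W := by
      have e : W = {s | 1 ≤ s.re} ∩ ({s | s.re ≤ 2} ∩ {s | s.im = t}) := by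
        ext s; simp [hWd]
      rw [e]
      refine (convex_halfSpace_re_ge 1).inter ((convex_halfSpace_re_le 2).inter ?_)
      exact convex_hyperplane (Complex.imLm.isLinear) t
    have := lip_bound f W hW ρ M hρ (fun s hs => hd s hs.1 hs.2.1 hs.2.2)
      (1 + x + Complex.I * t) (1 + y + Complex.I * t)
      ⟨by simp; linarith, by simp; linarith, by simp⟩ ⟨by simp; linarith, by simp; linarith, by simp⟩
    have e : (1 + y + Complex.I * t : ℂ) - (1 + x + Complex.I * t) = ((y - x : ℝ) : ℂ) := by
      push_cast; ring
    rw [e, Complex.norm_real, Real.norm_eq_abs, abs_of_nonneg (by linarith)] at this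
    exact (norm_sub_norm_le _ _).trans this

theorem norm_le_re_im (s : ℂ) : ‖s‖ ≤ |s.re| + |s.im| := Complex.norm_le_abs_re_add_abs_im s

theorem ball_mem (s w : ℂ) (ρ : ℝ) (hw : w ∈ Metric.closedBall s ρ) :
    s.re - ρ ≤ w.re ∧ w.re ≤ s.re + ρ ∧ |w.im| ≤ |s.im| + ρ ∧ |s.im| - ρ ≤ |w.im| := by
  rw [mem_closedBall_iff_norm] at hw
  have h1 := (Complex.abs_re_le_norm (w - s)).trans hw
  have h2 := (Complex.abs_im_le_norm (w - s)).trans hw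
  rw [Complex.sub_re] at h1
  rw [Complex.sub_im] at h2
  have h3 := abs_le.mp h1
  refine ⟨by linarith, by linarith, ?_, ?_⟩
  · have := abs_sub_abs_le_abs_sub w.im s.im; linarith
  · have := abs_sub_abs_le_abs_sub s.im w.im
    rw [abs_sub_comm] at this; linarith

theorem L_ball {p : ℕ} [NeZero p] (χ : DirichletCharacter ℂ p) (hχ : χ ≠ 1)
    (N : ℕ) (hN : 3 ≤ N) (T : ℝ) (h : 2 * p * (T + 4) ≤ N) (s : ℂ) (h1 : 1 ≤ s.re)
    (h2 : s.re ≤ 2) (h3 : |s.im| ≤ T) (w : ℂ) (hw : w ∈ Metric.closedBall s (1 / (2 * log N))) :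
    DifferentiableAt ℂ χ.LFunction w ∧ ‖χ.LFunction w‖ ≤ 11 * log N := by
  refine ⟨DirichletCharacter.differentiable_LFunction hχ w, ?_⟩
  obtain ⟨b1, b2, b3, b4⟩ := ball_mem s w _ hw
  have hl := one_le_log N hN
  have hr : 1 / (2 * log N) ≤ 1 / 2 := by gcongr; linarith
  have hr2 : 1 / (2 * log N) ≤ 1 / log N := by gcongr; linarith
  refine L_upper χ hχ N hN w (by linarith) (by linarith) ?_
  refine le_trans ?_ h
  gcongr
  refine (norm_le_re_im w).trans ?_
  rw [abs_of_nonneg (by linarith : 0 ≤ w.re)]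
  linarith

theorem zeta_ball (N : ℕ) (hN : 3 ≤ N) (t : ℝ) (ht : 1 ≤ |t|) (h : |t| + 4 ≤ N) (s : ℂ)
    (h1 : 1 ≤ s.re) (h2 : s.re ≤ 2) (h3 : s.im = t) (w : ℂ)
    (hw : w ∈ Metric.closedBall s (1 / (2 * log N))) :
    DifferentiableAt ℂ riemannZeta w ∧ ‖riemannZeta w‖ ≤ 17 * log N := by
  obtain ⟨b1, b2, b3, b4⟩ := ball_mem s w _ hw
  rw [h3] at b3 b4
  have hl := one_le_log N hN
  have hr : 1 / (2 * log N) ≤ 1 / 2 := by gcongr; linarith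
  have hr2 : 1 / (2 * log N) ≤ 1 / log N := by gcongr; linarith
  have hw1 : w ≠ 1 := by
    rintro rfl
    rw [Complex.one_im, abs_zero] at b4; linarith
  refine ⟨differentiableAt_riemannZeta hw1, ?_⟩
  have := zeta_upper N hN w (by linarith) (by linarith) (by
    refine (norm_le_re_im w).trans ?_
    rw [abs_of_nonneg (by linarith : 0 ≤ w.re)]
    linarith) hw1
  refine this.trans ?_
  have h5 : 1 / 2 ≤ ‖w - 1‖ := by
    have := Complex.abs_im_le_norm (w - 1)
    simp at this
    linarith
  have : 3 / ‖w - 1‖ ≤ 3 / (1 / 2) := by gcongr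
  linarith

theorem second_complex {p : ℕ} [NeZero p] (χ : DirichletCharacter ℂ p) (hχ : χ ≠ 1) (hχ2 : χ ^ 2 ≠ 1)
    (N : ℕ) (hN : 3 ≤ N) (t : ℝ) (h : 2 * p * (2 * |t| + 4) ≤ N) (x : ℝ) (hx : 0 < x) (hx1 : x ≤ 1) :
    ‖deriv (deriv (fun s => -deriv χ.LFunction s / χ.LFunction s)) (1 + x + Complex.I * t)‖ ≤
      14 * (22 ^ 4 * (432 * 11)) ^ 3 * log N ^ 27 := by
  have hl := one_le_log N hN
  have hl0 : 0 < log N := by linarith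
  have h' : 2 * p * (|t| + 4) ≤ N := by
    refine le_trans ?_ h
    gcongr
    have := abs_nonneg t
    linarith
  have hb := fun (s : ℂ) (h1 : 1 ≤ s.re) (h2 : s.re ≤ 2) (h3 : s.im = t) (w : ℂ)
    (hw : w ∈ Metric.closedBall s (1 / (2 * log N))) =>
    L_ball χ hχ N hN |t| h' s h1 h2 (by rw [h3]) w hw
  have hr1 : 1 / (2 * log N) ≤ 1 := by rw [div_le_one (by positivity)]; linarith
  have hm := core_bound χ.LFunction t (1 / (2 * log N)) (11 * log N) (11 * log N) (by positivity)
    hr1 (by linarith) (by linarith) hb ?_ x hx hx1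
  · have := logderiv_bound χ.LFunction (1 + x + Complex.I * t) (1 / (2 * log N)) (11 * log N) _
      (by positivity) (by positivity)
      (fun w hw => (hb _ (by simp; linarith) (by simp; linarith) (by simp) w hw).1)
      (fun w hw => (hb _ (by simp; linarith) (by simp; linarith) (by simp) w hw).2) hm
    refine this.trans (le_of_eq ?_)
    field_simp
    ring
  · intro y hy hy1
    refine (h341 χ y t hy hy1).trans ?_
    gcongr
    refine (L_ball (χ ^ 2) hχ2 N hN (2 * |t|) h _ (by simp; linarith) (by simp; linarith) (by simp) _
      (Metric.mem_closedBall_self (by positivity))).2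

theorem second_zeta (N : ℕ) (hN : 3 ≤ N) (t : ℝ) (ht : 1 ≤ |t|) (h : 2 * |t| + 4 ≤ N) (x : ℝ)
    (hx : 0 < x) (hx1 : x ≤ 1) :
    ‖deriv (deriv (fun s => -deriv riemannZeta s / riemannZeta s)) (1 + x + Complex.I * t)‖ ≤
      14 * (34 ^ 4 * (432 * 17)) ^ 3 * log N ^ 27 := by
  have hl := one_le_log N hN
  have hl0 : 0 < log N := by linarith
  have hb := fun (s : ℂ) (h1 : 1 ≤ s.re) (h2 : s.re ≤ 2) (h3 : s.im = t) (w : ℂ)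
    (hw : w ∈ Metric.closedBall s (1 / (2 * log N))) =>
    zeta_ball N hN t ht (by linarith) s h1 h2 h3 w hw
  have hr1 : 1 / (2 * log N) ≤ 1 := by rw [div_le_one (by positivity)]; linarith
  have hm := core_bound riemannZeta t (1 / (2 * log N)) (17 * log N) (17 * log N) (by positivity)
    hr1 (by linarith) (by linarith) hb ?_ x hx hx1
  · have := logderiv_bound riemannZeta (1 + x + Complex.I * t) (1 / (2 * log N)) (17 * log N) _
      (by positivity) (by positivity)
      (fun w hw => (hb _ (by simp; linarith) (by simp; linarith) (by simp) w hw).1)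
      (fun w hw => (hb _ (by simp; linarith) (by simp; linarith) (by simp) w hw).2) hm
    refine this.trans (le_of_eq ?_)
    field_simp
    ring
  · intro y hy hy1
    have := h341 (1 : DirichletCharacter ℂ 1) y t hy hy1
    simp only [DirichletCharacter.LFunction_modOne_eq] at this
    refine this.trans ?_
    gcongr
    have e : (1 + y + 2 * Complex.I * t : ℂ).im = 2 * t := by simp
    refine (zeta_ball N hN (2 * t) ?_ ?_ _ (by simp; linarith) (by simp; linarith) e _
      (Metric.mem_closedBall_self (by positivity))).2
    · rw [abs_mul]; norm_num; linarith
    · rw [abs_mul]; norm_num; linarith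

theorem second_real {p : ℕ} (hp : p.Prime) [NeZero p] (χ : DirichletCharacter ℂ p) (hχ : χ ≠ 1)
    (hχ2 : χ ^ 2 = 1) (δ : ℝ) (hδ : 0 < δ) (hδ1 : δ ≤ 1) (hL : δ ≤ ‖χ.LFunction 1‖)
    (N : ℕ) (hN : 3 ≤ N) (t : ℝ) (h : 2 * p * (2 * |t| + 4) ≤ N) (x : ℝ) (hx : 0 < x) (hx1 : x ≤ 1) :
    ‖deriv (deriv (fun s => -deriv χ.LFunction s / χ.LFunction s)) (1 + x + Complex.I * t)‖ ≤
      14 * (22 ^ 4 * (432 * 286)) ^ 3 * log N ^ 30 / δ ^ 3 := by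
  have hl := one_le_log N hN
  have hl0 : 0 < log N := by linarith
  have h' : 2 * p * (|t| + 4) ≤ N := by
    refine le_trans ?_ h
    gcongr
    have := abs_nonneg t
    linarith
  have hb0 := L_ball χ hχ N hN |t| h'
  have hb := fun (s : ℂ) (h1 : 1 ≤ s.re) (h2 : s.re ≤ 2) (h3 : s.im = t) (w : ℂ)
    (hw : w ∈ Metric.closedBall s (1 / (2 * log N))) => hb0 s h1 h2 (by rw [h3]) w hw
  have hr1 : 1 / (2 * log N) ≤ 1 := by rw [div_le_one (by positivity)]; linarith
  have hm : δ / (432 * 286 * 22 ^ 3 * log N ^ 8) ≤ ‖χ.LFunction (1 + x + Complex.I * t)‖ := by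
    have hl8 : log N ^ 2 ≤ log N ^ 8 := pow_le_pow_right₀ hl (by norm_num)
    have hl8' : 1 ≤ log N ^ 8 := one_le_pow₀ hl
    rcases le_or_gt (δ / (88 * log N ^ 2)) |t| with ht | ht
    · have ht0 : 0 < |t| := lt_of_lt_of_le (by positivity) ht
      have hA : 1 ≤ 286 * log N ^ 2 / δ := by
        rw [one_le_div hδ]; nlinarith [one_le_pow₀ (n := 2) hl]
      have := core_bound χ.LFunction t (1 / (2 * log N)) (11 * log N) (286 * log N ^ 2 / δ)
        (by positivity) hr1 (by linarith) hA hb ?_ x hx hx1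
      · refine le_trans (le_of_eq ?_) this
        field_simp
        norm_num
      · intro y hy hy1
        refine (h341 χ y t hy hy1).trans ?_
        gcongr
        set z : ℂ := 1 + y + 2 * Complex.I * t with hz
        have hzre : z.re = 1 + y := by simp [hz]
        have hzim : z.im = 2 * t := by simp [hz]
        have hz1 : z ≠ 1 := by
          intro hh; rw [hh] at hzre; simp at hzre; linarith
        have hp2 : (2 : ℝ) ≤ p := by exact_mod_cast hp.two_le
        rw [hχ2]
        have e1 : (1 : DirichletCharacter ℂ p).LFunction z = (1 - (p : ℂ) ^ (-z)) * riemannZeta z := by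
          have := DirichletCharacter.LFunctionTrivChar_eq_mul_riemannZeta (N := p) hz1
          rw [hp.primeFactors, Finset.prod_singleton] at this
          exact this
        have e2 : ‖(p : ℂ) ^ (-z)‖ ≤ 1 := by
          rw [Complex.norm_natCast_cpow_of_pos hp.pos]
          exact rpow_le_one_of_one_le_of_nonpos (by linarith) (by simp [hzre]; linarith)
        have e3 : ‖1 - (p : ℂ) ^ (-z)‖ ≤ 2 := by
          refine (norm_sub_le _ _).trans ?_
          rw [norm_one]; linarith
        have e4 := zeta_upper N hN z (by rw [hzre]; have : 0 < 1 / log N := by positivity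
                                         linarith) (by linarith) (by
          refine (norm_le_re_im z).trans ?_
          rw [hzre, hzim, abs_mul, abs_of_nonneg (by linarith : 0 ≤ 1 + y)]
          norm_num
          nlinarith [abs_nonneg t]) hz1
        have e5 : 2 * |t| ≤ ‖z - 1‖ := by
          have := Complex.abs_im_le_norm (z - 1)
          simp only [Complex.sub_im, hzim, Complex.one_im, sub_zero, abs_mul] at this
          norm_num at this
          exact this
        rw [e1, norm_mul]
        calc ‖1 - (p : ℂ) ^ (-z)‖ * ‖riemannZeta z‖ ≤ 2 * (11 * log N + 3 / (2 * |t|)) := by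
              gcongr
              refine e4.trans ?_
              gcongr
          _ = 22 * log N + 3 / |t| := by field_simp; ring
          _ ≤ 22 * log N + 3 / (δ / (88 * log N ^ 2)) := by gcongr
          _ = (22 * log N * δ + 264 * log N ^ 2) / δ := by field_simp; ring
          _ ≤ 286 * log N ^ 2 / δ := by
              gcongr
              have : log N * δ ≤ log N * log N := by gcongr; linarith
              nlinarith
    · rcases le_or_gt (δ / (88 * log N ^ 2)) x with hxx | hxx
      · have h4 := h341 χ x t hx hx1
        have h5 := L_le_abs (χ ^ 2) (1 + x + 2 * Complex.I * t) x hx hx1 (by simp)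
        set g := ‖χ.LFunction (1 + x + Complex.I * t)‖ with hg
        have h6 : 1 ≤ (3 / x) ^ 3 * g ^ 4 * (3 / x) := h4.trans (by gcongr)
        have h7 : x / 3 ≤ g := by
          refine le_of_pow_le_pow_left₀ (n := 4) (by norm_num) (norm_nonneg _) ?_
          have : (3 / x) ^ 3 * g ^ 4 * (3 / x) = g ^ 4 / (x / 3) ^ 4 := by field_simp
          rw [this, one_le_div (by positivity)] at h6
          exact h6
        refine le_trans ?_ h7
        calc _ ≤ δ / (88 * log N ^ 2) / 3 := by
              rw [div_div]
              refine div_le_div_of_nonneg_left hδ.le (by positivity) ?_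
              nlinarith
          _ ≤ x / 3 := by gcongr
      · set W : Set ℂ := {s | 1 ≤ s.re ∧ s.re ≤ 2 ∧ |s.im| ≤ |t|} with hWd
        have hW : Convex ℝ W := by
          have e : W = {s | 1 ≤ s.re} ∩ ({s | s.re ≤ 2} ∩ ({s | s.im ≤ |t|} ∩ {s | -|t| ≤ s.im})) := by
            ext s; simp [hWd, abs_le]; tauto
          rw [e]
          exact (convex_halfSpace_re_ge 1).inter ((convex_halfSpace_re_le 2).inter
            ((convex_halfSpace_im_le _).inter (convex_halfSpace_im_ge _)))
        have := lip_bound χ.LFunction W hW (1 / (2 * log N)) (11 * log N) (by positivity)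
          (fun s hs => hb0 s hs.1 hs.2.1 hs.2.2) 1 (1 + x + Complex.I * t)
          ⟨by simp, by simp, by simp⟩ ⟨by simp; linarith, by simp; linarith, by simp⟩
        have e1 : ‖(1 + x + Complex.I * t : ℂ) - 1‖ ≤ x + |t| := by
          refine (norm_le_re_im _).trans ?_
          simp [abs_of_pos hx]
        have e2 : ‖χ.LFunction 1‖ ≤ ‖χ.LFunction (1 + x + Complex.I * t)‖ +
            11 * log N / (1 / (2 * log N)) * (x + |t|) := by
          have e3 := norm_le_norm_add_norm_sub (χ.LFunction (1 + x + Complex.I * t)) (χ.LFunction 1)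
          refine e3.trans ?_
          gcongr
          refine this.trans ?_
          gcongr
        have e3 : 11 * log N / (1 / (2 * log N)) * (x + |t|) ≤ δ / 2 := by
          calc 11 * log N / (1 / (2 * log N)) * (x + |t|) ≤
              11 * log N / (1 / (2 * log N)) * (δ / (88 * log N ^ 2) + δ / (88 * log N ^ 2)) := by
                gcongr
            _ = δ / 2 := by field_simp; norm_num
        have e4 : δ / (432 * 286 * 22 ^ 3 * log N ^ 8) ≤ δ / 2 := by
          gcongr
          nlinarith
        linarith
  have := logderiv_bound χ.LFunction (1 + x + Complex.I * t) (1 / (2 * log N)) (11 * log N) _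
      (by positivity) (by positivity)
      (fun w hw => (hb _ (by simp; linarith) (by simp; linarith) (by simp) w hw).1)
      (fun w hw => (hb _ (by simp; linarith) (by simp; linarith) (by simp) w hw).2) hm
  refine this.trans (le_of_eq ?_)
  field_simp
  ring

end NCO

namespace NCO

theorem geom_exp_bound (p a m : ℕ) (ha : 0 < a) (hap : a < p) :
    ‖∑ i ∈ Finset.range m, Complex.exp (Complex.I * ((2 * π * a / p : ℝ) : ℂ)) ^ i‖ ≤
      p / 2 * ((a : ℝ)⁻¹ + ((p - a : ℕ) : ℝ)⁻¹) := by
  have hp0 : (0 : ℝ) < p := by exact_mod_cast (by omega : 0 < p)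
  have ha0 : (0 : ℝ) < a := by exact_mod_cast ha
  have hpa : (0 : ℝ) < p - a := by
    have : (a : ℝ) < p := by exact_mod_cast hap
    linarith
  have hcast : ((p - a : ℕ) : ℝ) = p - a := by push_cast [Nat.cast_sub hap.le]; ring
  rw [hcast]
  set θ : ℝ := 2 * π * a / p with hθ
  have hpi := pi_pos
  have hsin : 2 / p * min (a : ℝ) (p - a) ≤ sin (π * a / p) := by
    rcases le_total (a : ℝ) (p - a) with h | h
    · rw [min_eq_left h]
      have := mul_le_sin (x := π * a / p) (by positivity) (by
        rw [div_le_div_iff₀ hp0 (by norm_num)]; nlinarith)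
      refine le_trans (le_of_eq ?_) this
      field_simp
    · rw [min_eq_right h]
      have e : sin (π * a / p) = sin (π * (p - a) / p) := by
        rw [← sin_pi_sub]; congr 1; field_simp
      rw [e]
      have := mul_le_sin (x := π * (p - a) / p) (by positivity) (by
        rw [div_le_div_iff₀ hp0 (by norm_num)]; nlinarith)
      refine le_trans (le_of_eq ?_) this
      field_simp
  have hmin : 0 < min (a : ℝ) (p - a) := lt_min ha0 hpa
  have hsin0 : 0 < sin (π * a / p) := lt_of_lt_of_le (by positivity) hsin
  have hn : ‖Complex.exp (Complex.I * (θ : ℂ)) - 1‖ = 2 * sin (π * a / p) := by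
    rw [Complex.norm_exp_I_mul_ofReal_sub_one, hθ]
    have : 2 * π * a / p / 2 = π * a / p := by ring
    rw [this, Real.norm_eq_abs, abs_of_pos (by positivity)]
  have hne : Complex.exp (Complex.I * (θ : ℂ)) ≠ 1 := by
    intro h
    rw [h, sub_self, norm_zero] at hn
    linarith
  rw [geom_sum_eq hne, norm_div, hn]
  have hnum : ‖Complex.exp (Complex.I * (θ : ℂ)) ^ m - 1‖ ≤ 2 := by
    refine (norm_sub_le _ _).trans ?_
    rw [norm_pow, mul_comm, Complex.norm_exp_ofReal_mul_I]
    norm_num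
  calc _ ≤ 2 / (2 * sin (π * a / p)) := by gcongr
    _ ≤ 2 / (2 * (2 / p * min (a : ℝ) (p - a))) := by gcongr
    _ = p / 2 * (min (a : ℝ) (p - a))⁻¹ := by field_simp
    _ ≤ _ := by
      gcongr
      rcases le_total (a : ℝ) (p - a) with h | h
      · rw [min_eq_left h]; have : 0 < (p - a : ℝ)⁻¹ := by positivity
        linarith
      · rw [min_eq_right h]; have : 0 < (a : ℝ)⁻¹ := by positivity
        linarith

theorem polya_vinogradov (p : ℕ) [Fact p.Prime] (χ : DirichletCharacter ℂ p) (hχ : χ ≠ 1)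
    (hχ2 : χ ^ 2 = 1) (m : ℕ) :
    ‖∑ i ∈ Finset.range m, χ (i : ZMod p)‖ ≤ √p * (1 + log p) := by
  have hp : p.Prime := Fact.out
  have hp0 : (0 : ℝ) < p := by exact_mod_cast hp.pos
  set ψ := ZMod.stdAddChar (N := p) with hψ
  have hprim : χ.IsPrimitive := by
    rw [DirichletCharacter.isPrimitive_def]
    rcases (Nat.dvd_prime hp).mp χ.conductor_dvd_level with h | h
    · exact absurd (DirichletCharacter.eq_one_iff_conductor_eq_one.mpr h) hχ
    · exact h
  have hinv : χ⁻¹ = χ := by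
    rw [inv_eq_iff_mul_eq_one, ← sq]; exact hχ2
  have hquad : χ.IsQuadratic := MulChar.isQuadratic_iff_sq_eq_one.mpr hχ2
  have htau : ‖gaussSum χ ψ‖ = √p := by
    have h := gaussSum_sq hχ hquad (ZMod.isPrimitive_stdAddChar p)
    have h2 := congrArg norm h
    rw [norm_pow, norm_mul, ZMod.card] at h2
    have h3 : ‖χ (-1)‖ = 1 := by
      have : ‖χ ((-1 : (ZMod p)ˣ) : ZMod p)‖ = 1 := DirichletCharacter.unit_norm_eq_one χ _
      simpa using this
    rw [h3, one_mul, Complex.norm_natCast] at h2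
    rw [← h2, sqrt_sq (norm_nonneg _)]
  have hid : (∑ i ∈ Finset.range m, χ (i : ZMod p)) * gaussSum χ ψ =
      ∑ a : ZMod p, χ a * ∑ i ∈ Finset.range m, ψ a ^ i := by
    rw [Finset.sum_mul]
    have h1 : ∀ i ∈ Finset.range m, χ (i : ZMod p) * gaussSum χ ψ =
        ∑ a : ZMod p, χ a * ψ a ^ i := by
      intro i _
      have := gaussSum_mulShift_of_isPrimitive (e := ψ) hprim (i : ZMod p)
      rw [hinv] at this
      rw [← this, gaussSum]
      refine Finset.sum_congr rfl fun a _ => ?_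
      rw [AddChar.mulShift_apply, ← nsmul_eq_mul, AddChar.map_nsmul_eq_pow]
    rw [Finset.sum_congr rfl h1, Finset.sum_comm]
    refine Finset.sum_congr rfl fun a _ => ?_
    rw [Finset.mul_sum]
  have hb : ‖∑ a : ZMod p, χ a * ∑ i ∈ Finset.range m, ψ a ^ i‖ ≤
      ∑ a ∈ Finset.Ico 1 p, (p : ℝ) / 2 * ((a : ℝ)⁻¹ + ((p - a : ℕ) : ℝ)⁻¹) := by
    have e : ∑ a : ZMod p, χ a * ∑ i ∈ Finset.range m, ψ a ^ i =
        ∑ a ∈ Finset.range p, χ (a : ZMod p) * ∑ i ∈ Finset.range m, ψ (a : ZMod p) ^ i := by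
      symm
      refine Finset.sum_nbij' (fun i => (i : ZMod p)) (fun x => x.val) ?_ ?_ ?_ ?_ ?_
      · intro i _; exact Finset.mem_univ _
      · intro x _; exact Finset.mem_range.mpr (ZMod.val_lt x)
      · intro i hi; exact ZMod.val_natCast_of_lt (Finset.mem_range.mp hi)
      · intro x _; exact ZMod.natCast_zmod_val x
      · intro i _; rfl
    rw [e, Finset.range_eq_Ico, Finset.sum_eq_sum_Ico_succ_bot hp.pos]
    have e0 : χ ((0 : ℕ) : ZMod p) = 0 := by
      rw [Nat.cast_zero]
      exact MulChar.map_nonunit χ not_isUnit_zero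
    rw [e0, zero_mul, zero_add]
    refine norm_sum_le_of_le _ fun a ha => ?_
    obtain ⟨ha1, ha2⟩ := Finset.mem_Ico.mp ha
    rw [norm_mul]
    have e1 : ψ (a : ZMod p) = Complex.exp (Complex.I * ((2 * π * a / p : ℝ) : ℂ)) := by
      have := ZMod.stdAddChar_coe (N := p) (a : ℤ)
      push_cast at this
      rw [hψ, this]
      congr 1
      push_cast; ring
    rw [e1]
    calc _ ≤ 1 * _ := mul_le_mul_of_nonneg_right (χ.norm_le_one _) (norm_nonneg _)
      _ ≤ _ := by rw [one_mul]; exact geom_exp_bound p a m ha1 ha2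
  have hsum : ∑ a ∈ Finset.Ico 1 p, (p : ℝ) / 2 * ((a : ℝ)⁻¹ + ((p - a : ℕ) : ℝ)⁻¹) ≤
      p * (1 + log p) := by
    rw [← Finset.mul_sum, Finset.sum_add_distrib]
    have e1 : ∑ a ∈ Finset.Ico 1 p, ((p - a : ℕ) : ℝ)⁻¹ = ∑ a ∈ Finset.Ico 1 p, (a : ℝ)⁻¹ := by
      refine Finset.sum_nbij' (fun a => p - a) (fun a => p - a) ?_ ?_ ?_ ?_ ?_
      · intro a ha; simp at ha ⊢; omega
      · intro a ha; simp at ha ⊢; omega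
      · intro a ha; simp at ha ⊢; omega
      · intro a ha; simp at ha ⊢; omega
      · intro a ha; rfl
    have e2 : ∑ a ∈ Finset.Ico 1 p, (a : ℝ)⁻¹ ≤ 1 + log p := by
      have := harmonic_le_one_add_log p
      rw [harmonic_eq_sum_Icc] at this
      push_cast at this
      refine le_trans (Finset.sum_le_sum_of_subset_of_nonneg ?_ fun _ _ _ => by positivity) this
      intro a ha; simp at ha ⊢; omega
    rw [e1]
    nlinarith
  have h1 := congrArg norm hid
  rw [norm_mul, htau] at h1
  have h2 := (h1.le.trans hb).trans hsum
  have hs0 : 0 < √(p : ℝ) := sqrt_pos.mpr hp0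
  have hss : √(p : ℝ) * √p = p := mul_self_sqrt hp0.le
  have : √(p : ℝ) * ‖∑ i ∈ Finset.range m, χ (i : ZMod p)‖ ≤ √p * (√p * (1 + log p)) := by
    rw [← mul_assoc, hss, mul_comm]; exact h2
  exact le_of_mul_le_mul_left this hs0

end NCO

namespace NCO

theorem geom_ge (y : ℝ) (hy : 0 ≤ y) (n : ℕ) :
    (n + 1 : ℝ) * y ^ n ≤ ∑ i ∈ Finset.range (n + 1), (y ^ 2) ^ i := by
  have h1 := Finset.sum_range_reflect (fun i => (y ^ 2) ^ i) (n + 1)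
  have h2 : 2 * ∑ i ∈ Finset.range (n + 1), (y ^ 2) ^ i =
      ∑ i ∈ Finset.range (n + 1), ((y ^ 2) ^ i + (y ^ 2) ^ (n + 1 - 1 - i)) := by
    rw [Finset.sum_add_distrib, h1]; ring
  have h3 : ∑ i ∈ Finset.range (n + 1), 2 * y ^ n ≤
      ∑ i ∈ Finset.range (n + 1), ((y ^ 2) ^ i + (y ^ 2) ^ (n + 1 - 1 - i)) := by
    refine Finset.sum_le_sum fun i hi => ?_
    have hi' : i ≤ n := by simp at hi; omega
    obtain ⟨k, rfl⟩ := Nat.exists_eq_add_of_le hi'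
    have : i + k + 1 - 1 - i = k := by omega
    rw [this, ← pow_mul, ← pow_mul]
    have e1 : y ^ (2 * i) = (y ^ i) ^ 2 := by ring
    have e2 : y ^ (2 * k) = (y ^ k) ^ 2 := by ring
    have e3 : y ^ (i + k) = y ^ i * y ^ k := by ring
    rw [e1, e2, e3]
    nlinarith [sq_nonneg (y ^ i - y ^ k)]
  rw [← h2, Finset.sum_const, Finset.card_range, nsmul_eq_mul] at h3
  push_cast at h3
  linarith

/-- Monsky's weights -/
noncomputable def mb (x : ℝ) (n : ℕ) : ℝ := 1 / (n * (1 - x)) - x ^ n / (1 - x ^ n)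

theorem mb_anti (x : ℝ) (hx : 0 < x) (hx1 : x < 1) (n : ℕ) : mb x (n + 2) ≤ mb x (n + 1) := by
  set y := √x with hy
  have hy2 : y ^ 2 = x := sq_sqrt hx.le
  have hy0 : 0 < y := sqrt_pos.mpr hx
  have hy1 : y ≤ 1 := by nlinarith
  set S := ∑ i ∈ Finset.range (n + 1), x ^ i with hS
  have hS1 := geom_ge y hy0.le n
  have hS2 := geom_ge y hy0.le (n + 1)
  rw [hy2] at hS1 hS2
  have e2 : ∑ i ∈ Finset.range (n + 1 + 1), x ^ i = S + x ^ (n + 1) := Finset.sum_range_succ _ _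
  rw [e2] at hS2
  rw [← hS] at hS1
  have h1x : 0 < 1 - x := by linarith
  have hSe : S * (1 - x) = 1 - x ^ (n + 1) := by
    have := geom_sum_mul x (n + 1); rw [← hS] at this; linarith
  have hSe2 : (S + x ^ (n + 1)) * (1 - x) = 1 - x ^ (n + 2) := by
    have := geom_sum_mul x (n + 2); rw [e2] at this; linarith
  have hSe3 : S + x ^ (n + 1) = 1 + x * S := by
    have : (S + x ^ (n + 1) - 1 - x * S) = S * (1 - x) - (1 - x ^ (n + 1)) := by ring
    rw [hSe] at this; linarith
  have hSpos : 0 < S := lt_of_lt_of_le (by positivity) hS1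
  have hx1' : 0 < x ^ (n + 1) := by positivity
  have hmain : ((n : ℝ) + 1) * (n + 2) * x ^ (n + 1) ≤ S * (S + x ^ (n + 1)) := by
    calc ((n : ℝ) + 1) * (n + 2) * x ^ (n + 1) = ((n : ℝ) + 1) * (n + 2) * (y ^ (2 * n + 1) * y) := by
          rw [← hy2]; ring
      _ ≤ ((n : ℝ) + 1) * (n + 2) * (y ^ (2 * n + 1) * 1) := by gcongr
      _ = (((n : ℝ) + 1) * y ^ n) * (((n + 1 : ℕ) + 1 : ℝ) * y ^ (n + 1)) := by push_cast; ring
      _ ≤ S * (S + x ^ (n + 1)) := by gcongr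
  unfold mb
  rw [← hSe, ← hSe2]
  push_cast
  rw [← sub_nonneg]
  have : 1 / (((n : ℝ) + 1) * (1 - x)) - x ^ (n + 1) / (S * (1 - x)) - (1 / (((n : ℝ) + 2) * (1 - x)) -
      x ^ (n + 2) / ((S + x ^ (n + 1)) * (1 - x))) =
      (S * (S + x ^ (n + 1)) - ((n : ℝ) + 1) * (n + 2) * x ^ (n + 1)) /
      (((n : ℝ) + 1) * (n + 2) * S * (S + x ^ (n + 1)) * (1 - x)) := by
    have hSS : S + x ^ (n + 1) ≠ 0 := by positivity
    field_simp
    have e3 : x ^ (n + 2) = x * x ^ (n + 1) := by ring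
    rw [e3]
    have e4 : x * S = S + x ^ (n + 1) - 1 := by linarith
    linear_combination (-(n + 1) * (n + 2) * x ^ (n + 1)) * hSe3
  rw [this]
  apply div_nonneg
  · linarith
  · positivity

theorem mb_nonneg (x : ℝ) (hx : 0 < x) (hx1 : x < 1) (n : ℕ) : 0 ≤ mb x (n + 1) := by
  set S := ∑ i ∈ Finset.range (n + 1), x ^ i with hS
  have hSe : S * (1 - x) = 1 - x ^ (n + 1) := by
    have := geom_sum_mul x (n + 1); rw [← hS] at this; linarith
  have h1x : 0 < 1 - x := by linarith
  have hS1 : ((n : ℝ) + 1) * x ^ (n + 1) ≤ S := by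
    have : ∑ i ∈ Finset.range (n + 1), x ^ (n + 1) ≤ S := by
      refine Finset.sum_le_sum fun i hi => ?_
      exact pow_le_pow_of_le_one hx.le hx1.le (by simp at hi; omega)
    rw [Finset.sum_const, Finset.card_range, nsmul_eq_mul] at this
    push_cast at this; exact this
  have hSpos : 0 < S := lt_of_lt_of_le (by positivity) hS1
  unfold mb
  rw [← hSe]
  push_cast
  rw [sub_nonneg, div_le_div_iff₀ (by positivity) (by positivity)]
  nlinarith

/-- Abel summation with decreasing weights. -/
theorem abel_dec (a : ℕ → ℂ) (b : ℕ → ℝ) (M : ℝ) (hM : ∀ m, ‖∑ i ∈ Finset.range m, a i‖ ≤ M)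
    (hb : ∀ n, b (n + 1) ≤ b n) (hb0 : ∀ n, 0 ≤ b n) (m : ℕ) :
    ‖∑ i ∈ Finset.range m, a i * b i‖ ≤ M * b 0 := by
  have key : ∀ m, ∑ i ∈ Finset.range m, a i * b i = (∑ i ∈ Finset.range m, a i) * b m +
      ∑ k ∈ Finset.range m, (∑ i ∈ Finset.range (k + 1), a i) * ((b k - b (k + 1) : ℝ) : ℂ) := by
    intro m
    induction m with
    | zero => simp
    | succ m ih =>
      rw [Finset.sum_range_succ, ih, Finset.sum_range_succ (fun k => (∑ i ∈ Finset.range (k + 1), a i)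
        * ((b k - b (k + 1) : ℝ) : ℂ))]
      rw [Finset.sum_range_succ a m]
      push_cast
      ring
  rw [key]
  have h1 : ‖(∑ i ∈ Finset.range m, a i) * (b m : ℂ)‖ ≤ M * b m := by
    rw [norm_mul, Complex.norm_real, Real.norm_eq_abs, abs_of_nonneg (hb0 m)]
    exact mul_le_mul_of_nonneg_right (hM m) (hb0 m)
  have h2 : ‖∑ k ∈ Finset.range m, (∑ i ∈ Finset.range (k + 1), a i) * ((b k - b (k + 1) : ℝ) : ℂ)‖ ≤
      ∑ k ∈ Finset.range m, M * (b k - b (k + 1)) := by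
    refine norm_sum_le_of_le _ fun k _ => ?_
    have : 0 ≤ b k - b (k + 1) := by linarith [hb k]
    rw [norm_mul, Complex.norm_real, Real.norm_eq_abs, abs_of_nonneg this]
    exact mul_le_mul_of_nonneg_right (hM _) this
  rw [← Finset.mul_sum, Finset.sum_range_sub'] at h2
  refine (norm_add_le _ _).trans ?_
  linarith

open scoped ComplexOrder in
theorem zetaMul_sq_prime {p : ℕ} (χ : DirichletCharacter ℂ p) (hχ : χ ^ 2 = 1) {q : ℕ}
    (hq : q.Prime) (k : ℕ) : (1 : ℂ) ≤ χ.zetaMul (q ^ (2 * k)) := by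
  have e : χ.zetaMul (q ^ (2 * k)) = ∑ i ∈ Finset.range (2 * k + 1), (χ (q : ZMod p)) ^ i := by
    simp only [DirichletCharacter.zetaMul, ArithmeticFunction.coe_zeta_mul_apply]
    rw [Nat.sum_divisors_prime_pow hq]
    refine Finset.sum_congr rfl fun i _ => ?_
    have : q ^ i ≠ 0 := pow_ne_zero _ hq.ne_zero
    simp [toArithmeticFunction, hq.ne_zero]
  rw [e]
  rcases MulChar.isQuadratic_iff_sq_eq_one.mpr hχ q with h | h | h
  · rw [h, Finset.sum_range_succ']
    simp
  · rw [h]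
    simp only [one_pow, Finset.sum_const, Finset.card_range, nsmul_eq_mul, mul_one]
    exact_mod_cast (by omega : 1 ≤ 2 * k + 1)
  · rw [h, neg_one_geom_sum, if_neg]
    simp

open scoped ComplexOrder in
theorem zetaMul_sq {p : ℕ} (χ : DirichletCharacter ℂ p) (hχ : χ ^ 2 = 1) (k : ℕ) (hk : 1 ≤ k) :
    (1 : ℂ) ≤ χ.zetaMul (k ^ 2) := by
  rw [χ.isMultiplicative_zetaMul.multiplicative_factorization _ (by positivity), Finsupp.prod,
    Nat.factorization_pow]
  have key : ∀ s : Finset ℕ, (∀ q ∈ s, q.Prime) →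
      (1 : ℂ) ≤ ∏ q ∈ s, χ.zetaMul (q ^ ((2 • k.factorization) q)) := by
    intro s
    induction s using Finset.induction_on with
    | empty => simp
    | insert q s hq ih =>
      intro h
      rw [Finset.prod_insert hq]
      have h1 := ih fun q hq => h q (Finset.mem_insert_of_mem hq)
      have h2 := zetaMul_sq_prime χ hχ (h q (Finset.mem_insert_self _ _)) (k.factorization q)
      simp only [Finsupp.smul_apply, smul_eq_mul] at h1 ⊢
      calc (1 : ℂ) ≤ χ.zetaMul (q ^ (2 * k.factorization q)) := h2
        _ = χ.zetaMul (q ^ (2 * k.factorization q)) * 1 := (mul_one _).symm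
        _ ≤ _ := mul_le_mul_of_nonneg_left h1 (zero_le_one.trans h2)
  refine key _ fun q hq => ?_
  have : q ∈ k.factorization.support := Finsupp.support_smul hq
  exact Nat.prime_of_mem_primeFactors this

theorem lambert_lower {p : ℕ} [NeZero p] (χ : DirichletCharacter ℂ p) (hχ2 : χ ^ 2 = 1)
    (x : ℝ) (hx : 0 < x) (hx1 : x < 1) (K : ℕ) :
    ∃ f : ℂ, Tendsto (fun m : ℕ => ∑ i ∈ Finset.range m, χ ((i + 1 : ℕ) : ZMod p) *
      ((x ^ (i + 1) / (1 - x ^ (i + 1)) : ℝ) : ℂ)) atTop (nhds f) ∧ K * x ^ (K ^ 2) ≤ ‖f‖ := by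
  have hxn : ‖(x : ℂ)‖ < 1 := by rw [Complex.norm_real, Real.norm_eq_abs, abs_of_pos hx]; exact hx1
  have hsum : Summable (fun c : ℕ+ × ℕ+ => χ ((c.1 : ℕ) : ZMod p) * (x : ℂ) ^ (c.1 * c.2 : ℕ)) := by
    have h := summable_prod_mul_pow (𝕜 := ℂ) 0 hxn
    refine Summable.of_norm_bounded h.norm fun c => ?_
    rw [norm_mul]
    simp only [pow_zero, one_mul]
    exact mul_le_of_le_one_left (norm_nonneg _) (χ.norm_le_one _)
  set f : ℂ := ∑' c : ℕ+ × ℕ+, χ ((c.1 : ℕ) : ZMod p) * (x : ℂ) ^ (c.1 * c.2 : ℕ) with hf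
  refine ⟨f, ?_, ?_⟩
  · have h1 : HasSum (fun n : ℕ+ => ∑' k : ℕ+, χ ((n : ℕ) : ZMod p) * (x : ℂ) ^ (n * k : ℕ)) f :=
      hsum.hasSum.prod_fiberwise fun n => (hsum.prod_factor n).hasSum
    set g : ℕ → ℂ := fun i => χ ((i + 1 : ℕ) : ZMod p) *
      ((x ^ (i + 1) / (1 - x ^ (i + 1)) : ℝ) : ℂ) with hg
    have h2 : ∀ n : ℕ+, ∑' k : ℕ+, χ ((n : ℕ) : ZMod p) * (x : ℂ) ^ (n * k : ℕ) =
        g (Equiv.pnatEquivNat n) := by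
      intro n
      rw [tsum_mul_left]
      simp only [hg]
      have hn : Equiv.pnatEquivNat n + 1 = (n : ℕ) := by
        simp [Equiv.pnatEquivNat]
      rw [hn]
      congr 1
      rw [tsum_pnat_eq_tsum_succ (f := fun k => (x : ℂ) ^ (n * k : ℕ))]
      have hxn' : ‖(x : ℂ) ^ (n : ℕ)‖ < 1 := by
        rw [norm_pow]; exact pow_lt_one₀ (norm_nonneg _) hxn n.ne_zero
      have := tsum_geometric_of_norm_lt_one hxn'
      calc ∑' k : ℕ, (x : ℂ) ^ ((n : ℕ) * (k + 1)) = ∑' k : ℕ, (x : ℂ) ^ (n : ℕ) * ((x : ℂ) ^ (n : ℕ)) ^ k := by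
            refine tsum_congr fun k => ?_
            rw [← pow_mul, ← pow_add]; ring_nf
        _ = _ := by
            rw [tsum_mul_left, this]; push_cast; rw [div_eq_mul_inv]
    have h3 : HasSum g f := by
      rw [funext h2] at h1
      exact (Equiv.hasSum_iff Equiv.pnatEquivNat).mp h1
    exact h3.tendsto_sum_nat
  · have h1 : HasSum (fun c : (n : ℕ+) × Nat.divisorsAntidiagonal n =>
        χ ((c.2.1.1 : ℕ) : ZMod p) * (x : ℂ) ^ (c.2.1.1 * c.2.1.2 : ℕ)) f :=
      (sigmaAntidiagonalEquivProd.hasSum_iff (f := fun c : ℕ+ × ℕ+ =>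
        χ ((c.1 : ℕ) : ZMod p) * (x : ℂ) ^ (c.1 * c.2 : ℕ))).mpr hsum.hasSum
    have h2 : HasSum (fun n : ℕ+ => χ.zetaMul n * (x : ℂ) ^ (n : ℕ)) f := by
      have := h1.sigma (g := fun n : ℕ+ => χ.zetaMul n * (x : ℂ) ^ (n : ℕ)) fun n => ?_
      · exact this
      · convert hasSum_fintype _ using 1
        rw [Finset.univ_eq_attach]
        rw [(n : ℕ).divisorsAntidiagonal.sum_attach fun y : ℕ × ℕ =>
          χ ((y.1 : ℕ) : ZMod p) * (x : ℂ) ^ (y.1 * y.2)]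
        have e1 : ∀ y ∈ (n : ℕ).divisorsAntidiagonal, χ ((y.1 : ℕ) : ZMod p) * (x : ℂ) ^ (y.1 * y.2) =
            χ ((y.1 : ℕ) : ZMod p) * (x : ℂ) ^ (n : ℕ) := by
          intro y hy; rw [(Nat.mem_divisorsAntidiagonal.mp hy).1]
        rw [Finset.sum_congr rfl e1, ← Finset.sum_mul]
        congr 1
        rw [Nat.sum_divisorsAntidiagonal (fun y _ => χ ((y : ℕ) : ZMod p))]
        simp only [DirichletCharacter.zetaMul, ArithmeticFunction.coe_zeta_mul_apply]
        refine Finset.sum_congr rfl fun i hi => ?_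
        have : i ≠ 0 := (Nat.pos_of_mem_divisors hi).ne'
        simp [toArithmeticFunction, this]
    have h3 : HasSum (fun n : ℕ+ => (χ.zetaMul n).re * x ^ (n : ℕ)) f.re := by
      have := Complex.hasSum_re h2
      convert this using 2 with n
      rw [← Complex.ofReal_pow, Complex.re_mul_ofReal]
    have hnn : ∀ n : ℕ, 0 ≤ (χ.zetaMul n).re := fun n =>
      (Complex.nonneg_iff.mp (DirichletCharacter.zetaMul_nonneg hχ2 n)).1
    have hsq : ∀ k : ℕ, 1 ≤ k → 1 ≤ (χ.zetaMul (k ^ 2)).re := fun k hk =>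
      by
      have := (Complex.le_def.mp (zetaMul_sq χ hχ2 k hk)).1
      simpa using this
    have h4 : ∑ n ∈ (Finset.Icc 1 K).image (fun k => (k ^ 2).toPNat'),
        (χ.zetaMul n).re * x ^ (n : ℕ) ≤ f.re :=
      sum_le_hasSum _ (fun n _ => mul_nonneg (hnn n) (by positivity)) h3
    refine le_trans ?_ (h4.trans (Complex.re_le_norm f))
    rw [Finset.sum_image]
    · have : ∑ k ∈ Finset.Icc 1 K, x ^ (K ^ 2) ≤ ∑ k ∈ Finset.Icc 1 K,
        (χ.zetaMul (k ^ 2).toPNat').re * x ^ ((k ^ 2).toPNat' : ℕ) := by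
        refine Finset.sum_le_sum fun k hk => ?_
        obtain ⟨hk1, hk2⟩ := Finset.mem_Icc.mp hk
        have e : ((k ^ 2).toPNat' : ℕ) = k ^ 2 := by
          rw [Nat.toPNat'_coe, if_pos (by positivity)]
        rw [e]
        have e1 : x ^ (K ^ 2) ≤ x ^ (k ^ 2) :=
          pow_le_pow_of_le_one hx.le hx1.le (Nat.pow_le_pow_left hk2 2)
        have e2 := hsq k hk1
        have e3 : 0 < x ^ (k ^ 2) := by positivity
        nlinarith
      simpa using this
    · intro a ha b hb hab
      simp at ha hb
      have := congrArg (fun n : ℕ+ => (n : ℕ)) hab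
      simp only [Nat.toPNat'_coe] at this
      rw [if_pos (pow_pos (by omega) 2), if_pos (pow_pos (by omega) 2)] at this
      exact Nat.pow_left_injective (n := 2) (by norm_num) this

theorem L_one_lower {p : ℕ} [NeZero p] (χ : DirichletCharacter ℂ p) (hχ : χ ≠ 1) (hχ2 : χ ^ 2 = 1)
    (hz : χ 0 = 0)
    (M : ℝ) (hM1 : 1 ≤ M) (hM : ∀ m, ‖∑ i ∈ Finset.range m, χ (i : ZMod p)‖ ≤ M) :
    1 / (40 * M) ≤ ‖χ.LFunction 1‖ := by
  set K := ⌈4 * M⌉₊ with hK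
  have hK1 : 4 * M ≤ K := Nat.le_ceil _
  have hK2 : (K : ℝ) < 4 * M + 1 := Nat.ceil_lt_add_one (by linarith)
  have hK0 : (0 : ℝ) < K := by linarith
  set x : ℝ := 1 - 1 / (2 * K ^ 2) with hx
  have hKK : 1 / (2 * (K : ℝ) ^ 2) ≤ 1 / 2 := by
    gcongr
    nlinarith
  have hx0 : 0 < x := by rw [hx]; linarith
  have hx1 : x < 1 := by
    have : 0 < 1 / (2 * (K : ℝ) ^ 2) := by positivity
    rw [hx]; linarith
  obtain ⟨f, hf1, hf2⟩ := lambert_lower χ hχ2 x hx0 hx1 K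
  have hfK : (K : ℝ) / 2 ≤ ‖f‖ := by
    refine le_trans ?_ hf2
    have := one_add_mul_le_pow (a := -(1 / (2 * (K : ℝ) ^ 2))) (by linarith) (K ^ 2)
    push_cast at this
    have e : (1 : ℝ) + K ^ 2 * -(1 / (2 * K ^ 2)) = 1 / 2 := by field_simp; ring
    rw [e, ← sub_eq_add_neg, ← hx] at this
    nlinarith
  have hLt : Tendsto (fun m : ℕ => ∑ i ∈ Finset.range m, χ ((i + 1 : ℕ) : ZMod p) *
      ((1 / ((i + 1 : ℕ) : ℝ) : ℝ) : ℂ)) atTop (nhds (χ.LFunction 1)) := by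
    rw [tendsto_iff_norm_sub_tendsto_zero]
    have hlim : Tendsto (fun m : ℕ => 2 * p * ((m : ℝ)⁻¹)) atTop (nhds 0) := by
      have := (tendsto_inv_atTop_nhds_zero_nat (𝕜 := ℝ)).const_mul (2 * p : ℝ)
      simpa using this
    refine squeeze_zero' (Eventually.of_forall fun _ => norm_nonneg _) ?_ hlim
    filter_upwards [eventually_ge_atTop 1] with m hm
    have := L_trunc χ hχ m hm 1 (by simp)
    rw [norm_sub_rev]
    have e : ∑ i ∈ Finset.range m, χ ((i + 1 : ℕ) : ZMod p) * ((1 / ((i + 1 : ℕ) : ℝ) : ℝ) : ℂ) =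
        ∑ n ∈ Finset.Icc 1 m, χ n * (n : ℂ) ^ (-(1 : ℂ)) := by
      rw [Finset.range_eq_Ico, Finset.sum_Ico_add' (fun n : ℕ => χ (n : ZMod p) *
        ((1 / (n : ℝ) : ℝ) : ℂ)) 0 m 1]
      have : Finset.Ico (0 + 1) (m + 1) = Finset.Icc 1 m := by ext; simp
      rw [this]
      refine Finset.sum_congr rfl fun n _ => ?_
      rw [Complex.cpow_neg_one]; push_cast; rw [one_div]
    rw [e]
    simpa [rpow_neg_one] using this
  have hbt : Tendsto (fun m : ℕ => ∑ i ∈ Finset.range m, χ ((i + 1 : ℕ) : ZMod p) *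
      (mb x (i + 1) : ℂ)) atTop (nhds (χ.LFunction 1 * ((1 / (1 - x) : ℝ) : ℂ) - f)) := by
    refine ((hLt.mul_const _).sub hf1).congr fun m => ?_
    rw [Finset.sum_mul, ← Finset.sum_sub_distrib]
    refine Finset.sum_congr rfl fun i _ => ?_
    rw [mul_assoc, ← mul_sub, ← Complex.ofReal_mul, ← Complex.ofReal_sub]
    congr 2
    unfold mb
    rw [one_div_mul_one_div]
  have hle : ‖χ.LFunction 1 * ((1 / (1 - x) : ℝ) : ℂ) - f‖ ≤ M := by
    refine le_of_tendsto hbt.norm (Eventually.of_forall fun m => ?_)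
    have hM' : ∀ m, ‖∑ i ∈ Finset.range m, χ ((i + 1 : ℕ) : ZMod p)‖ ≤ M := by
      intro m
      have := hM (m + 1)
      rw [Finset.sum_range_succ'] at this
      simpa [hz] using this
    have := abel_dec (fun i => χ ((i + 1 : ℕ) : ZMod p)) (fun i => mb x (i + 1)) M hM'
      (fun n => mb_anti x hx0 hx1 n) (fun n => mb_nonneg x hx0 hx1 n) m
    refine this.trans (le_of_eq ?_)
    have : mb x (0 + 1) = 1 := by
      unfold mb
      have : 1 - x ≠ 0 := by linarith
      simp
      field_simp
    rw [this, mul_one]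
  have h1 : ‖f‖ ≤ ‖χ.LFunction 1‖ * (2 * K ^ 2) + M := by
    have e : 1 / (1 - x) = 2 * (K : ℝ) ^ 2 := by rw [hx]; field_simp; ring
    have := norm_le_norm_add_norm_sub (χ.LFunction 1 * ((1 / (1 - x) : ℝ) : ℂ)) f
    rw [norm_sub_rev, norm_mul, Complex.norm_real, e, Real.norm_eq_abs,
      abs_of_pos (by positivity)] at this
    rw [e] at hle
    rw [norm_sub_rev] at hle
    first | linarith | (rw [norm_sub_rev] at hle; linarith)
  rw [div_le_iff₀ (by linarith)]
  have hn := norm_nonneg (χ.LFunction 1)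
  have h2 : (K : ℝ) / 4 ≤ ‖χ.LFunction 1‖ * (2 * K ^ 2) := by linarith
  have h3 : 1 ≤ ‖χ.LFunction 1‖ * (8 * K) := by
    have : (K : ℝ) * 1 ≤ K * (‖χ.LFunction 1‖ * (8 * K)) := by nlinarith
    exact le_of_mul_le_mul_left this hK0
  have : ‖χ.LFunction 1‖ * (8 * K) ≤ ‖χ.LFunction 1‖ * (40 * M) :=
    mul_le_mul_of_nonneg_left (by linarith) hn
  linarith

end NCO

namespace NCO

/-- The Fejer type kernel -/
noncomputable def fk (t : ℝ) : ℂ :=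
  (Set.Ioc 0 1).indicator (fun _ => (1 : ℂ)) t - (Set.Ioc 0 1).indicator (fun t : ℝ => (t : ℂ) ^ (1 : ℂ)) t

theorem fk_eq (t : ℝ) (ht : 0 < t) : fk t = ((max (1 - t) 0 : ℝ) : ℂ) := by
  unfold fk
  by_cases h : t ≤ 1
  · rw [Set.indicator_of_mem (by exact ⟨ht, h⟩), Set.indicator_of_mem (by exact ⟨ht, h⟩),
      max_eq_left (by linarith)]
    simp
  · rw [Set.indicator_of_notMem (by simp [h]), Set.indicator_of_notMem (by simp [h]),
      max_eq_right (by linarith)]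
    simp

theorem fk_mellin (s : ℂ) (hs : 0 < s.re) : HasMellin fk s (1 / (s * (s + 1))) := by
  have h1 := hasMellin_one_Ioc hs
  have h2 := hasMellin_cpow_Ioc 1 (s := s) (by simp; linarith)
  have h3 := hasMellin_sub h1.1 h2.1
  rw [h1.2, h2.2] at h3
  have hs0 : s ≠ 0 := by intro h; simp [h] at hs
  have hs1 : s + 1 ≠ 0 := by
    intro h
    have := congrArg Complex.re h
    simp at this; linarith
  have e : 1 / s - 1 / (s + 1) = 1 / (s * (s + 1)) := by field_simp; ring
  rw [e] at h3
  exact h3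

theorem ker_norm (σ : ℝ) (hσ : 1 ≤ σ) (y : ℝ) :
    ‖1 / (((σ : ℂ) + y * Complex.I) * (((σ : ℂ) + y * Complex.I) + 1))‖ ≤ (1 + y ^ 2)⁻¹ := by
  rw [norm_div, norm_one, norm_mul, one_div]
  have h1 : √(1 + y ^ 2) ≤ ‖(σ : ℂ) + y * Complex.I‖ := by
    rw [Complex.norm_add_mul_I]; apply sqrt_le_sqrt; nlinarith
  have h2 : √(1 + y ^ 2) ≤ ‖(σ : ℂ) + y * Complex.I + 1‖ := by
    have : (σ : ℂ) + y * Complex.I + 1 = ((σ + 1 : ℝ) : ℂ) + y * Complex.I := by push_cast; ring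
    rw [this, Complex.norm_add_mul_I]; apply sqrt_le_sqrt; nlinarith
  have h3 : 1 + y ^ 2 = √(1 + y ^ 2) * √(1 + y ^ 2) := (mul_self_sqrt (by positivity)).symm
  rw [h3]
  have : 0 < √(1 + y ^ 2) := sqrt_pos.mpr (by positivity)
  gcongr

theorem fk_inv (σ : ℝ) (hσ : 1 ≤ σ) (u : ℝ) (hu : 0 < u) :
    ((max (1 - u) 0 : ℝ) : ℂ) = (1 / (2 * π) : ℝ) • ∫ y : ℝ, (u : ℂ) ^ (-((σ : ℂ) + y * Complex.I)) *
      (1 / (((σ : ℂ) + y * Complex.I) * (((σ : ℂ) + y * Complex.I) + 1))) := by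
  have hm : ∀ y : ℝ, mellin fk ((σ : ℂ) + y * Complex.I) =
      1 / (((σ : ℂ) + y * Complex.I) * (((σ : ℂ) + y * Complex.I) + 1)) := fun y =>
    (fk_mellin _ (by simp; linarith)).2
  have h := mellinInv_mellin_eq σ fk hu (fk_mellin (σ : ℂ) (by simp; linarith)).1 ?_ ?_
  · rw [fk_eq u hu] at h
    rw [← h]
    unfold mellinInv
    simp only [smul_eq_mul, hm]
  · unfold Complex.VerticalIntegrable
    simp only [hm]
    refine MeasureTheory.Integrable.mono' integrable_inv_one_add_sq ?_
      (MeasureTheory.ae_of_all _ fun y => ker_norm σ hσ y)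
    apply Continuous.aestronglyMeasurable
    refine continuous_const.div (by fun_prop) fun y h => ?_
    rcases mul_eq_zero.mp h with h | h
    · have := congrArg Complex.re h; simp at this; linarith
    · have := congrArg Complex.re h; simp at this; linarith
  · have : fk =ᶠ[nhds u] fun t => ((max (1 - t) 0 : ℝ) : ℂ) := by
      filter_upwards [lt_mem_nhds hu] with t ht using fk_eq t ht
    rw [continuousAt_congr this]
    fun_prop

/-- the constant in Perron -/
noncomputable def KP : ℝ := ∫ y : ℝ, (1 + ‖y‖ ^ 2) ^ (-(3 / 2 : ℝ) / 2)

theorem perron (a : ℕ → ℂ) (σ : ℝ) (hσ : 1 < σ) (ha : LSeriesSummable a σ) (B : ℝ)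
    (hB : ∀ t : ℝ, ‖LSeries a (σ + t * Complex.I)‖ ≤ B * (1 + ‖t‖ ^ 2) ^ (1 / 4 : ℝ))
    (x : ℝ) (hx : 1 ≤ x) :
    ‖∑ n ∈ Finset.Icc 1 ⌊x⌋₊, a n * ((1 - n / x : ℝ) : ℂ)‖ ≤ KP * B * x ^ σ := by
  have hx0 : 0 < x := by linarith
  set K : ℝ → ℂ := fun y => 1 / (((σ : ℂ) + y * Complex.I) * (((σ : ℂ) + y * Complex.I) + 1)) with hK
  have hKc : Continuous K := by
    refine continuous_const.div (by fun_prop) fun y h => ?_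
    rcases mul_eq_zero.mp h with h | h
    · have := congrArg Complex.re h; simp at this; linarith
    · have := congrArg Complex.re h; simp at this; linarith
  have hKi : MeasureTheory.Integrable K :=
    MeasureTheory.Integrable.mono' integrable_inv_one_add_sq hKc.aestronglyMeasurable
      (MeasureTheory.ae_of_all _ fun y => ker_norm σ hσ.le y)
  set g : ℕ → ℝ → ℂ := fun n y => (x : ℂ) ^ ((σ : ℂ) + y * Complex.I) *
    LSeries.term a ((σ : ℂ) + y * Complex.I) n * K y with hg
  have hgn : ∀ n y, ‖g n y‖ = x ^ σ * ‖LSeries.term a σ n‖ * ‖K y‖ := by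
    intro n y
    simp only [hg]
    rw [norm_mul, norm_mul, Complex.norm_cpow_eq_rpow_re_of_pos hx0, LSeries.norm_term_eq,
      LSeries.norm_term_eq]
    simp
  have hgm : ∀ n, MeasureTheory.AEStronglyMeasurable (g n) := by
    intro n
    apply Continuous.aestronglyMeasurable
    simp only [hg]
    refine Continuous.mul (Continuous.mul ?_ ?_) hKc
    · exact Continuous.const_cpow (by fun_prop) (Or.inl (by exact_mod_cast hx0.ne'))
    · rcases eq_or_ne n 0 with rfl | hn
      · simp only [LSeries.term_zero]; fun_prop
      · simp only [LSeries.term_of_ne_zero hn]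
        refine continuous_const.div (Continuous.const_cpow (by fun_prop) (Or.inl (by exact_mod_cast hn)))
          fun y => ?_
        simp [Complex.cpow_eq_zero_iff, hn]
  have hgi : ∀ n, MeasureTheory.Integrable (g n) := by
    intro n
    refine MeasureTheory.Integrable.mono' (hKi.norm.const_mul (x ^ σ * ‖LSeries.term a σ n‖)) (hgm n)
      (MeasureTheory.ae_of_all _ fun y => (hgn n y).le)
  have hgs : Summable fun n => ∫ y, ‖g n y‖ := by
    simp only [hgn, MeasureTheory.integral_const_mul]
    exact (ha.norm.mul_left (x ^ σ)).mul_right _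
  have hsum := MeasureTheory.hasSum_integral_of_summable_integral_norm hgi hgs
  have hintg : ∀ n : ℕ, n ≠ 0 → a n * ((max (1 - n / x) 0 : ℝ) : ℂ) = (1 / (2 * π) : ℝ) • ∫ y, g n y := by
    intro n hn
    have hn0 : (0 : ℝ) < n := by positivity
    rw [fk_inv σ hσ.le (n / x) (by positivity), mul_smul_comm, ← MeasureTheory.integral_const_mul]
    congr 2
    ext y
    simp only [hg, LSeries.term_of_ne_zero hn, hK]
    rw [← mul_assoc]
    congr 1
    rw [Complex.cpow_neg]
    push_cast
    rw [← Complex.ofReal_natCast, Complex.div_cpow_ofReal_nonneg hn0.le hx0.le] 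
    rw [inv_div]
    ring
  have hz : ∫ y, g 0 y = 0 := by simp [hg]
  have e1 : ∑ n ∈ Finset.Icc 1 ⌊x⌋₊, a n * ((1 - n / x : ℝ) : ℂ) =
      (1 / (2 * π) : ℝ) • ∑' n, ∫ y, g n y := by
    rw [← tsum_const_smul'' , tsum_eq_sum (s := Finset.Icc 1 ⌊x⌋₊)]
    · refine Finset.sum_congr rfl fun n hn => ?_
      obtain ⟨h1, h2⟩ := Finset.mem_Icc.mp hn
      rw [← hintg n (by omega), max_eq_left]
      have := (Nat.le_floor_iff hx0.le).mp h2
      rw [sub_nonneg, div_le_one hx0]; exact this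
    · intro n hn
      rcases eq_or_ne n 0 with rfl | hn0
      · rw [hz]; simp
      · rw [← hintg n hn0, max_eq_right]
        · simp
        · have : ¬ n ≤ ⌊x⌋₊ := fun h => hn (Finset.mem_Icc.mpr ⟨by omega, h⟩)
          rw [Nat.le_floor_iff hx0.le, not_le] at this
          rw [sub_nonpos, one_le_div hx0]; exact this.le
  rw [e1, hsum.tsum_eq, norm_smul]
  have hpt : ∀ y, ‖∑' n, g n y‖ ≤ x ^ σ * B * (1 + ‖y‖ ^ 2) ^ (-(3 / 2 : ℝ) / 2) := by
    intro y
    simp only [hg]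
    rw [tsum_mul_right, tsum_mul_left, norm_mul, norm_mul, Complex.norm_cpow_eq_rpow_re_of_pos hx0]
    have h1 : ‖∑' n, LSeries.term a ((σ : ℂ) + y * Complex.I) n‖ ≤ B * (1 + ‖y‖ ^ 2) ^ (1 / 4 : ℝ) := hB y
    have h2 : ‖K y‖ ≤ (1 + ‖y‖ ^ 2)⁻¹ := by
      rw [Real.norm_eq_abs y, sq_abs]; exact ker_norm σ hσ.le y
    have h3 : (1 + ‖y‖ ^ 2) ^ (-(3 / 2 : ℝ) / 2) = (1 + ‖y‖ ^ 2) ^ (1 / 4 : ℝ) * (1 + ‖y‖ ^ 2)⁻¹ := by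
      rw [← rpow_neg_one, ← rpow_add (by positivity)]; norm_num
    rw [h3]
    have hre : ((σ : ℂ) + y * Complex.I).re = σ := by simp
    rw [hre]
    have hBB := (norm_nonneg _).trans h1
    calc x ^ σ * ‖∑' n, LSeries.term a ((σ : ℂ) + y * Complex.I) n‖ * ‖K y‖
        ≤ x ^ σ * (B * (1 + ‖y‖ ^ 2) ^ (1 / 4 : ℝ)) * (1 + ‖y‖ ^ 2)⁻¹ := by gcongr
      _ = _ := by ring
  have hI : MeasureTheory.Integrable (fun y : ℝ => (1 + ‖y‖ ^ 2) ^ (-(3 / 2 : ℝ) / 2)) :=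
    integrable_rpow_neg_one_add_norm_sq (by simp; norm_num)
  have hle := MeasureTheory.norm_integral_le_of_norm_le (hI.const_mul (x ^ σ * B))
    (MeasureTheory.ae_of_all _ hpt)
  rw [MeasureTheory.integral_const_mul] at hle
  have h2 : ‖(1 / (2 * π) : ℝ)‖ ≤ 1 := by
    rw [Real.norm_eq_abs, abs_of_pos (by positivity), div_le_one (by positivity)]
    linarith [pi_gt_three]
  calc _ ≤ 1 * ‖∫ y, ∑' n, g n y‖ := by gcongr
    _ ≤ 1 * (x ^ σ * B * KP) := by gcongr; exact hle
    _ = _ := by ring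

end NCO

namespace NCO

theorem logpow_le (k : ℕ) : ∃ C : ℝ, 0 < C ∧ ∀ u : ℝ, 1 ≤ u → log u ^ k ≤ C * u ^ (1 / 2 : ℝ) := by
  rcases Nat.eq_zero_or_pos k with rfl | hk
  · refine ⟨1, one_pos, fun u hu => ?_⟩
    simpa using one_le_rpow hu (by norm_num : (0 : ℝ) ≤ 1 / 2)
  · have hk' : (0 : ℝ) < k := by exact_mod_cast hk
    refine ⟨(2 * k) ^ k, by positivity, fun u hu => ?_⟩
    have h := log_le_rpow_div (x := u) (ε := 1 / (2 * k)) (by linarith) (by positivity)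
    calc log u ^ k ≤ (u ^ (1 / (2 * k) : ℝ) / (1 / (2 * k))) ^ k := by
          gcongr
          exact log_nonneg hu
      _ = (2 * k) ^ k * (u ^ (1 / (2 * k) : ℝ)) ^ k := by rw [div_div_eq_mul_div, div_one, mul_pow]; ring
      _ = (2 * k) ^ k * u ^ (1 / 2 : ℝ) := by
          rw [← rpow_mul_natCast (by linarith)]; congr 2; field_simp

theorem lser_second (f : ℕ → ℂ) (G : ℂ → ℂ) (hf : ∀ s : ℂ, 1 < s.re → LSeriesSummable f s)
    (hG : ∀ s : ℂ, 1 < s.re → LSeries f s = G s) (s : ℂ) (hs : 1 < s.re) :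
    LSeriesSummable (fun n => (log n : ℂ) ^ 2 * f n) s ∧
    LSeries (fun n => (log n : ℂ) ^ 2 * f n) s = deriv (deriv G) s := by
  have hab : LSeries.abscissaOfAbsConv f ≤ (1 : ℝ) :=
    LSeries.abscissaOfAbsConv_le_of_forall_lt_LSeriesSummable fun y hy => hf y (by simpa using hy)
  have hab' : LSeries.abscissaOfAbsConv f < s.re := lt_of_le_of_lt hab (by exact_mod_cast hs)
  have e : (fun n : ℕ => (log n : ℂ) ^ 2 * f n) = LSeries.logMul^[2] f := by
    ext n
    simp only [Function.iterate_succ, Function.iterate_zero, Function.comp, id, LSeries.logMul]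
    rw [← Complex.natCast_log]
    ring
  rw [e]
  constructor
  · exact LSeriesSummable_of_abscissaOfAbsConv_lt_re (by rwa [LSeries.absicssaOfAbsConv_logPowMul])
  · have h1 := LSeries_iteratedDeriv (f := f) 2 hab'
    rw [iteratedDeriv_succ, iteratedDeriv_one] at h1
    have hop : IsOpen {s : ℂ | 1 < s.re} := isOpen_lt continuous_const Complex.continuous_re
    have h2 : LSeries f =ᶠ[nhds s] G := by
      filter_upwards [hop.mem_nhds hs] with w hw using hG w hw
    rw [h2.deriv.deriv_eq] at h1
    rw [h1]; norm_num

theorem lser_chi {p : ℕ} [NeZero p] (χ : DirichletCharacter ℂ p) (s : ℂ) (hs : 1 < s.re) :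
    LSeriesSummable (fun n => (log n : ℂ) ^ 2 * (χ n * ArithmeticFunction.vonMangoldt n)) s ∧
    LSeries (fun n => (log n : ℂ) ^ 2 * (χ n * ArithmeticFunction.vonMangoldt n)) s =
      deriv (deriv (fun s => -deriv χ.LFunction s / χ.LFunction s)) s := by
  refine lser_second _ _ (fun s hs => χ.LSeriesSummable_twist_vonMangoldt hs) (fun s hs => ?_) s hs
  refine (χ.LSeries_twist_vonMangoldt_eq hs).trans ?_
  rw [← χ.LFunction_eq_LSeries hs]
  have hop : IsOpen {s : ℂ | 1 < s.re} := isOpen_lt continuous_const Complex.continuous_re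
  have h2 : LSeries (fun n => χ n) =ᶠ[nhds s] χ.LFunction := by
    filter_upwards [hop.mem_nhds hs] with w hw using (χ.LFunction_eq_LSeries hw).symm
  rw [h2.deriv_eq]

theorem lser_zeta (s : ℂ) (hs : 1 < s.re) :
    LSeriesSummable (fun n => (log n : ℂ) ^ 2 * ((ArithmeticFunction.vonMangoldt n : ℂ) - 1)) s ∧
    LSeries (fun n => (log n : ℂ) ^ 2 * ((ArithmeticFunction.vonMangoldt n : ℂ) - 1)) s =
      deriv (deriv (fun s => -deriv riemannZeta s / riemannZeta s - riemannZeta s)) s := by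
  refine lser_second _ _ (fun s hs => ?_) (fun s hs => ?_) s hs
  · exact (ArithmeticFunction.LSeriesSummable_vonMangoldt hs).sub (LSeriesSummable_one_iff.mpr hs)
  · have := LSeries_sub (ArithmeticFunction.LSeriesSummable_vonMangoldt hs) (LSeriesSummable_one_iff.mpr hs)
    refine Eq.trans ?_ (this.trans ?_)
    · rfl
    · rw [ArithmeticFunction.LSeries_vonMangoldt_eq_deriv_riemannZeta_div hs, LSeries_one_eq_riemannZeta hs]

theorem w_bound (t : ℝ) : 2 * |t| + 4 ≤ 6 * (1 + ‖t‖ ^ 2) ^ (1 / 2 : ℝ) ∧ 1 ≤ (1 + ‖t‖ ^ 2) ^ (1 / 2 : ℝ) := by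
  rw [← sqrt_eq_rpow, Real.norm_eq_abs]
  have h1 : |t| ≤ √(1 + |t| ^ 2) := le_sqrt_of_sq_le (by linarith)
  have h2 : 1 ≤ √(1 + |t| ^ 2) := le_sqrt_of_sq_le (by nlinarith [sq_nonneg |t|])
  exact ⟨by linarith, h2⟩

theorem N_choice (p : ℕ) (hp : 1 ≤ p) (t : ℝ) : ∃ N : ℕ, 3 ≤ N ∧ 2 * p * (2 * |t| + 4) ≤ N ∧
    p ≤ N ∧ (N : ℝ) ≤ 13 * p * (1 + ‖t‖ ^ 2) ^ (1 / 2 : ℝ) := by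
  obtain ⟨h1, h2⟩ := w_bound t
  have hp' : (1 : ℝ) ≤ p := by exact_mod_cast hp
  have ht := abs_nonneg t
  have h0 : 8 * (p : ℝ) ≤ 2 * p * (2 * |t| + 4) := by nlinarith
  have hN : 2 * p * (2 * |t| + 4) ≤ (⌈2 * p * (2 * |t| + 4)⌉₊ : ℝ) := Nat.le_ceil _
  refine ⟨⌈2 * p * (2 * |t| + 4)⌉₊, ?_, hN, ?_, ?_⟩
  · have : (3 : ℝ) ≤ (⌈2 * p * (2 * |t| + 4)⌉₊ : ℝ) := by linarith
    exact_mod_cast this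
  · have : (p : ℝ) ≤ (⌈2 * p * (2 * |t| + 4)⌉₊ : ℝ) := by linarith
    exact_mod_cast this
  · have := (Nat.ceil_lt_add_one (by positivity : 0 ≤ 2 * p * (2 * |t| + 4))).le
    refine this.trans ?_
    nlinarith

theorem logN_pow (k : ℕ) : ∃ C : ℝ, 0 < C ∧ ∀ (p N : ℕ) (t : ℝ), 1 ≤ p → 1 ≤ N →
    (N : ℝ) ≤ 13 * p * (1 + ‖t‖ ^ 2) ^ (1 / 2 : ℝ) →
    log N ^ k ≤ C * √p * (1 + ‖t‖ ^ 2) ^ (1 / 4 : ℝ) := by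
  obtain ⟨C, hC, h⟩ := logpow_le k
  refine ⟨C * (13 : ℝ) ^ (1 / 2 : ℝ), by positivity, fun p N t hp hN1 hN => ?_⟩
  refine (h N (by exact_mod_cast hN1)).trans ?_
  calc C * (N : ℝ) ^ (1 / 2 : ℝ) ≤ C * (13 * p * (1 + ‖t‖ ^ 2) ^ (1 / 2 : ℝ)) ^ (1 / 2 : ℝ) := by gcongr
    _ = C * (13 : ℝ) ^ (1 / 2 : ℝ) * √p * (1 + ‖t‖ ^ 2) ^ (1 / 4 : ℝ) := by
      rw [mul_rpow (by positivity) (by positivity), mul_rpow (by positivity) (by positivity),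
        ← rpow_mul (by positivity), sqrt_eq_rpow]
      norm_num
      ring

theorem B_complex : ∃ C : ℝ, 0 < C ∧ ∀ (p : ℕ) [NeZero p] (χ : DirichletCharacter ℂ p), χ ≠ 1 → χ ^ 2 ≠ 1 →
    ∀ σ t : ℝ, 1 < σ → σ ≤ 2 →
    ‖LSeries (fun n => (log n : ℂ) ^ 2 * (χ n * ArithmeticFunction.vonMangoldt n)) (σ + t * Complex.I)‖ ≤
      C * p * (1 + ‖t‖ ^ 2) ^ (1 / 4 : ℝ) := by
  obtain ⟨C, hC, h⟩ := logN_pow 27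
  refine ⟨14 * (22 ^ 4 * (432 * 11)) ^ 3 * C, by positivity, fun p _ χ h1 h2 σ t hσ hσ2 => ?_⟩
  have hp : 1 ≤ p := NeZero.one_le
  have hp' : (1 : ℝ) ≤ p := by exact_mod_cast hp
  obtain ⟨N, hN3, hN, _, hN2⟩ := N_choice p hp t
  rw [(lser_chi χ _ (by simpa using hσ)).2]
  have e : (σ : ℂ) + t * Complex.I = 1 + ((σ - 1 : ℝ) : ℂ) + Complex.I * t := by push_cast; ring
  rw [e]
  refine (second_complex χ h1 h2 N hN3 t hN (σ - 1) (by linarith) (by linarith)).trans ?_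
  have := h p N t hp (by omega) hN2
  have hs : √(p : ℝ) ≤ p := by rw [sqrt_le_left (by linarith)]; nlinarith
  calc 14 * (22 ^ 4 * (432 * 11)) ^ 3 * log N ^ 27 ≤
      14 * (22 ^ 4 * (432 * 11)) ^ 3 * (C * √p * (1 + ‖t‖ ^ 2) ^ (1 / 4 : ℝ)) := by gcongr
    _ ≤ 14 * (22 ^ 4 * (432 * 11)) ^ 3 * (C * p * (1 + ‖t‖ ^ 2) ^ (1 / 4 : ℝ)) := by gcongr
    _ = _ := by ring

theorem B_real : ∃ C : ℝ, 0 < C ∧ ∀ (p : ℕ) [Fact p.Prime] (χ : DirichletCharacter ℂ p), χ ≠ 1 → χ ^ 2 = 1 →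
    ∀ σ t : ℝ, 1 < σ → σ ≤ 2 →
    ‖LSeries (fun n => (log n : ℂ) ^ 2 * (χ n * ArithmeticFunction.vonMangoldt n)) (σ + t * Complex.I)‖ ≤
      C * p ^ 2 * (1 + ‖t‖ ^ 2) ^ (1 / 4 : ℝ) := by
  obtain ⟨C, hC, h⟩ := logN_pow 33
  refine ⟨14 * (22 ^ 4 * (432 * 286)) ^ 3 * 512000 * C, by positivity, fun p hpp χ h1 h2 σ t hσ hσ2 => ?_⟩
  have hp : 1 ≤ p := NeZero.one_le
  have hp' : (1 : ℝ) ≤ p := by exact_mod_cast hp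
  obtain ⟨N, hN3, hN, hpN, hN2⟩ := N_choice p hp t
  have hlp : 0 ≤ log p := log_nonneg hp'
  have hsp : 1 ≤ √(p : ℝ) := one_le_sqrt.mpr hp'
  set M := √(p : ℝ) * (1 + log p) with hM
  have hM1 : 1 ≤ M := by rw [hM]; nlinarith
  have hL := L_one_lower χ h1 h2 (MulChar.map_nonunit χ not_isUnit_zero) M hM1 (polya_vinogradov p χ h1 h2)
  rw [(lser_chi χ _ (by simpa using hσ)).2]
  have e : (σ : ℂ) + t * Complex.I = 1 + ((σ - 1 : ℝ) : ℂ) + Complex.I * t := by push_cast; ring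
  rw [e]
  have hd : 1 / (40 * M) ≤ 1 := by rw [div_le_one (by positivity)]; linarith
  refine (second_real hpp.out χ h1 h2 _ (by positivity) hd hL N hN3 t hN (σ - 1) (by linarith)
    (by linarith)).trans ?_
  have h3 := h p N t hp (by omega) hN2
  have hlN := one_le_log N hN3
  have hMl : M ≤ √p * (2 * log N) := by
    have : log p ≤ log N := log_le_log (by linarith) (by exact_mod_cast hpN)
    rw [hM]; gcongr; linarith
  have hs : √(p : ℝ) * √p = p := mul_self_sqrt (by linarith)
  calc 14 * (22 ^ 4 * (432 * 286)) ^ 3 * log N ^ 30 / (1 / (40 * M)) ^ 3 =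
      14 * (22 ^ 4 * (432 * 286)) ^ 3 * 64000 * log N ^ 30 * M ^ 3 := by field_simp; norm_num
    _ ≤ 14 * (22 ^ 4 * (432 * 286)) ^ 3 * 64000 * log N ^ 30 * (√p * (2 * log N)) ^ 3 := by gcongr
    _ = 14 * (22 ^ 4 * (432 * 286)) ^ 3 * 512000 * (√p) ^ 3 * log N ^ 33 := by ring
    _ ≤ 14 * (22 ^ 4 * (432 * 286)) ^ 3 * 512000 * (√p) ^ 3 * (C * √p * (1 + ‖t‖ ^ 2) ^ (1 / 4 : ℝ)) := by
      gcongr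
    _ = 14 * (22 ^ 4 * (432 * 286)) ^ 3 * 512000 * C * (√p * √p) ^ 2 * (1 + ‖t‖ ^ 2) ^ (1 / 4 : ℝ) := by ring
    _ = _ := by rw [hs]

end NCO

namespace NCO

theorem zeta1_ne (s : ℂ) (hs : 1 ≤ s.re) : riemannZeta₁ s ≠ 0 := by
  rcases eq_or_ne s 1 with rfl | h
  · simp
  · intro h0
    have := riemannZeta_eq_inv_sub_mul h
    rw [h0, mul_zero] at this
    exact riemannZeta_ne_zero_of_one_le_re hs this

theorem zeta_small_t : ∃ C : ℝ, ∀ σ t : ℝ, 1 < σ → σ ≤ 2 → |t| ≤ 1 →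
    ‖deriv (deriv (fun s => -deriv riemannZeta s / riemannZeta s - riemannZeta s)) (σ + t * Complex.I)‖ ≤ C := by
  set U : Set ℂ := {s | riemannZeta₁ s ≠ 0} with hU
  have hUo : IsOpen U := isOpen_ne_fun differentiable_riemannZeta₁.continuous continuous_const
  set g : ℂ → ℂ := fun s => -deriv riemannZeta₁ s / riemannZeta₁ s - riemannZeta₀ s with hg
  have hgd : DifferentiableOn ℂ g U := by
    refine DifferentiableOn.sub (DifferentiableOn.div ?_ ?_ fun s hs => hs) ?_
    · exact differentiable_riemannZeta₁.deriv.neg.differentiableOn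
    · exact differentiable_riemannZeta₁.differentiableOn
    · exact differentiable_riemannZeta₀.differentiableOn
  have hg2 : ContinuousOn (deriv (deriv g)) U := ((hgd.deriv hUo).deriv hUo).continuousOn
  have hK : IsCompact (Set.Icc (1 : ℝ) 2 ×ℂ Set.Icc (-1 : ℝ) 1) := isCompact_Icc.reProdIm isCompact_Icc
  have hKU : (Set.Icc (1 : ℝ) 2 ×ℂ Set.Icc (-1 : ℝ) 1) ⊆ U := fun s hs => zeta1_ne s hs.1.1
  obtain ⟨C, hC⟩ := hK.exists_bound_of_continuousOn (hg2.mono hKU)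
  refine ⟨C, fun σ t h1 h2 ht => ?_⟩
  have hop : IsOpen {s : ℂ | 1 < s.re} := isOpen_lt continuous_const Complex.continuous_re
  have heq : (fun s => -deriv riemannZeta s / riemannZeta s - riemannZeta s) =ᶠ[nhds (σ + t * Complex.I)] g := by
    filter_upwards [hop.mem_nhds (show 1 < ((σ : ℂ) + t * Complex.I).re by simpa using h1)] with s hs
    have hs1 : s ≠ 1 := by rintro rfl; simp at hs
    have hs1' : s - 1 ≠ 0 := sub_ne_zero.mpr hs1
    have hz := zeta1_ne s (le_of_lt hs)
    simp only [hg]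
    rw [deriv_riemannZeta_eq_neg_inv_sub_sq_mul_add hs1]
    conv_lhs => rw [riemannZeta_eq_inv_sub_mul hs1]
    have h1 : riemannZeta₁ s = 1 + (s - 1) * riemannZeta₀ s := rfl
    have h0 : riemannZeta₀ s = (riemannZeta₁ s - 1) / (s - 1) := by rw [h1]; field_simp; ring
    rw [h0]
    field_simp
    ring
  rw [heq.deriv.deriv_eq]
  refine hC _ ?_
  rw [Complex.mem_reProdIm]
  have := abs_le.mp ht
  simp
  exact ⟨⟨h1.le, h2⟩, this⟩

theorem B_zeta : ∃ C : ℝ, 0 < C ∧ ∀ σ t : ℝ, 1 < σ → σ ≤ 2 →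
    ‖LSeries (fun n => (log n : ℂ) ^ 2 * ((ArithmeticFunction.vonMangoldt n : ℂ) - 1)) (σ + t * Complex.I)‖ ≤
      C * (1 + ‖t‖ ^ 2) ^ (1 / 4 : ℝ) := by
  obtain ⟨C1, hC1⟩ := zeta_small_t
  obtain ⟨C2, hC2, h27⟩ := logN_pow 27
  obtain ⟨C3, hC3, h3⟩ := logN_pow 3
  set D : ℝ := |C1| + 1 + 14 * (34 ^ 4 * (432 * 17)) ^ 3 * C2 + 136 * C3 with hD
  have hD1 : |C1| ≤ D := by rw [hD]; have : 0 < 14 * (34 ^ 4 * (432 * 17)) ^ 3 * C2 := by positivity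
                            linarith
  refine ⟨D, by positivity, fun σ t hσ hσ2 => ?_⟩
  rw [(lser_zeta _ (by simpa using hσ)).2]
  have hw : 1 ≤ (1 + ‖t‖ ^ 2) ^ (1 / 4 : ℝ) := one_le_rpow (by nlinarith [sq_nonneg ‖t‖]) (by norm_num)
  by_cases ht : |t| ≤ 1
  · refine (hC1 σ t hσ hσ2 ht).trans ((le_abs_self C1).trans (hD1.trans ?_))
    have : 0 ≤ D := (abs_nonneg _).trans hD1
    nlinarith
  · have ht1 : 1 ≤ |t| := by linarith
    obtain ⟨N, hN3, hN, _, hN2⟩ := N_choice 1 le_rfl t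
    have hN' : 2 * |t| + 4 ≤ N := by push_cast at hN; linarith
    have hl := one_le_log N hN3
    set z : ℂ := σ + t * Complex.I with hz
    have hzre : z.re = σ := by simp [hz]
    have hzim : z.im = t := by simp [hz]
    have e : z = 1 + ((σ - 1 : ℝ) : ℂ) + Complex.I * t := by rw [hz]; push_cast; ring
    have hz2 := second_zeta N hN3 t ht1 hN' (σ - 1) (by linarith) (by linarith)
    rw [← e] at hz2
    have hb := zeta_ball N hN3 t ht1 (by linarith) z (by rw [hzre]; linarith) (by rw [hzre]; linarith) hzim
    have hr : 0 < 1 / (2 * log N) := by positivity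
    have hzz : ‖deriv (deriv riemannZeta) z‖ ≤ 136 * log N ^ 3 := by
      have := Complex.norm_iteratedDeriv_le_of_forall_mem_sphere_norm_le (c := z) (R := 1 / (2 * log N))
        (C := 17 * log N) (f := riemannZeta) 2 hr ?_ ?_
      · rw [iteratedDeriv_succ, iteratedDeriv_one] at this
        refine this.trans (le_of_eq ?_)
        simp
        field_simp
        norm_num
      · apply DifferentiableOn.diffContOnCl
        intro w hw
        exact (hb w (Metric.closure_ball_subset_closedBall hw)).1.differentiableWithinAt
      · intro w hw
        exact (hb w (Metric.sphere_subset_closedBall hw)).2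
    set H : Set ℂ := {s : ℂ | 1 < s.re} with hH
    have hop : IsOpen H := isOpen_lt continuous_const Complex.continuous_re
    have hzd : DifferentiableOn ℂ riemannZeta H := fun s hs =>
      (differentiableAt_riemannZeta (by rintro rfl; simp [hH] at hs)).differentiableWithinAt
    have hfd : DifferentiableOn ℂ (fun s => -deriv riemannZeta s / riemannZeta s) H :=
      DifferentiableOn.div (hzd.deriv hop).neg hzd fun s hs => riemannZeta_ne_zero_of_one_le_re (le_of_lt hs)
    have hzH : z ∈ H := by rw [hH, Set.mem_setOf_eq, hzre]; exact hσ
    have hsub : deriv (fun s => -deriv riemannZeta s / riemannZeta s - riemannZeta s) =ᶠ[nhds z]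
        fun s => deriv (fun s => -deriv riemannZeta s / riemannZeta s) s - deriv riemannZeta s := by
      filter_upwards [hop.mem_nhds hzH] with s hs
      exact deriv_fun_sub (hfd.differentiableAt (hop.mem_nhds hs)) (hzd.differentiableAt (hop.mem_nhds hs))
    rw [hsub.deriv_eq, deriv_fun_sub ((hfd.deriv hop).differentiableAt (hop.mem_nhds hzH))
      ((hzd.deriv hop).differentiableAt (hop.mem_nhds hzH))]
    have k1 := h27 1 N t le_rfl (by omega) hN2
    have k2 := h3 1 N t le_rfl (by omega) hN2
    simp only [Nat.cast_one, sqrt_one, mul_one] at k1 k2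
    calc _ ≤ _ := norm_sub_le _ _
      _ ≤ 14 * (34 ^ 4 * (432 * 17)) ^ 3 * log N ^ 27 + 136 * log N ^ 3 := add_le_add hz2 hzz
      _ ≤ 14 * (34 ^ 4 * (432 * 17)) ^ 3 * (C2 * (1 + ‖t‖ ^ 2) ^ (1 / 4 : ℝ)) +
          136 * (C3 * (1 + ‖t‖ ^ 2) ^ (1 / 4 : ℝ)) := by gcongr
      _ ≤ D * (1 + ‖t‖ ^ 2) ^ (1 / 4 : ℝ) := by
        rw [hD]
        have := abs_nonneg C1
        nlinarith

end NCO

namespace NCO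

open Classical in
noncomputable def cc (p : ℕ) (a : ZMod p) (n : ℕ) : ℝ :=
  log n ^ 2 * ((if a = (n : ZMod p) then ArithmeticFunction.vonMangoldt n else 0) - 1 / ((p : ℝ) - 1))

theorem KP_nonneg : 0 ≤ KP := MeasureTheory.integral_nonneg fun y => by positivity

theorem xsig (x : ℝ) (hx : 3 ≤ x) : 1 < 1 + 1 / log x ∧ 1 + 1 / log x ≤ 2 ∧
    x ^ (1 + 1 / log x) ≤ 3 * x := by
  have hl : 1 < log x := by
    rw [lt_log_iff_exp_lt (by linarith)]
    exact lt_of_lt_of_le (exp_one_lt_d9.trans (by norm_num)) hx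
  have h0 : 0 < 1 / log x := by positivity
  have h1 : 1 / log x ≤ 1 := by rw [div_le_one (by linarith)]; exact hl.le
  refine ⟨by linarith, by linarith, ?_⟩
  rw [rpow_add (by linarith), rpow_one, mul_comm]
  have : x ^ (1 / log x) = exp 1 := by
    rw [rpow_def_of_pos (by linarith)]; congr 1; field_simp
  rw [this]
  have := exp_one_lt_d9
  nlinarith

theorem p_powers (p : ℕ) (hp : p.Prime) (x : ℝ) (hx : 3 ≤ x) :
    ∑ n ∈ (Finset.Icc 1 ⌊x⌋₊).filter (fun n => p ∣ n), log n ^ 2 * ArithmeticFunction.vonMangoldt n ≤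
      log x ^ 3 := by
  have hx0 : 0 < x := by linarith
  have hlx : 0 ≤ log x := log_nonneg (by linarith)
  set m := ⌊x⌋₊ with hm
  have hm0 : m ≠ 0 := by
    have := Nat.floor_pos.mpr (by linarith : 1 ≤ x); omega
  have hmx : (m : ℝ) ≤ x := Nat.floor_le hx0.le
  set S := (Finset.Icc 1 (Nat.log p m)).image (fun k => p ^ k) with hS
  have h1 : ∑ n ∈ (Finset.Icc 1 m).filter (fun n => p ∣ n), log n ^ 2 * ArithmeticFunction.vonMangoldt n ≤
      ∑ n ∈ S, log n ^ 2 * ArithmeticFunction.vonMangoldt n := by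
    rw [← Finset.sum_filter_ne_zero]
    refine Finset.sum_le_sum_of_subset_of_nonneg (fun n hn' => ?_) fun n _ _ =>
      mul_nonneg (sq_nonneg _) ArithmeticFunction.vonMangoldt_nonneg
    obtain ⟨hn, hne⟩ := Finset.mem_filter.mp hn'
    obtain ⟨hn1, hpn⟩ := Finset.mem_filter.mp hn
    have hv : ArithmeticFunction.vonMangoldt n ≠ 0 := right_ne_zero_of_mul hne
    rw [ArithmeticFunction.vonMangoldt_ne_zero_iff] at hv
    obtain ⟨q, k, hq, hk, rfl⟩ := (isPrimePow_nat_iff n).mp hv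
    have hpq : p = q := (Nat.prime_dvd_prime_iff_eq hp hq).mp (hp.dvd_of_dvd_pow hpn)
    subst hpq
    rw [hS, Finset.mem_image]
    refine ⟨k, Finset.mem_Icc.mpr ⟨hk, ?_⟩, rfl⟩
    rw [Nat.le_log_iff_pow_le hp.one_lt hm0]
    exact (Finset.mem_Icc.mp hn1).2
  refine h1.trans ?_
  rw [hS, Finset.sum_image (fun a _ b _ h => Nat.pow_right_injective hp.two_le h)]
  have hlp : 0 < log p := log_pos (by exact_mod_cast hp.one_lt)
  have h2 : ∑ k ∈ Finset.Icc 1 (Nat.log p m), log ((p ^ k : ℕ) : ℝ) ^ 2 * ArithmeticFunction.vonMangoldt (p ^ k) ≤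
      ∑ k ∈ Finset.Icc 1 (Nat.log p m), log x ^ 2 * log p := by
    refine Finset.sum_le_sum fun k hk => ?_
    obtain ⟨hk1, hk2⟩ := Finset.mem_Icc.mp hk
    rw [ArithmeticFunction.vonMangoldt_apply_pow (by omega), ArithmeticFunction.vonMangoldt_apply_prime hp]
    rw [Nat.le_log_iff_pow_le hp.one_lt hm0] at hk2
    have hpk : 1 ≤ p ^ k := Nat.one_le_pow _ _ hp.pos
    gcongr
    refine le_trans ?_ hmx; exact_mod_cast hk2
  refine h2.trans ?_
  rw [Finset.sum_const, Nat.card_Icc, nsmul_eq_mul]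
  have h3 : (Nat.log p m : ℝ) * log p ≤ log x := by
    rw [← log_pow]
    have : p ^ Nat.log p m ≤ m := Nat.pow_log_le_self p hm0
    have : ((p ^ Nat.log p m : ℕ) : ℝ) ≤ m := by exact_mod_cast this
    push_cast at this
    exact log_le_log (pow_pos (by exact_mod_cast hp.pos) _) (this.trans hmx)
  simp only [Nat.add_sub_cancel]
  nlinarith [sq_nonneg (log x)]

theorem card_real (p : ℕ) [Fact p.Prime] : ((Finset.univ : Finset (DirichletCharacter ℂ p)).filter
    (fun χ => χ ^ 2 = 1)).card ≤ 2 := by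
  obtain ⟨e⟩ := MulChar.mulEquiv_units (ZMod p) ℂ
  have : IsCyclic (DirichletCharacter ℂ p) := e.isCyclic.mpr inferInstance
  exact IsCyclic.card_pow_eq_one_le (by norm_num)

theorem V_bound : ∃ C : ℝ, 0 < C ∧ ∀ (p : ℕ) [Fact p.Prime] (a : ZMod p), IsUnit a → 3 ≤ p → ∀ x : ℝ, 3 ≤ x →
    |∑ n ∈ Finset.Icc 1 ⌊x⌋₊, cc p a n * (1 - n / x)| ≤ C * p * x := by
  classical
  obtain ⟨Cc, hCc, hc⟩ := B_complex
  obtain ⟨Cr, hCr, hr⟩ := B_real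
  obtain ⟨Cz, hCz, hz⟩ := B_zeta
  obtain ⟨Cl, hCl, hl⟩ := logpow_le 3
  have hK := KP_nonneg
  refine ⟨2 * ((KP * 3) * (Cc + 2 * Cr + Cz) + Cl), by positivity, fun p hpF a ha hp3 x hx => ?_⟩
  have hp := hpF.out
  have hp3' : (3 : ℝ) ≤ p := by exact_mod_cast hp3
  obtain ⟨hs1, hs2, hs3⟩ := xsig x hx
  set σ := 1 + 1 / log x with hσ
  have hx0 : 0 < x := by linarith
  set A : DirichletCharacter ℂ p → ℕ → ℂ := fun χ n =>
    (log n : ℂ) ^ 2 * (χ n * ArithmeticFunction.vonMangoldt n) with hA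
  set Z : ℕ → ℂ := fun n => (log n : ℂ) ^ 2 * ((ArithmeticFunction.vonMangoldt n : ℂ) - 1) with hZ
  set B : DirichletCharacter ℂ p → ℝ := fun χ => Cc * p + if χ ^ 2 = 1 then Cr * p ^ 2 else 0 with hB
  have hAb : ∀ χ : DirichletCharacter ℂ p, χ ≠ 1 →
      ‖∑ n ∈ Finset.Icc 1 ⌊x⌋₊, A χ n * ((1 - n / x : ℝ) : ℂ)‖ ≤ KP * B χ * (3 * x) := by
    intro χ hχ
    have hsum := (lser_chi χ σ (by simpa using hs1)).1
    refine (perron (A χ) σ hs1 hsum (B χ) (fun t => ?_) x (by linarith)).trans ?_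
    · by_cases h2 : χ ^ 2 = 1
      · refine (hr p χ hχ h2 σ t hs1 hs2).trans ?_
        simp only [hB, if_pos h2]
        gcongr
        have : 0 ≤ Cc * p := by positivity
        linarith
      · refine (hc p χ hχ h2 σ t hs1 hs2).trans ?_
        simp only [hB, if_neg h2, add_zero]
        exact le_rfl
    · have : 0 ≤ B χ := by
        simp only [hB]; split_ifs <;> positivity
      gcongr
  have hZb : ‖∑ n ∈ Finset.Icc 1 ⌊x⌋₊, Z n * ((1 - n / x : ℝ) : ℂ)‖ ≤ KP * Cz * (3 * x) := by
    refine (perron Z σ hs1 (lser_zeta σ (by simpa using hs1)).1 Cz (fun t => hz σ t hs1 hs2) x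
      (by linarith)).trans ?_
    gcongr
  set P : ℕ → ℝ := fun n => if p ∣ n then log n ^ 2 * ArithmeticFunction.vonMangoldt n else 0 with hP
  have hφ : (p.totient : ℂ) = ((p : ℝ) - 1 : ℝ) := by
    rw [Nat.totient_prime hp, Nat.cast_sub hp.one_lt.le]; push_cast; ring
  have hne : ((p : ℝ) - 1) ≠ 0 := by linarith
  have hid : ∀ n : ℕ, ((((p : ℝ) - 1) * cc p a n : ℝ) : ℂ) =
      ∑ χ ∈ Finset.univ.erase (1 : DirichletCharacter ℂ p), χ a⁻¹ * A χ n + Z n - (P n : ℂ) := by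
    intro n
    have ho := DirichletCharacter.sum_char_inv_mul_char_eq ℂ ha (n : ZMod p)
    rw [← Finset.add_sum_erase _ _ (Finset.mem_univ (1 : DirichletCharacter ℂ p)), hφ] at ho
    have h1 : (1 : DirichletCharacter ℂ p) a⁻¹ = 1 := by
      rw [MulChar.one_apply]
      exact (isUnit_iff_ne_zero.mpr (inv_ne_zero ha.ne_zero))
    have h1n : (1 : DirichletCharacter ℂ p) (n : ZMod p) = if p ∣ n then 0 else 1 := by
      split_ifs with h
      · rw [(ZMod.natCast_eq_zero_iff n p).mpr h]
        exact MulChar.map_nonunit _ not_isUnit_zero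
      · apply MulChar.one_apply
        rw [isUnit_iff_ne_zero, Ne, ZMod.natCast_eq_zero_iff]; exact h
    rw [h1, one_mul, h1n] at ho
    have hs : ∑ χ ∈ Finset.univ.erase (1 : DirichletCharacter ℂ p), χ a⁻¹ * A χ n =
        (log n : ℂ) ^ 2 * ArithmeticFunction.vonMangoldt n *
        ∑ χ ∈ Finset.univ.erase (1 : DirichletCharacter ℂ p), χ a⁻¹ * χ (n : ZMod p) := by
      rw [Finset.mul_sum]
      refine Finset.sum_congr rfl fun χ _ => ?_
      simp only [hA]; ring
    rw [hs, ← sub_eq_iff_eq_add'.mpr ho.symm]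
    simp only [hZ, hP, cc]
    have hne' : ((p : ℂ) - 1) ≠ 0 := by exact_mod_cast hne
    by_cases h1 : a = (n : ZMod p) <;> by_cases h2 : p ∣ n <;> simp only [h1, h2, if_true, if_false] <;>
      push_cast <;> field_simp <;> ring
  have hsumid : (((((p : ℝ) - 1) * ∑ n ∈ Finset.Icc 1 ⌊x⌋₊, cc p a n * (1 - n / x)) : ℝ) : ℂ) =
      ∑ χ ∈ Finset.univ.erase (1 : DirichletCharacter ℂ p), χ a⁻¹ *
        ∑ n ∈ Finset.Icc 1 ⌊x⌋₊, A χ n * ((1 - n / x : ℝ) : ℂ) +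
      ∑ n ∈ Finset.Icc 1 ⌊x⌋₊, Z n * ((1 - n / x : ℝ) : ℂ) -
      ((∑ n ∈ Finset.Icc 1 ⌊x⌋₊, P n * (1 - n / x) : ℝ) : ℂ) := by
    simp only [Finset.mul_sum]
    rw [Finset.sum_comm, Complex.ofReal_sum, Complex.ofReal_sum, ← Finset.sum_add_distrib,
      ← Finset.sum_sub_distrib]
    refine Finset.sum_congr rfl fun n _ => ?_
    rw [← mul_assoc, Complex.ofReal_mul, hid n, sub_mul, add_mul, Finset.sum_mul, Complex.ofReal_mul]
    congr 2
    refine Finset.sum_congr rfl fun χ _ => by ring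
  have hPb : |∑ n ∈ Finset.Icc 1 ⌊x⌋₊, P n * (1 - n / x)| ≤ log x ^ 3 := by
    have hPn : ∀ n, 0 ≤ P n := by
      intro n; simp only [hP]; split_ifs
      · exact mul_nonneg (sq_nonneg _) ArithmeticFunction.vonMangoldt_nonneg
      · exact le_rfl
    have hw : ∀ n ∈ Finset.Icc 1 ⌊x⌋₊, 0 ≤ (1 - n / x : ℝ) ∧ (1 - n / x : ℝ) ≤ 1 := by
      intro n hn
      have := (Nat.le_floor_iff hx0.le).mp (Finset.mem_Icc.mp hn).2
      constructor
      · rw [sub_nonneg, div_le_one hx0]; exact this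
      · have : 0 ≤ (n : ℝ) / x := by positivity
        linarith
    rw [abs_of_nonneg (Finset.sum_nonneg fun n hn => mul_nonneg (hPn n) (hw n hn).1)]
    refine le_trans ?_ (p_powers p hp x hx)
    rw [Finset.sum_filter]
    refine Finset.sum_le_sum fun n hn => ?_
    exact mul_le_of_le_one_right (hPn n) (hw n hn).2
  have hBs : ∑ χ ∈ Finset.univ.erase (1 : DirichletCharacter ℂ p), B χ ≤ (Cc + 2 * Cr) * p ^ 2 := by
    have hnn : ∀ χ, 0 ≤ B χ := by intro χ; simp only [hB]; split_ifs <;> positivity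
    refine (Finset.sum_le_sum_of_subset_of_nonneg (Finset.erase_subset _ _) fun χ _ _ => hnn χ).trans ?_
    simp only [hB]
    rw [Finset.sum_add_distrib, ← Finset.sum_filter, Finset.sum_const, Finset.sum_const, nsmul_eq_mul,
      nsmul_eq_mul]
    have h1 : ((Finset.univ : Finset (DirichletCharacter ℂ p)).card : ℝ) ≤ p := by
      rw [Finset.card_univ, ← Nat.card_eq_fintype_card,
        DirichletCharacter.card_eq_totient_of_hasEnoughRootsOfUnity]
      exact_mod_cast Nat.totient_le p
    have h2 : ((((Finset.univ : Finset (DirichletCharacter ℂ p)).filter (fun χ => χ ^ 2 = 1)).card : ℕ) : ℝ) ≤ 2 := by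
      exact_mod_cast card_real p
    calc _ ≤ (p : ℝ) * (Cc * p) + 2 * (Cr * p ^ 2) := by gcongr
      _ = _ := by ring
  have hmain : ((p : ℝ) - 1) * |∑ n ∈ Finset.Icc 1 ⌊x⌋₊, cc p a n * (1 - n / x)| ≤
      (Cc + 2 * Cr) * p ^ 2 * (KP * (3 * x)) + KP * Cz * (3 * x) + log x ^ 3 := by
    have h0 : 0 ≤ (p : ℝ) - 1 := by linarith
    rw [← abs_of_nonneg h0, ← abs_mul, ← Real.norm_eq_abs, ← Complex.norm_real, hsumid]
    refine (norm_sub_le _ _).trans (add_le_add ((norm_add_le _ _).trans (add_le_add ?_ hZb)) ?_)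
    · refine (norm_sum_le _ _).trans ?_
      calc _ ≤ ∑ χ ∈ Finset.univ.erase (1 : DirichletCharacter ℂ p), B χ * (KP * (3 * x)) := by
            refine Finset.sum_le_sum fun χ hχ => ?_
            rw [norm_mul]
            have := hAb χ (Finset.ne_of_mem_erase hχ)
            have h1 := χ.norm_le_one a⁻¹
            calc _ ≤ 1 * (KP * B χ * (3 * x)) := by gcongr
              _ = _ := by ring
        _ = (∑ χ ∈ Finset.univ.erase (1 : DirichletCharacter ℂ p), B χ) * (KP * (3 * x)) := by
            rw [Finset.sum_mul]
        _ ≤ _ := by gcongr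
    · rw [Complex.norm_real, Real.norm_eq_abs]; exact hPb
  have hlx : log x ^ 3 ≤ Cl * x := by
    refine (hl x (by linarith)).trans ?_
    gcongr
    calc x ^ (1 / 2 : ℝ) ≤ x ^ (1 : ℝ) := rpow_le_rpow_of_exponent_le (by linarith) (by norm_num)
      _ = x := rpow_one x
  have hpp : (p : ℝ) ^ 2 ≤ 2 * p * (p - 1) := by nlinarith
  have hfin : ((p : ℝ) - 1) * |∑ n ∈ Finset.Icc 1 ⌊x⌋₊, cc p a n * (1 - n / x)| ≤
      ((p : ℝ) - 1) * (2 * ((KP * 3) * (Cc + 2 * Cr + Cz) + Cl) * p * x) := by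
    refine hmain.trans ?_
    calc (Cc + 2 * Cr) * p ^ 2 * (KP * (3 * x)) + KP * Cz * (3 * x) + log x ^ 3
        ≤ (Cc + 2 * Cr) * p ^ 2 * (KP * (3 * x)) + KP * Cz * (3 * x) * p ^ 2 + Cl * x * p ^ 2 := by
          have : 1 ≤ (p : ℝ) ^ 2 := by nlinarith
          refine add_le_add (add_le_add le_rfl ?_) ?_
          · exact le_mul_of_one_le_right (by positivity) this
          · exact hlx.trans (le_mul_of_one_le_right (by positivity) this)
      _ = ((KP * 3) * (Cc + 2 * Cr + Cz) + Cl) * x * p ^ 2 := by ring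
      _ ≤ ((KP * 3) * (Cc + 2 * Cr + Cz) + Cl) * x * (2 * p * (p - 1)) := by gcongr
      _ = _ := by ring
  exact le_of_mul_le_mul_left hfin (by linarith)

end NCO

namespace NCO

theorem W_ext (c : ℕ → ℝ) (y : ℝ) (hy : 0 ≤ y) (M : ℕ) (hM : ⌊y⌋₊ ≤ M) :
    ∑ n ∈ Finset.Icc 1 ⌊y⌋₊, c n * (y - n) = ∑ n ∈ Finset.Icc 1 M, c n * max (y - n) 0 := by
  rw [← Finset.sum_subset (Finset.Icc_subset_Icc_right hM)]
  · refine Finset.sum_congr rfl fun n hn => ?_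
    have := (Nat.le_floor_iff hy).mp (Finset.mem_Icc.mp hn).2
    rw [max_eq_left (by linarith)]
  · intro n h1 h2
    have : ¬ n ≤ ⌊y⌋₊ := fun h => h2 (Finset.mem_Icc.mpr ⟨(Finset.mem_Icc.mp h1).1, h⟩)
    rw [Nat.le_floor_iff hy, not_le] at this
    rw [max_eq_right (by linarith), mul_zero]

theorem S_ext (c : ℕ → ℝ) (y : ℝ) (hy : 0 ≤ y) (M : ℕ) (hM : ⌊y⌋₊ ≤ M) :
    ∑ n ∈ Finset.Icc 1 ⌊y⌋₊, c n = ∑ n ∈ Finset.Icc 1 M, c n * (if (n : ℝ) ≤ y then 1 else 0) := by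
  rw [← Finset.sum_subset (Finset.Icc_subset_Icc_right hM)]
  · refine Finset.sum_congr rfl fun n hn => ?_
    have := (Nat.le_floor_iff hy).mp (Finset.mem_Icc.mp hn).2
    rw [if_pos this, mul_one]
  · intro n h1 h2
    have : ¬ n ≤ ⌊y⌋₊ := fun h => h2 (Finset.mem_Icc.mpr ⟨(Finset.mem_Icc.mp h1).1, h⟩)
    rw [Nat.le_floor_iff hy] at this
    rw [if_neg this, mul_zero]

theorem card_short (u h : ℝ) (hu : 0 ≤ u) (hh : 0 ≤ h) (M : ℕ) :
    ∑ n ∈ Finset.Icc 1 M, (if u < n ∧ (n : ℝ) ≤ u + h then (1 : ℝ) else 0) ≤ h + 1 := by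
  rw [← Finset.sum_filter, Finset.sum_const, nsmul_eq_mul, mul_one]
  have hsub : (Finset.Icc 1 M).filter (fun n : ℕ => u < n ∧ (n : ℝ) ≤ u + h) ⊆
      Finset.Ioc ⌊u⌋₊ ⌊u + h⌋₊ := by
    intro n hn
    obtain ⟨_, h1, h2⟩ := Finset.mem_filter.mp hn
    rw [Finset.mem_Ioc]
    exact ⟨(Nat.floor_lt hu).mpr h1, (Nat.le_floor_iff (by linarith)).mpr h2⟩
  have h1 := Finset.card_le_card hsub
  rw [Nat.card_Ioc] at h1
  have h2 : ⌊u⌋₊ ≤ ⌊u + h⌋₊ := Nat.floor_le_floor (by linarith)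
  have h3 : (((⌊u + h⌋₊ - ⌊u⌋₊ : ℕ)) : ℝ) ≤ h + 1 := by
    rw [Nat.cast_sub h2]
    have := Nat.floor_le (by linarith : 0 ≤ u + h)
    have := Nat.lt_floor_add_one u
    linarith
  refine le_trans ?_ h3
  exact_mod_cast h1

theorem diff_bound (c : ℕ → ℝ) (K D u h : ℝ) (hh : 0 < h) (hhu : h ≤ u / 2) (hK : 0 ≤ K)
    (hc : ∀ n : ℕ, (n : ℝ) ≤ 2 * u → -K ≤ c n)
    (hW : ∀ y, u / 2 ≤ y → y ≤ 2 * u → |∑ n ∈ Finset.Icc 1 ⌊y⌋₊, c n * (y - n)| ≤ D) :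
    |∑ n ∈ Finset.Icc 1 ⌊u⌋₊, c n| ≤ 2 * D / h + K * (h + 1) := by
  have hu : 0 < u := by linarith
  set M := ⌊2 * u⌋₊ with hM
  have hMf : ∀ y, y ≤ 2 * u → ⌊y⌋₊ ≤ M := fun y hy => Nat.floor_le_floor hy
  have hn2 : ∀ n ∈ Finset.Icc 1 M, (n : ℝ) ≤ 2 * u := fun n hn =>
    (Nat.le_floor_iff (by linarith)).mp (Finset.mem_Icc.mp hn).2
  have w0 := abs_le.mp (hW u (by linarith) (by linarith))
  have w1 := abs_le.mp (hW (u + h) (by linarith) (by linarith))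
  have w2 := abs_le.mp (hW (u - h) (by linarith) (by linarith))
  rw [W_ext c u (by linarith) M (hMf _ (by linarith))] at w0
  rw [W_ext c (u + h) (by linarith) M (hMf _ (by linarith))] at w1
  rw [W_ext c (u - h) (by linarith) M (hMf _ (by linarith))] at w2
  rw [S_ext c u (by linarith) M (hMf _ (by linarith))]
  set S := ∑ n ∈ Finset.Icc 1 M, c n * (if (n : ℝ) ≤ u then 1 else 0) with hS
  have up : h * S ≤ ∑ n ∈ Finset.Icc 1 M, c n * max (u + h - n) 0 - ∑ n ∈ Finset.Icc 1 M, c n * max (u - n) 0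
      + K * h * (h + 1) := by
    have key : ∑ n ∈ Finset.Icc 1 M, (h * (c n * (if (n : ℝ) ≤ u then 1 else 0))) ≤
        ∑ n ∈ Finset.Icc 1 M, (c n * max (u + h - n) 0 - c n * max (u - n) 0 +
          K * h * (if u < n ∧ (n : ℝ) ≤ u + h then (1 : ℝ) else 0)) := by
      refine Finset.sum_le_sum fun n hn => ?_
      have hcn := hc n (hn2 n hn)
      by_cases h1 : (n : ℝ) ≤ u
      · rw [if_pos h1, if_neg (by intro h; linarith [h.1]), max_eq_left (by linarith), max_eq_left (by linarith)]
        linarith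
      · by_cases h2 : (n : ℝ) ≤ u + h
        · rw [if_neg h1, if_pos ⟨by linarith, h2⟩, max_eq_left (by linarith), max_eq_right (by linarith)]
          have : 0 ≤ u + h - n := by linarith
          have h3 : u + h - n ≤ h := by linarith
          nlinarith
        · rw [if_neg h1, if_neg (by intro h; exact h2 h.2), max_eq_right (by linarith),
            max_eq_right (by linarith)]
          simp
    rw [Finset.sum_add_distrib, Finset.sum_sub_distrib, ← Finset.mul_sum, ← Finset.mul_sum] at key
    have := card_short u h hu.le hh.le M
    have h4 : 0 ≤ K * h := by positivity
    nlinarith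
  have lo : ∑ n ∈ Finset.Icc 1 M, c n * max (u - n) 0 - ∑ n ∈ Finset.Icc 1 M, c n * max (u - h - n) 0
      - K * h * (h + 1) ≤ h * S := by
    have key : ∑ n ∈ Finset.Icc 1 M, (c n * max (u - n) 0 - c n * max (u - h - n) 0 -
          K * h * (if u - h < n ∧ (n : ℝ) ≤ u - h + h then (1 : ℝ) else 0)) ≤
        ∑ n ∈ Finset.Icc 1 M, (h * (c n * (if (n : ℝ) ≤ u then 1 else 0))) := by
      refine Finset.sum_le_sum fun n hn => ?_
      have hcn := hc n (hn2 n hn)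
      by_cases h1 : (n : ℝ) ≤ u - h
      · rw [if_neg (by intro h; linarith [h.1]), if_pos (by linarith), max_eq_left (by linarith),
          max_eq_left (by linarith)]
        linarith
      · by_cases h2 : (n : ℝ) ≤ u
        · rw [if_pos ⟨by linarith, by linarith⟩, if_pos h2, max_eq_left (by linarith), max_eq_right (by linarith)]
          have h3 : 0 ≤ h - (u - n) := by linarith
          have h4 : h - (u - n) ≤ h := by linarith
          nlinarith
        · rw [if_neg (by intro h; apply h2; linarith [h.2]), if_neg h2, max_eq_right (by linarith),
            max_eq_right (by linarith)]
          simp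
    rw [Finset.sum_sub_distrib, Finset.sum_sub_distrib, ← Finset.mul_sum, ← Finset.mul_sum] at key
    have := card_short (u - h) h (by linarith) hh.le M
    have h4 : 0 ≤ K * h := by positivity
    nlinarith
  have e : 2 * D / h + K * (h + 1) = (2 * D + K * h * (h + 1)) / h := by field_simp
  rw [e, le_div_iff₀ hh, ← abs_of_pos hh, ← abs_mul, abs_of_pos hh, abs_le]
  constructor <;> nlinarith

theorem S_bound : ∃ C : ℝ, 0 < C ∧ ∀ (p : ℕ) [Fact p.Prime] (a : ZMod p), IsUnit a → 3 ≤ p → ∀ u : ℝ,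
    3 ≤ u → (p : ℝ) ≤ log u / 2 → |∑ n ∈ Finset.Icc 1 ⌊u⌋₊, cc p a n| ≤ C * u * log u := by
  obtain ⟨C, hC, hV⟩ := V_bound
  refine ⟨8 * C + 12, by positivity, fun p hpF a ha hp3 u hu3 hpu => ?_⟩
  have hp3' : (3 : ℝ) ≤ p := by exact_mod_cast hp3
  have hlu : 6 ≤ log u := by linarith
  have hu6 : 7 ≤ u := by
    have := log_le_sub_one_of_pos (by linarith : 0 < u); linarith
  set h := u * p / log u with hh
  have hh0 : 0 < h := by positivity
  have hhu : h ≤ u / 2 := by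
    rw [hh, div_le_iff₀ (by linarith)]; nlinarith
  have hl2 : log (2 * u) ≤ 2 * log u := by
    rw [log_mul (by norm_num) (by linarith)]
    have := log_two_lt_d9; linarith
  have hl20 : 0 ≤ log (2 * u) := log_nonneg (by linarith)
  have key := diff_bound (cc p a) (4 * log u ^ 2 / (p - 1)) (C * p * (2 * u) * (2 * u)) u h hh0 hhu
    (div_nonneg (by positivity) (by linarith)) ?_ ?_
  · refine key.trans ?_
    have e1 : 2 * (C * p * (2 * u) * (2 * u)) / h = 8 * C * u * log u := by
      rw [hh]; field_simp; norm_num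
    rw [e1]
    have e2 : 4 * log u ^ 2 / (p - 1) * (h + 1) ≤ 12 * u * log u := by
      have h1 : log u ≤ u := (log_le_sub_one_of_pos (by linarith)).trans (by linarith)
      have h2 : h + 1 ≤ 2 * h := by
        have : 1 ≤ h := by
          rw [hh, one_le_div (by linarith)]; nlinarith
        linarith
      have hp1 : (0 : ℝ) < p - 1 := by linarith
      calc 4 * log u ^ 2 / (p - 1) * (h + 1) ≤ 4 * log u ^ 2 / (p - 1) * (2 * h) := by gcongr
        _ = 8 * u * log u * (p / (p - 1)) := by rw [hh]; field_simp; norm_num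
        _ ≤ 8 * u * log u * (3 / 2) := by
          refine mul_le_mul_of_nonneg_left ?_ (by positivity)
          rw [div_le_div_iff₀ hp1 (by norm_num)]; linarith
        _ = _ := by ring
    nlinarith
  · intro n hn
    have hp1 : (0 : ℝ) < p - 1 := by linarith
    have hlog : log n ^ 2 ≤ 4 * log u ^ 2 := by
      rcases Nat.eq_zero_or_pos n with rfl | hn0
      · simp; positivity
      · have h1 : (1 : ℝ) ≤ n := by exact_mod_cast hn0
        have : log n ≤ 2 * log u := (log_le_log (by linarith) hn).trans hl2
        have := log_nonneg h1
        nlinarith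
    unfold cc
    have hnn : 0 ≤ (if a = (n : ZMod p) then ArithmeticFunction.vonMangoldt n else 0) := by
      split_ifs
      · exact ArithmeticFunction.vonMangoldt_nonneg
      · exact le_rfl
    have : log n ^ 2 / (p - 1) ≤ 4 * log u ^ 2 / (p - 1) := by gcongr
    have e : log n ^ 2 / ((p : ℝ) - 1) = log n ^ 2 * (1 / (p - 1)) := by ring
    nlinarith [mul_nonneg (sq_nonneg (log n)) hnn]
  · intro y hy1 hy2
    have hy3 : 3 ≤ y := by linarith
    have := hV p a ha hp3 y hy3
    have e : ∑ n ∈ Finset.Icc 1 ⌊y⌋₊, cc p a n * (y - n) = y * ∑ n ∈ Finset.Icc 1 ⌊y⌋₊, cc p a n * (1 - n / y) := by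
      rw [Finset.mul_sum]
      refine Finset.sum_congr rfl fun n _ => ?_
      field_simp
    rw [e, abs_mul, abs_of_pos (by linarith)]
    calc y * _ ≤ (2 * u) * (C * p * y) := by gcongr
      _ ≤ (2 * u) * (C * p * (2 * u)) := by gcongr
      _ = _ := by ring

end NCO

namespace NCO

theorem abel_real (c g : ℕ → ℝ) (m : ℕ) (M : ℝ) (hM : ∀ k, |∑ n ∈ Finset.Ioc m (m + k), c n| ≤ M)
    (hg : ∀ n, m < n → g (n + 1) ≤ g n) (hg0 : ∀ n, m < n → 0 ≤ g n) (k : ℕ) :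
    |∑ n ∈ Finset.Ioc m (m + k), c n * g n| ≤ M * g (m + 1) := by
  have conv : ∀ (f : ℕ → ℝ) (k : ℕ), ∑ i ∈ Finset.range k, (f (m + 1 + i) : ℂ) =
      ((∑ n ∈ Finset.Ioc m (m + k), f n : ℝ) : ℂ) := by
    intro f k
    rw [← Complex.ofReal_sum]
    congr 1
    have : Finset.Ioc m (m + k) = Finset.Ico (m + 1) (m + 1 + k) := by ext; simp; omega
    rw [this, Finset.sum_Ico_eq_sum_range]
    simp
  have h := abel_dec (fun i => (c (m + 1 + i) : ℂ)) (fun i => g (m + 1 + i)) M (fun k => ?_)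
    (fun n => hg (m + 1 + n) (by omega)) (fun n => hg0 (m + 1 + n) (by omega)) k
  · simp only [← Complex.ofReal_mul] at h
    rw [conv (fun n => c n * g n) k, Complex.norm_real, Real.norm_eq_abs] at h
    exact h
  · rw [conv c k, Complex.norm_real, Real.norm_eq_abs]
    exact hM k

theorem primepow_count (x : ℝ) (hx : 3 ≤ x) :
    (((Finset.Icc 2 ⌊x⌋₊).filter (fun n => IsPrimePow n ∧ ¬ n.Prime)).card : ℝ) ≤ √x * (2 * log x) := by
  have hx0 : 0 < x := by linarith
  set m := ⌊x⌋₊ with hm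
  have hm0 : m ≠ 0 := by
    have := Nat.floor_pos.mpr (by linarith : 1 ≤ x); omega
  have hmx : (m : ℝ) ≤ x := Nat.floor_le hx0.le
  have hsub : (Finset.Icc 2 m).filter (fun n => IsPrimePow n ∧ ¬ n.Prime) ⊆
      (Finset.Icc 1 (Nat.sqrt m) ×ˢ Finset.Icc 1 (Nat.log 2 m)).image (fun q : ℕ × ℕ => q.1 ^ q.2) := by
    intro n hn
    obtain ⟨h1, h2, h3⟩ := Finset.mem_filter.mp hn
    obtain ⟨q, k, hq, hk, rfl⟩ := (isPrimePow_nat_iff n).mp h2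
    have hqm := (Finset.mem_Icc.mp h1).2
    have hk2 : 2 ≤ k := by
      by_contra hk2
      have : k = 1 := by omega
      subst this
      simp at h3; exact h3 hq
    rw [Finset.mem_image]
    refine ⟨(q, k), Finset.mem_product.mpr ⟨Finset.mem_Icc.mpr ⟨hq.pos, ?_⟩, Finset.mem_Icc.mpr ⟨hk, ?_⟩⟩, rfl⟩
    · simp only
      rw [Nat.le_sqrt']
      exact (Nat.pow_le_pow_right hq.pos hk2).trans hqm
    · simp only
      rw [Nat.le_log_iff_pow_le (by norm_num) hm0]
      exact (Nat.pow_le_pow_left hq.two_le k).trans hqm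
  have h1 := (Finset.card_le_card hsub).trans Finset.card_image_le
  rw [Finset.card_product, Nat.card_Icc, Nat.card_Icc] at h1
  simp only [Nat.add_sub_cancel] at h1
  have h2 : (Nat.sqrt m : ℝ) ≤ √x := by
    apply le_sqrt_of_sq_le
    refine le_trans ?_ hmx
    exact_mod_cast Nat.sqrt_le' m
  have h3 : (Nat.log 2 m : ℝ) ≤ 2 * log x := by
    have := Nat.pow_log_le_self 2 hm0
    have h4 : ((2 : ℝ) ^ Nat.log 2 m) ≤ x := by
      refine le_trans ?_ hmx; exact_mod_cast this
    have h5 := log_le_log (by positivity) h4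
    rw [log_pow] at h5
    have := log_two_gt_d9
    have : (0 : ℝ) ≤ Nat.log 2 m := by positivity
    nlinarith
  calc _ ≤ ((Nat.sqrt m * Nat.log 2 m : ℕ) : ℝ) := by exact_mod_cast h1
    _ = (Nat.sqrt m : ℝ) * Nat.log 2 m := by push_cast; ring
    _ ≤ _ := by gcongr

open Classical in
/-- the deviation function of primes in the progression a mod p -/
noncomputable def ee (p : ℕ) (a : ZMod p) (n : ℕ) : ℝ :=
  (if n.Prime ∧ a = (n : ZMod p) then 1 else 0) - 1 / (((p : ℝ) - 1) * log n)

theorem inv_log_le (p : ℕ) (hp : 3 ≤ p) (n : ℕ) (hn : 2 ≤ n) :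
    0 ≤ 1 / (((p : ℝ) - 1) * log n) ∧ 1 / (((p : ℝ) - 1) * log n) ≤ 1 := by
  have hp3' : (3 : ℝ) ≤ p := by exact_mod_cast hp
  have hl : log 2 ≤ log n := log_le_log (by norm_num) (by exact_mod_cast hn)
  have := log_two_gt_d9
  have h1 : 1 ≤ ((p : ℝ) - 1) * log n := by nlinarith
  refine ⟨by positivity, ?_⟩
  rw [div_le_one (by linarith)]; exact h1

theorem ee_abs (p : ℕ) (hp : 3 ≤ p) (a : ZMod p) (n : ℕ) (hn : 2 ≤ n) : |ee p a n| ≤ 1 := by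
  obtain ⟨h1, h2⟩ := inv_log_le p hp n hn
  unfold ee
  rw [abs_le]
  split_ifs <;> constructor <;> linarith

theorem ee_cc (p : ℕ) (a : ZMod p) (n : ℕ) (hn : 2 ≤ n) :
    |ee p a n - cc p a n * (1 / log n ^ 3)| ≤ if IsPrimePow n ∧ ¬ n.Prime then 1 else 0 := by
  have hl : 0 < log n := log_pos (by exact_mod_cast hn)
  have e : ee p a n - cc p a n * (1 / log n ^ 3) = (if n.Prime ∧ a = (n : ZMod p) then 1 else 0) -
      (if a = (n : ZMod p) then ArithmeticFunction.vonMangoldt n else 0) / log n := by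
    unfold ee cc
    rcases eq_or_ne ((p : ℝ) - 1) 0 with h | h
    · rw [h]; field_simp; simp
    · field_simp; ring
  rw [e]
  by_cases ha : a = (n : ZMod p)
  · simp only [ha, and_true, if_true]
    by_cases hpn : n.Prime
    · rw [if_pos hpn, ArithmeticFunction.vonMangoldt_apply_prime hpn, div_self hl.ne']
      simp [hpn]
    · rw [if_neg hpn, zero_sub, abs_neg]
      by_cases hpp : IsPrimePow n
      · rw [if_pos ⟨hpp, hpn⟩, abs_of_nonneg (div_nonneg ArithmeticFunction.vonMangoldt_nonneg hl.le),
          div_le_one hl]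
        exact ArithmeticFunction.vonMangoldt_le_log
      · rw [if_neg (fun h => hpp h.1)]
        have : ArithmeticFunction.vonMangoldt n = 0 := by
          by_contra h; exact hpp (ArithmeticFunction.vonMangoldt_ne_zero_iff.mp h)
        rw [this]; simp
  · simp only [ha, and_false, if_false, zero_div, sub_zero, abs_zero]
    split_ifs <;> norm_num

theorem pnt_ap : ∃ C : ℝ, 0 < C ∧ ∀ (p : ℕ) [Fact p.Prime] (a : ZMod p), IsUnit a → 3 ≤ p → ∀ x : ℝ,
    3 ≤ x → (p : ℝ) ≤ log x / 4 → |∑ n ∈ Finset.Icc 2 ⌊x⌋₊, ee p a n| ≤ C * x / log x ^ 2 := by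
  obtain ⟨C, hC, hS⟩ := S_bound
  obtain ⟨Cl, hCl, hl⟩ := logpow_le 3
  refine ⟨16 * C + 3 * Cl, by positivity, fun p hpF a ha hp3 x hx hpx => ?_⟩
  have hp3' : (3 : ℝ) ≤ p := by exact_mod_cast hp3
  have hx0 : 0 < x := by linarith
  have hlx : 12 ≤ log x := by linarith
  have hx13 : 13 ≤ x := by
    have := log_le_sub_one_of_pos hx0; linarith
  have hsx : 3 ≤ √x := le_sqrt_of_sq_le (by linarith)
  have hsqx : √x * √x = x := mul_self_sqrt hx0.le
  have hls : log √x = log x / 2 := log_sqrt hx0.le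
  set m := ⌊√x⌋₊ with hm
  have hm3 : 3 ≤ m := Nat.le_floor (by exact_mod_cast hsx)
  have hmx : m ≤ ⌊x⌋₊ := Nat.floor_le_floor (by nlinarith)
  have hmlt : √x < m + 1 := Nat.lt_floor_add_one _
  have hmle : (m : ℝ) ≤ √x := Nat.floor_le (by linarith)
  -- partial sums
  have hpart : ∀ u : ℝ, √x ≤ u → u ≤ x → |∑ n ∈ Finset.Icc 1 ⌊u⌋₊, cc p a n| ≤ C * x * log x := by
    intro u h1 h2
    have hlu : log √x ≤ log u := log_le_log (by linarith) h1
    have hlu2 : log u ≤ log x := log_le_log (by linarith) h2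
    refine (hS p a ha hp3 u (by linarith) (by linarith)).trans ?_
    have : 0 ≤ log u := by linarith
    gcongr
  -- Abel
  obtain ⟨k, hk⟩ := Nat.exists_eq_add_of_le hmx
  have hIoc : ∀ j, j ≤ k → |∑ n ∈ Finset.Ioc m (m + j), cc p a n| ≤ 2 * (C * x * log x) := by
    intro j hj
    have e : ∑ n ∈ Finset.Ioc m (m + j), cc p a n =
        ∑ n ∈ Finset.Icc 1 (m + j), cc p a n - ∑ n ∈ Finset.Icc 1 m, cc p a n := by
      rw [eq_sub_iff_add_eq']
      have e1 : Finset.Icc 1 (m + j) = Finset.Ioc 0 (m + j) := by ext; simp; omega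
      have e2 : Finset.Icc 1 m = Finset.Ioc 0 m := by ext; simp; omega
      rw [e1, e2]
      exact Finset.sum_Ioc_consecutive _ (by omega) (by omega)
    rw [e]
    have h1 := hpart (√x) le_rfl (by nlinarith)
    have h2 : |∑ n ∈ Finset.Icc 1 (m + j), cc p a n| ≤ C * x * log x := by
      rcases Nat.eq_zero_or_pos j with rfl | hj0
      · simpa using h1
      · have := hpart ((m + j : ℕ) : ℝ) ?_ ?_
        · rwa [Nat.floor_natCast] at this
        · have : (1 : ℝ) ≤ j := by exact_mod_cast hj0
          push_cast; linarith
        · have : ((m + j : ℕ) : ℝ) ≤ (⌊x⌋₊ : ℝ) := by exact_mod_cast (by omega)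
          exact this.trans (Nat.floor_le hx0.le)
    rw [← hm] at h1
    refine (abs_sub _ _).trans ?_
    linarith
  have habel : |∑ n ∈ Finset.Ioc m (m + k), cc p a n * (1 / log n ^ 3)| ≤ 16 * C * x / log x ^ 2 := by
    set c' : ℕ → ℝ := fun n => if n ≤ m + k then cc p a n else 0 with hc'
    have e : ∑ n ∈ Finset.Ioc m (m + k), cc p a n * (1 / log n ^ 3) =
        ∑ n ∈ Finset.Ioc m (m + k), c' n * (1 / log n ^ 3) := by
      refine Finset.sum_congr rfl fun n hn => ?_
      simp only [hc']; rw [if_pos (Finset.mem_Ioc.mp hn).2]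
    rw [e]
    refine (abel_real c' (fun n => 1 / log n ^ 3) m (2 * (C * x * log x)) (fun j => ?_) (fun n hn => ?_)
      (fun n hn => ?_) k).trans ?_
    · have : ∑ n ∈ Finset.Ioc m (m + j), c' n = ∑ n ∈ Finset.Ioc m (m + min j k), cc p a n := by
        simp only [hc']
        rw [← Finset.sum_filter]
        congr 1
        ext n; simp; omega
      rw [this]
      exact hIoc _ (min_le_right _ _)
    · have h1 : 0 < log n := log_pos (by exact_mod_cast (by omega : 1 < n))
      have h2 : log n ≤ log ((n + 1 : ℕ) : ℝ) := log_le_log (by exact_mod_cast (by omega : 0 < n)) (by push_cast; linarith)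
      gcongr
    · have h1 : 0 < log n := log_pos (by exact_mod_cast (by omega : 1 < n))
      positivity
    · have h1 : log x / 2 ≤ log ((m + 1 : ℕ) : ℝ) := by
        rw [← hls]; exact log_le_log (by linarith) (by push_cast; linarith)
      calc 2 * (C * x * log x) * (1 / log ((m + 1 : ℕ) : ℝ) ^ 3) ≤ 2 * (C * x * log x) * (1 / (log x / 2) ^ 3) := by
            gcongr
        _ = _ := by field_simp; norm_num
  -- decomposition
  have hsplit : ∑ n ∈ Finset.Icc 2 ⌊x⌋₊, ee p a n = ∑ n ∈ Finset.Icc 2 m, ee p a n +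
      (∑ n ∈ Finset.Ioc m (m + k), cc p a n * (1 / log n ^ 3) +
       ∑ n ∈ Finset.Ioc m (m + k), (ee p a n - cc p a n * (1 / log n ^ 3))) := by
    rw [← Finset.sum_add_distrib]
    simp only [add_sub_cancel]
    rw [hk]
    have e1 : Finset.Icc 2 (m + k) = Finset.Ioc 1 (m + k) := by ext; simp; omega
    have e2 : Finset.Icc 2 m = Finset.Ioc 1 m := by ext; simp; omega
    rw [e1, e2]
    exact (Finset.sum_Ioc_consecutive _ (by omega) (by omega)).symm
  have b1 : |∑ n ∈ Finset.Icc 2 m, ee p a n| ≤ √x := by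
    refine (Finset.abs_sum_le_sum_abs _ _).trans ?_
    refine (Finset.sum_le_sum fun n hn => ee_abs p hp3 a n (Finset.mem_Icc.mp hn).1).trans ?_
    rw [Finset.sum_const, Nat.card_Icc, nsmul_eq_mul, mul_one]
    refine le_trans ?_ hmle
    exact_mod_cast (by omega)
  have b2 : |∑ n ∈ Finset.Ioc m (m + k), (ee p a n - cc p a n * (1 / log n ^ 3))| ≤ √x * (2 * log x) := by
    refine (Finset.abs_sum_le_sum_abs _ _).trans ?_
    refine (Finset.sum_le_sum fun n hn => ee_cc p a n (by
      have := (Finset.mem_Ioc.mp hn).1; omega)).trans ?_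
    refine le_trans ?_ (primepow_count x hx)
    rw [← Finset.sum_filter, Finset.sum_const, nsmul_eq_mul, mul_one]
    norm_cast
    apply Finset.card_le_card
    intro n hn
    obtain ⟨h1, h2⟩ := Finset.mem_filter.mp hn
    have := Finset.mem_Ioc.mp h1
    refine Finset.mem_filter.mpr ⟨Finset.mem_Icc.mpr ⟨by omega, by omega⟩, h2⟩
  have b3 : √x * (3 * log x) ≤ 3 * Cl * x / log x ^ 2 := by
    rw [le_div_iff₀ (by positivity)]
    have := hl x (by linarith)
    rw [← sqrt_eq_rpow] at this
    calc √x * (3 * log x) * log x ^ 2 = 3 * √x * log x ^ 3 := by ring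
      _ ≤ 3 * √x * (Cl * √x) := by gcongr
      _ = 3 * Cl * (√x * √x) := by ring
      _ = _ := by rw [hsqx]
  rw [hsplit]
  have t1 := abs_add_le (∑ n ∈ Finset.Icc 2 m, ee p a n) (∑ n ∈ Finset.Ioc m (m + k), cc p a n * (1 / log n ^ 3) +
       ∑ n ∈ Finset.Ioc m (m + k), (ee p a n - cc p a n * (1 / log n ^ 3)))
  have t2 := abs_add_le (∑ n ∈ Finset.Ioc m (m + k), cc p a n * (1 / log n ^ 3))
       (∑ n ∈ Finset.Ioc m (m + k), (ee p a n - cc p a n * (1 / log n ^ 3)))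
  have e : (16 * C + 3 * Cl) * x / log x ^ 2 = 16 * C * x / log x ^ 2 + 3 * Cl * x / log x ^ 2 := by ring
  rw [e]
  have : √x ≤ √x * log x := le_mul_of_one_le_right (by linarith) (by linarith)
  linarith

end NCO

namespace NCO

/-- residue of `z / q` mod `p` -/
noncomputable def ww (p q : ℕ) (z : ℤ) : ℕ := ((z : ZMod p) * (q : ZMod p)⁻¹).val

open Classical in
/-- indicator of the semigroup generated by `p` and `q` -/
noncomputable def bb (p q : ℕ) (z : ℤ) : ℤ := if (ww p q z : ℤ) * q ≤ z then 1 else 0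

/-- coefficients of the `pq`-th cyclotomic polynomial -/
noncomputable def AA (p q : ℕ) (z : ℤ) : ℤ := bb p q z - bb p q (z - 1)

theorem ww_lt (p q : ℕ) [Fact p.Prime] (z : ℤ) : ww p q z < p := ZMod.val_lt _

theorem ww_eq (p q : ℕ) [Fact p.Prime] (hq : (q : ZMod p) ≠ 0) (z : ℤ) (k : ℕ) (hk : k < p)
    (h : (z : ZMod p) = k * q) : ww p q z = k := by
  unfold ww
  rw [h, mul_assoc, mul_inv_cancel₀ hq, mul_one, ZMod.val_natCast_of_lt hk]

theorem ww_spec (p q : ℕ) [Fact p.Prime] (hq : (q : ZMod p) ≠ 0) (z : ℤ) :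
    (z : ZMod p) = (ww p q z : ZMod p) * q := by
  unfold ww
  rw [ZMod.natCast_zmod_val, mul_assoc, inv_mul_cancel₀ hq, mul_one]

theorem bb_neg (p q : ℕ) (z : ℤ) (hz : z < 0) : bb p q z = 0 := by
  unfold bb
  rw [if_neg]
  have : (0 : ℤ) ≤ (ww p q z : ℤ) * q := by positivity
  omega

theorem bb_sub (p q : ℕ) [Fact p.Prime] (hq : (q : ZMod p) ≠ 0) (z : ℤ) :
    bb p q z - bb p q (z - p) = if z = (ww p q z : ℤ) * q then 1 else 0 := by
  have hp : 0 < p := (Fact.out : p.Prime).pos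
  have h1 : ww p q (z - p) = ww p q z := by unfold ww; simp
  have h2 : (p : ℤ) ∣ z - (ww p q z : ℤ) * q := by
    rw [← ZMod.intCast_zmod_eq_zero_iff_dvd]
    push_cast
    rw [← ww_spec p q hq z, sub_self]
  obtain ⟨k, hk⟩ := h2
  unfold bb
  rw [h1]
  split_ifs with h3 h4 h5 h5 h5 h5
  · exfalso; omega
  · rfl
  · rfl
  · exfalso
    have : 0 ≤ (p : ℤ) * k := by omega
    have h6 : (p : ℤ) * k < p * 1 := by omega
    have h7 : k < 1 := lt_of_mul_lt_mul_left h6 (by positivity)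
    have h8 : 0 ≤ k := by
      by_contra hc
      have : (p : ℤ) * k < 0 := mul_neg_of_pos_of_neg (by exact_mod_cast hp) (by omega)
      omega
    have h9 : k = 0 := by omega
    subst h9
    omega
  · exfalso; omega
  · exfalso; omega
  · exfalso; omega
  · rfl

theorem qz_ne (p q : ℕ) (hp : p.Prime) (hq : q.Prime) (hpq : p < q) : (q : ZMod p) ≠ 0 := by
  intro h
  rw [ZMod.natCast_eq_zero_iff] at h
  have := (Nat.prime_dvd_prime_iff_eq hp hq).1 h
  omega

theorem cyc_id (p q : ℕ) (hp : p.Prime) (hq : q.Prime) (hpq : p < q) :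
    cyclotomic (p * q) ℤ * (X ^ p - 1) = (X - 1) * ∑ j ∈ Finset.range p, (X : ℤ[X]) ^ (j * q) := by
  haveI := Fact.mk hp
  have h1 : expand ℤ q (cyclotomic p ℤ) = cyclotomic (p * q) ℤ * cyclotomic p ℤ :=
    cyclotomic_expand_eq_cyclotomic_mul hq (fun h => by
      have := (Nat.prime_dvd_prime_iff_eq hq hp).1 h; omega) ℤ
  rw [← cyclotomic_prime_mul_X_sub_one ℤ p, ← mul_assoc, ← h1, cyclotomic_prime, map_sum, mul_comm]
  congr 1
  apply Finset.sum_congr rfl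
  intro j _
  rw [map_pow, expand_X, ← pow_mul, mul_comm]

theorem cyc_coeff (p q : ℕ) (hp : p.Prime) (hq : q.Prime) (hpq : p < q) (n : ℕ) :
    (cyclotomic (p * q) ℤ).coeff n = AA p q n := by
  haveI := Fact.mk hp
  have hqz := qz_ne p q hp hq hpq
  set H : PowerSeries ℤ := PowerSeries.mk (fun n => bb p q n) with hH
  have h1 : H * (PowerSeries.X ^ p - 1) =
      - ((∑ j ∈ Finset.range p, (X : ℤ[X]) ^ (j * q) : ℤ[X]) : PowerSeries ℤ) := by
    ext n
    rw [mul_sub, mul_one, map_sub, PowerSeries.coeff_mul_X_pow', map_neg, Polynomial.coeff_coe, finsetSum_coeff]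
    have h2 := bb_sub p q hqz n
    have h3 : (if p ≤ n then PowerSeries.coeff (n - p) H else 0) = bb p q ((n : ℤ) - p) := by
      split_ifs with h
      · rw [hH, PowerSeries.coeff_mk]; congr 1; omega
      · rw [bb_neg]; omega
    rw [h3, hH, PowerSeries.coeff_mk]
    have h4 : ∑ j ∈ Finset.range p, ((X : ℤ[X]) ^ (j * q)).coeff n =
        if (n : ℤ) = (ww p q n : ℤ) * q then 1 else 0 := by
      simp only [coeff_X_pow]
      rw [Finset.sum_eq_single_of_mem (ww p q n) (Finset.mem_range.2 (ww_lt _ _ _))]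
      · congr 1
        apply propext
        constructor
        · intro h; exact_mod_cast h
        · intro h; exact_mod_cast h
      · intro j hj hne
        rw [if_neg]
        intro h
        apply hne
        rw [ww_eq p q hqz n j (Finset.mem_range.1 hj)]
        rw [h]; push_cast; rfl
    rw [h4]
    linarith
  have h5 : ((cyclotomic (p * q) ℤ : ℤ[X]) : PowerSeries ℤ) * (PowerSeries.X ^ p - 1) =
      (1 - PowerSeries.X) * H * (PowerSeries.X ^ p - 1) := by
    have := congrArg (fun f : ℤ[X] => (f : PowerSeries ℤ)) (cyc_id p q hp hq hpq)
    simp only [Polynomial.coe_mul, Polynomial.coe_sub, Polynomial.coe_pow, Polynomial.coe_X, Polynomial.coe_one] at this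
    rw [this, mul_assoc, h1]
    ring
  have h6 : (PowerSeries.X ^ p - 1 : PowerSeries ℤ) ≠ 0 := by
    intro h
    have := congrArg (PowerSeries.coeff 0) h
    simp [PowerSeries.coeff_X_pow, hp.ne_zero] at this
  have h7 := mul_right_cancel₀ h6 h5
  have h8 := congrArg (PowerSeries.coeff n) h7
  rw [Polynomial.coeff_coe] at h8
  rw [h8, mul_comm, mul_sub, mul_one, map_sub]
  unfold AA
  congr 1
  · rw [hH, PowerSeries.coeff_mk]
  · rcases n with _ | n
    · simp [bb_neg]
    · rw [PowerSeries.coeff_succ_mul_X, hH, PowerSeries.coeff_mk]; congr 1; push_cast; ring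

theorem AA_neg (p q : ℕ) (z : ℤ) (hz : z < 0) : AA p q z = 0 := by
  unfold AA; rw [bb_neg _ _ _ hz, bb_neg _ _ _ (by omega)]; rfl

theorem AA_deg (p q : ℕ) (hp : p.Prime) (hq : q.Prime) (hpq : p < q) (z : ℤ) (hz : AA p q z ≠ 0) :
    0 ≤ z ∧ z ≤ ((p : ℤ) - 1) * (q - 1) := by
  have h0 : 0 ≤ z := by
    by_contra h; exact hz (AA_neg p q z (by omega))
  refine ⟨h0, ?_⟩
  by_contra h
  lift z to ℕ using h0
  rw [← cyc_coeff p q hp hq hpq] at hz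
  apply hz
  apply coeff_eq_zero_of_natDegree_lt
  rw [natDegree_cyclotomic, Nat.totient_mul ((Nat.coprime_primes hp hq).2 hpq.ne), Nat.totient_prime hp, Nat.totient_prime hq]
  zify [hp.one_le, hq.one_le]
  omega

theorem AA_abs (p q : ℕ) (z : ℤ) : |AA p q z| ≤ 1 := by
  unfold AA bb
  split_ifs <;> simp

theorem psi_eq (p q r : ℕ) (hp : p.Prime) (hq : q.Prime) (hr : r.Prime) (hpq : p < q) (hqr : q < r) :
    (X ^ (p * q * r) - 1 : ℤ[X]) /ₘ cyclotomic (p * q * r) ℤ =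
      cyclotomic (p * q) ℤ * (X ^ (q * r) - 1) * ∑ j ∈ Finset.range p, X ^ (j * r) := by
  haveI := Fact.mk hp
  have h1 : expand ℤ q (cyclotomic p ℤ) = cyclotomic (p * q) ℤ * cyclotomic p ℤ :=
    cyclotomic_expand_eq_cyclotomic_mul hq (fun h => by
      have := (Nat.prime_dvd_prime_iff_eq hq hp).1 h; omega) ℤ
  have h2 : expand ℤ r (cyclotomic (p * q) ℤ) = cyclotomic (p * q * r) ℤ * cyclotomic (p * q) ℤ :=
    cyclotomic_expand_eq_cyclotomic_mul hr (fun h => by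
      rcases (Nat.Prime.dvd_mul hr).1 h with h | h
      · have := (Nat.prime_dvd_prime_iff_eq hr hp).1 h; omega
      · have := (Nat.prime_dvd_prime_iff_eq hr hq).1 h; omega) ℤ
  have h3 : cyclotomic (p * q) ℤ * cyclotomic p ℤ * (X ^ q - 1) = X ^ (p * q) - 1 := by
    have : (X ^ q - 1 : ℤ[X]) = expand ℤ q (X - 1) := by simp
    rw [← h1, this, ← map_mul, cyclotomic_prime_mul_X_sub_one]
    simp [← pow_mul, mul_comm]
  have h4 : ∑ j ∈ Finset.range p, (X : ℤ[X]) ^ (j * r) = expand ℤ r (cyclotomic p ℤ) := by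
    rw [cyclotomic_prime, map_sum]
    apply Finset.sum_congr rfl
    intro j _
    rw [map_pow, expand_X, ← pow_mul, mul_comm]
  have h5 : (X ^ (q * r) - 1 : ℤ[X]) = expand ℤ r (X ^ q - 1) := by
    simp [← pow_mul, mul_comm]
  have h6 : (X ^ (p * q * r) - 1 : ℤ[X]) = cyclotomic (p * q * r) ℤ *
      (cyclotomic (p * q) ℤ * (X ^ (q * r) - 1) * ∑ j ∈ Finset.range p, X ^ (j * r)) := by
    have : (X ^ (p * q * r) - 1 : ℤ[X]) = expand ℤ r (X ^ (p * q) - 1) := by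
      simp [← pow_mul, mul_comm]
    rw [this, ← h3, map_mul, map_mul, h2, h4, h5]
    ring
  rw [h6, mul_divByMonic_cancel_left _ (cyclotomic.monic _ _)]

theorem psi_coeff (p q r : ℕ) (hp : p.Prime) (hq : q.Prime) (hr : r.Prime) (hpq : p < q) (hqr : q < r) (m : ℕ) :
    ((X ^ (p * q * r) - 1 : ℤ[X]) /ₘ cyclotomic (p * q * r) ℤ).coeff m =
      ∑ j ∈ Finset.range p, AA p q (m - ((q + j : ℕ) : ℤ) * r) - ∑ j ∈ Finset.range p, AA p q (m - (j : ℤ) * r) := by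
  rw [psi_eq p q r hp hq hr hpq hqr]
  have : cyclotomic (p * q) ℤ * (X ^ (q * r) - 1) * ∑ j ∈ Finset.range p, X ^ (j * r) =
      ∑ j ∈ Finset.range p, cyclotomic (p * q) ℤ * X ^ ((q + j) * r) -
      ∑ j ∈ Finset.range p, cyclotomic (p * q) ℤ * X ^ (j * r) := by
    rw [← Finset.mul_sum, ← Finset.mul_sum, mul_sub, mul_one, sub_mul, mul_assoc, Finset.mul_sum]
    congr 3
    funext j
    ring
  rw [this, coeff_sub, finsetSum_coeff, finsetSum_coeff]
  have key : ∀ k : ℕ, (cyclotomic (p * q) ℤ * X ^ (k * r)).coeff m = AA p q (m - (k : ℤ) * r) := by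
    intro k
    rw [coeff_mul_X_pow']
    split_ifs with h
    · rw [cyc_coeff p q hp hq hpq]; congr 1; push_cast [h]; ring
    · rw [AA_neg]; zify at h; omega
  simp only [key]

end NCO

namespace NCO

theorem ww_sub_one_ge (p q : ℕ) [Fact p.Prime] (hq : (q : ZMod p) ≠ 0) (z : ℤ) (h : ww p q 1 ≤ ww p q z) :
    ww p q (z - 1) = ww p q z - ww p q 1 := by
  apply ww_eq p q hq
  · have := ww_lt p q z; omega
  · push_cast [h]
    rw [sub_mul, ← ww_spec p q hq z, ← ww_spec p q hq 1]; simp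

theorem ww_sub_one_lt (p q : ℕ) [Fact p.Prime] (hq : (q : ZMod p) ≠ 0) (z : ℤ) (h : ww p q z < ww p q 1) :
    ww p q (z - 1) = ww p q z + (p - ww p q 1) := by
  have h1 := ww_lt p q 1
  apply ww_eq p q hq
  · omega
  · push_cast [h1.le]
    rw [add_mul, sub_mul, ← ww_spec p q hq z, ← ww_spec p q hq 1]; simp; ring

theorem AA_one (p q : ℕ) [Fact p.Prime] (hq : (q : ZMod p) ≠ 0) (z : ℤ) (h : AA p q z = 1) :
    ww p q z < ww p q 1 ∧ (ww p q z : ℤ) * q ≤ z ∧ z - 1 < (ww p q (z - 1) : ℤ) * q := by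
  unfold AA bb at h
  have hb : (ww p q z : ℤ) * q ≤ z ∧ ¬ (ww p q (z - 1) : ℤ) * q ≤ z - 1 := by
    split_ifs at h <;> first | omega | (constructor <;> assumption)
  refine ⟨?_, hb.1, by omega⟩
  by_contra hc
  push Not at hc
  have h1 := ww_sub_one_ge p q hq z hc
  apply hb.2
  rw [h1]
  push_cast [hc]
  have h2 : 1 ≤ ww p q 1 := by
    by_contra h0
    have h3 : ww p q 1 = 0 := by omega
    have := ww_spec p q hq 1
    rw [h3] at this
    simp at this
  have h3 : 1 ≤ q := by
    rcases q with _ | q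
    · simp at hq
    · omega
  have h4 : (1 : ℤ) ≤ (ww p q 1 : ℤ) * q := by
    have : 1 ≤ ww p q 1 * q := Nat.mul_pos h2 h3
    exact_mod_cast this
  rw [sub_mul]
  omega

theorem AA_neg_one (p q : ℕ) [Fact p.Prime] (hq : (q : ZMod p) ≠ 0) (z : ℤ) (h : AA p q z = -1) :
    ww p q 1 ≤ ww p q z ∧ z < (ww p q z : ℤ) * q ∧ (ww p q (z - 1) : ℤ) * q ≤ z - 1 := by
  unfold AA bb at h
  have hb : ¬ (ww p q z : ℤ) * q ≤ z ∧ (ww p q (z - 1) : ℤ) * q ≤ z - 1 := by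
    split_ifs at h <;> first | omega | (constructor <;> assumption)
  refine ⟨?_, by omega, hb.2⟩
  by_contra hc
  push Not at hc
  have h1 := ww_sub_one_lt p q hq z hc
  have h2 := hb.2
  rw [h1] at h2
  push_cast at h2
  have h3 : (0 : ℤ) ≤ ((p - ww p q 1 : ℕ) : ℤ) * q := by positivity
  rw [add_mul] at h2
  omega

/-- distinct residues along an arithmetic progression -/
theorem ww_inj (p q r : ℕ) [Fact p.Prime] (hq : (q : ZMod p) ≠ 0) (hr : (r : ZMod p) ≠ 0) (z : ℤ) (i j : ℕ)
    (hi : i < p) (hj : j < p) (h : ww p q (z + i * r) = ww p q (z + j * r)) : i = j := by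
  have h1 := ww_spec p q hq (z + i * r)
  rw [h, ← ww_spec p q hq (z + j * r)] at h1
  push_cast at h1
  have h2 : (i : ZMod p) = j := by
    have := add_left_cancel h1
    exact mul_right_cancel₀ hr this
  rw [ZMod.natCast_eq_natCast_iff'] at h2
  rwa [Nat.mod_eq_of_lt hi, Nat.mod_eq_of_lt hj] at h2

theorem mono_squeeze (f : ℕ → ℕ) (N s : ℕ) (hf : ∀ i, i < N → f i < f (i + 1)) (h0 : s ≤ f 0) (hN : f N ≤ N + s) :
    ∀ i ≤ N, f i = i + s := by
  have h1 : ∀ i, i ≤ N → i + s ≤ f i := by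
    intro i
    induction i with
    | zero => intro _; omega
    | succ i ih => intro h; have := hf i (by omega); have := ih (by omega); omega
  have h2 : ∀ k, k ≤ N → f (N - k) ≤ N - k + s := by
    intro k
    induction k with
    | zero => intro _; simpa using hN
    | succ k ih =>
      intro h
      have h3 := hf (N - (k + 1)) (by omega)
      rw [show N - (k + 1) + 1 = N - k by omega] at h3
      have := ih (by omega)
      omega
  intro i hi
  have := h1 i hi
  have h3 := h2 (N - i) (by omega)
  rw [show N - (N - i) = i by omega] at h3
  omega

theorem crit_fwd (p q r : ℕ) (hp : p.Prime) (hq : q.Prime) (hr : r.Prime) (hp3 : 3 ≤ p) (hpq : p < q) (hqr : q < r)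
    (z : ℤ) (ε : ℤ) (hε : ε = 1 ∨ ε = -1) (h : ∀ i, i < p - 1 → AA p q (z + (i : ℤ) * r) = ε) :
    (((q : ZMod p) = 1 ∧ (r : ZMod p) = 1) ∨ ((q : ZMod p) = -1 ∧ (r : ZMod p) = -1)) ∧
      (p - 2) * r < (p - 1) * (q - 1) := by
  haveI := Fact.mk hp
  have hqz := qz_ne p q hp hq hpq
  have hrz := qz_ne p r hp hr (hpq.trans hqr)
  have hε0 : ε ≠ 0 := by omega
  refine ⟨?_, ?_⟩
  swap
  · have h0 := AA_deg p q hp hq hpq _ (by rw [h 0 (by omega)]; exact hε0)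
    have h1 := AA_deg p q hp hq hpq _ (by rw [h (p - 2) (by omega)]; exact hε0)
    have h2 : (p - 2) * r ≤ (p - 1) * (q - 1) := by
      zify [show 2 ≤ p by omega, show 1 ≤ p by omega, show 1 ≤ q by omega]
      have e : ((p - 2 : ℕ) : ℤ) = p - 2 := by omega
      rw [e] at h1
      simp at h0
      linarith
    refine lt_of_le_of_ne h2 (fun he => ?_)
    have h3 : (p - 1) ∣ (p - 2) * r := ⟨q - 1, he⟩
    have h4 : Nat.Coprime (p - 1) (p - 2) := by
      rw [show p - 1 = (p - 2) + 1 by omega]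
      simp
    have h5 := h4.dvd_of_dvd_mul_left h3
    rcases (Nat.dvd_prime hr).1 h5 with h6 | h6 <;> omega
  -- congruences
  have hstep : ∀ i : ℕ, ∀ u : ℕ, ww p q (z + (i : ℤ) * r) = u → ww p q (z + ((i + 1 : ℕ) : ℤ) * r) = u + 1 →
      (r : ZMod p) = q := by
    intro i u h1 h2
    have h3 := ww_spec p q hqz (z + (i : ℤ) * r)
    have h4 := ww_spec p q hqz (z + ((i + 1 : ℕ) : ℤ) * r)
    rw [h1] at h3
    rw [h2] at h4
    push_cast at h3 h4
    linear_combination h4 - h3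
  have hcard : ∀ T : Finset ℕ, (∀ i < p - 1, ww p q (z + (i : ℤ) * r) ∈ T) → p - 1 ≤ T.card := by
    intro T hT
    have : (Finset.range (p - 1)).card ≤ T.card :=
      Finset.card_le_card_of_injOn (fun i => ww p q (z + (i : ℤ) * r)) (fun i hi => by
        simp at hi
        exact hT i hi) (fun i hi j hj hij => by
        simp at hi hj
        exact ww_inj p q r hqz hrz z i j (by omega) (by omega) hij)
    simpa using this
  have hl := ww_lt p q 1
  have hlspec := ww_spec p q hqz 1
  rcases hε with rfl | rfl
  · right
    have hA := fun i (hi : i < p - 1) => AA_one p q hqz _ (h i hi)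
    have h1 := hcard (Finset.range (ww p q 1)) (fun i hi => Finset.mem_range.2 (hA i hi).1)
    rw [Finset.card_range] at h1
    have h2 : ww p q 1 = p - 1 := by omega
    have h3 : (q : ZMod p) = -1 := by
      rw [h2] at hlspec
      push_cast [hp.one_le] at hlspec
      simp at hlspec
      linear_combination hlspec
    have hsq := mono_squeeze (fun i => ww p q (z + (i : ℤ) * r)) (p - 2) 0 (fun i hi => by
      have a1 := hA i (by omega)
      have a2 := hA (i + 1) (by omega)
      have a3 := ww_sub_one_lt p q hqz _ a2.1
      have a4 := a2.2.2
      rw [a3, h2, show p - (p - 1) = 1 by omega] at a4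
      have a5 : ((ww p q (z + (i : ℤ) * r) : ℤ) + 1) * q < ((ww p q (z + ((i + 1 : ℕ) : ℤ) * r) : ℤ) + 1) * q := by
        push_cast at a4 ⊢
        have := a1.2.1
        have : (q : ℤ) < r := by exact_mod_cast hqr
        nlinarith
      have a6 := lt_of_mul_lt_mul_right a5 (by positivity)
      omega) (by omega) (by
      have := (hA (p - 2) (by omega)).1
      omega)
    have := hstep 0 0 (hsq 0 (by omega)) (hsq 1 (by omega))
    exact ⟨h3, this.trans h3⟩
  · left
    have hA := fun i (hi : i < p - 1) => AA_neg_one p q hqz _ (h i hi)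
    have h1 := hcard (Finset.Ico (ww p q 1) p) (fun i hi => Finset.mem_Ico.2 ⟨(hA i hi).1, ww_lt _ _ _⟩)
    rw [Nat.card_Ico] at h1
    have h0 : ww p q 1 ≠ 0 := by
      intro h0
      rw [h0] at hlspec
      simp at hlspec
    have h2 : ww p q 1 = 1 := by omega
    have h3 : (q : ZMod p) = 1 := by
      rw [h2] at hlspec
      simp at hlspec
      exact hlspec.symm
    have hsq := mono_squeeze (fun i => ww p q (z + (i : ℤ) * r)) (p - 2) 1 (fun i hi => by
      have a1 := hA i (by omega)
      have a2 := hA (i + 1) (by omega)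
      have a3 := ww_sub_one_ge p q hqz _ a1.1
      have a4 := a1.2.2
      rw [a3, h2] at a4
      have a6 := a1.1
      rw [h2] at a6
      have a5 : (ww p q (z + (i : ℤ) * r) : ℤ) * q < (ww p q (z + ((i + 1 : ℕ) : ℤ) * r) : ℤ) * q := by
        push_cast [a6] at a4 a2 ⊢
        have := a2.2.1
        have : (q : ℤ) < r := by exact_mod_cast hqr
        nlinarith
      have a6 := lt_of_mul_lt_mul_right a5 (by positivity)
      omega) (by have := (hA 0 (by omega)).1; omega) (by
      have := ww_lt p q (z + ((p - 2 : ℕ) : ℤ) * r)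
      omega)
    have := hstep 0 1 (hsq 0 (by omega)) (hsq 1 (by omega))
    exact ⟨h3, this.trans h3⟩

theorem crit_bwd (p q r : ℕ) (hp : p.Prime) (hq : q.Prime) (hr : r.Prime) (hp3 : 3 ≤ p) (hpq : p < q) (hqr : q < r)
    (hc : ((q : ZMod p) = 1 ∧ (r : ZMod p) = 1) ∨ ((q : ZMod p) = -1 ∧ (r : ZMod p) = -1))
    (hi : (p - 2) * r < (p - 1) * (q - 1)) :
    ∃ z : ℤ, 0 ≤ z ∧ z ≤ 1 ∧ ∃ ε : ℤ, (ε = 1 ∨ ε = -1) ∧ ∀ i, i < p - 1 → AA p q (z + (i : ℤ) * r) = ε := by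
  haveI := Fact.mk hp
  have hqz := qz_ne p q hp hq hpq
  have hrz := qz_ne p r hp hr (hpq.trans hqr)
  have hi' : ((p : ℤ) - 2) * r < (p - 1) * (q - 1) := by
    zify [show 2 ≤ p by omega, show 1 ≤ p by omega, show 1 ≤ q by omega] at hi
    exact hi
  have hqr' : (q : ℤ) < r := by exact_mod_cast hqr
  have hp3' : (3 : ℤ) ≤ p := by exact_mod_cast hp3
  have hpq' : (p : ℤ) < q := by exact_mod_cast hpq
  have hkey : ∀ i : ℕ, i < p - 1 → (i : ℤ) * r ≤ (i + 1) * (q - 1) := by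
    intro i hi2
    have h1 : (i : ℤ) ≤ p - 2 := by omega
    have h2 : ((p : ℤ) - 2) * (i * r) ≤ (p - 2) * ((i + 1) * (q - 1)) := by
      have h3 : (i : ℤ) * ((p - 2) * r) ≤ i * ((p - 1) * (q - 1)) := by gcongr
      have h4 : (i : ℤ) * ((p - 1) * (q - 1)) ≤ (p - 2) * ((i + 1) * (q - 1)) := by nlinarith
      linarith
    exact le_of_mul_le_mul_left h2 (by omega)
  rcases hc with ⟨h1, h2⟩ | ⟨h1, h2⟩
  · refine ⟨1, by norm_num, le_rfl, -1, Or.inr rfl, fun i hi2 => ?_⟩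
    have e1 : ww p q (1 + (i : ℤ) * r) = i + 1 := ww_eq p q hqz _ _ (by omega) (by
      push_cast; rw [h1, h2]; ring)
    have e2 : ww p q (1 + (i : ℤ) * r - 1) = i := ww_eq p q hqz _ _ (by omega) (by
      push_cast; rw [h1, h2]; ring)
    unfold AA bb
    rw [e1, e2, if_neg, if_pos]
    · norm_num
    · rw [add_sub_cancel_left]; gcongr
    · push_cast
      have := hkey i hi2
      rcases i with _ | i
      · simp; omega
      · push_cast at this ⊢; nlinarith
  · refine ⟨0, le_rfl, by norm_num, 1, Or.inl rfl, fun i hi2 => ?_⟩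
    have e1 : ww p q (0 + (i : ℤ) * r) = i := ww_eq p q hqz _ _ (by omega) (by
      push_cast; rw [h1, h2]; ring)
    have e2 : ww p q (0 + (i : ℤ) * r - 1) = i + 1 := ww_eq p q hqz _ _ (by omega) (by
      push_cast; rw [h1, h2]; ring)
    unfold AA bb
    rw [e1, e2, if_pos, if_neg]
    · norm_num
    · push_cast
      have := hkey i hi2
      nlinarith
    · rw [zero_add]; gcongr

end NCO

namespace NCO

theorem window (g : ℕ → ℤ) (N d : ℕ) (h1 : ∀ k, |g k| ≤ 1)
    (h2 : ∀ k < N, ∀ k' < N, g k ≠ 0 → g k' ≠ 0 → k' ≤ k + d) :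
    |∑ k ∈ Finset.range N, g k| ≤ d + 1 ∧ (|∑ k ∈ Finset.range N, g k| = d + 1 →
      ∃ k0, ∃ ε : ℤ, (ε = 1 ∨ ε = -1) ∧ ∀ i ≤ d, k0 + i < N ∧ g (k0 + i) = ε) := by
  by_cases hJ : ((Finset.range N).filter (fun k => g k ≠ 0)).Nonempty
  swap
  · rw [Finset.not_nonempty_iff_eq_empty, Finset.filter_eq_empty_iff] at hJ
    have h0 : ∑ k ∈ Finset.range N, g k = 0 := Finset.sum_eq_zero (fun k hk => by
      have := hJ hk; tauto)
    rw [h0]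
    constructor
    · simp; omega
    · intro h; simp at h; omega
  set k0 := ((Finset.range N).filter (fun k => g k ≠ 0)).min' hJ with hk0
  have hmem := Finset.min'_mem _ hJ
  rw [← hk0] at hmem
  simp only [Finset.mem_filter, Finset.mem_range] at hmem
  have hs : ∑ k ∈ Finset.range N, g k = ∑ k ∈ Finset.Icc k0 (k0 + d), (if k < N then g k else 0) := by
    rw [← Finset.sum_filter]
    apply (Finset.sum_subset_zero_on_sdiff _ _ _).symm
    · intro k; simp
    · intro k hk
      simp only [Finset.mem_sdiff, Finset.mem_range, Finset.mem_filter, Finset.mem_Icc] at hk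
      by_contra hne
      apply hk.2
      refine ⟨⟨?_, h2 k0 hmem.1 k hk.1 hmem.2 hne⟩, hk.1⟩
      exact Finset.min'_le _ _ (by simp; exact ⟨hk.1, hne⟩)
    · intro k _; rfl
  have h1' : ∀ k, |if k < N then g k else 0| ≤ 1 := by
    intro k; split_ifs
    · exact h1 k
    · simp
  have hc : (Finset.Icc k0 (k0 + d)).card = d + 1 := by simp; omega
  rw [hs]
  constructor
  · refine (Finset.abs_sum_le_sum_abs _ _).trans ?_
    refine (Finset.sum_le_sum (fun k _ => h1' k)).trans ?_
    rw [Finset.sum_const, hc]; simp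
  · intro he
    have key : ∀ ε : ℤ, (ε = 1 ∨ ε = -1) → ∑ k ∈ Finset.Icc k0 (k0 + d), (if k < N then g k else 0) = ε * (d + 1) →
        ∀ i ≤ d, k0 + i < N ∧ g (k0 + i) = ε := by
      intro ε hε hsum i hi
      have hz : ∑ k ∈ Finset.Icc k0 (k0 + d), (1 - ε * (if k < N then g k else 0)) = 0 := by
        rw [Finset.sum_sub_distrib, ← Finset.mul_sum, hsum, Finset.sum_const, hc]
        rcases hε with rfl | rfl <;> simp
      rw [Finset.sum_eq_zero_iff_of_nonneg] at hz
      · have h3 := hz (k0 + i) (by simp; exact hi)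
        split_ifs at h3 with h4
        · refine ⟨h4, ?_⟩
          rcases hε with rfl | rfl <;> omega
        · simp at h3
      · intro k _
        have := abs_le.1 (h1' k)
        rcases hε with rfl | rfl <;> omega
    rcases abs_eq (by positivity : (0 : ℤ) ≤ d + 1) |>.1 he with h3 | h3
    · exact ⟨k0, 1, Or.inl rfl, key 1 (Or.inl rfl) (by rw [h3]; ring)⟩
    · exact ⟨k0, -1, Or.inr rfl, key (-1) (Or.inr rfl) (by rw [h3]; ring)⟩

theorem psi_coeff_bound (p q r : ℕ) (hp : p.Prime) (hq : q.Prime) (hr : r.Prime) (hp3 : 3 ≤ p) (hpq : p < q)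
    (hqr : q < r) (m : ℕ) :
    |((X ^ (p * q * r) - 1 : ℤ[X]) /ₘ cyclotomic (p * q * r) ℤ).coeff m| ≤ ((p - 2 : ℕ) : ℤ) + 1 ∧
    (|((X ^ (p * q * r) - 1 : ℤ[X]) /ₘ cyclotomic (p * q * r) ℤ).coeff m| = ((p - 2 : ℕ) : ℤ) + 1 →
      ∃ z : ℤ, ∃ ε : ℤ, (ε = 1 ∨ ε = -1) ∧ ∀ i, i < p - 1 → AA p q (z + (i : ℤ) * r) = ε) := by
  rw [psi_coeff p q r hp hq hr hpq hqr]
  set g : ℕ → ℤ := fun k => (if k < p then -1 else if k < q then 0 else 1) * AA p q (m - (k : ℤ) * r) with hg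
  have hsum : ∑ j ∈ Finset.range p, AA p q (m - ((q + j : ℕ) : ℤ) * r) - ∑ j ∈ Finset.range p, AA p q (m - (j : ℤ) * r)
      = ∑ k ∈ Finset.range (q + p), g k := by
    rw [Finset.sum_range_add, ← Finset.sum_range_add_sum_Ico _ hpq.le]
    have e1 : ∑ k ∈ Finset.range p, g k = - ∑ j ∈ Finset.range p, AA p q (m - (j : ℤ) * r) := by
      rw [← Finset.sum_neg_distrib]
      apply Finset.sum_congr rfl
      intro k hk
      simp only [hg]
      rw [if_pos (Finset.mem_range.1 hk)]; ring
    have e2 : ∑ k ∈ Finset.Ico p q, g k = 0 := by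
      apply Finset.sum_eq_zero
      intro k hk
      simp only [hg]
      rw [Finset.mem_Ico] at hk
      rw [if_neg (by omega), if_pos (by omega)]; ring
    have e3 : ∑ k ∈ Finset.range p, g (q + k) = ∑ j ∈ Finset.range p, AA p q (m - ((q + j : ℕ) : ℤ) * r) := by
      apply Finset.sum_congr rfl
      intro k hk
      simp only [hg]
      rw [if_neg (by omega), if_neg (by omega)]; ring
    rw [e1, e2, e3]; ring
  rw [hsum]
  have hne : ∀ k, g k ≠ 0 → AA p q (m - (k : ℤ) * r) ≠ 0 := by
    intro k hk h0
    apply hk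
    simp only [hg, h0, mul_zero]
  have hw := window g (q + p) (p - 2) (fun k => by
    simp only [hg]
    have := AA_abs p q (m - (k : ℤ) * r)
    split_ifs
    · simpa using this
    · simp
    · simpa using this) (fun k _ k' _ hk hk' => by
    have a1 := AA_deg p q hp hq hpq _ (hne k hk)
    have a2 := AA_deg p q hp hq hpq _ (hne k' hk')
    by_contra hc
    have hc' : (k : ℤ) + p - 1 ≤ k' := by omega
    have h5 : (q : ℤ) < r := by exact_mod_cast hqr
    have h6 : (3 : ℤ) ≤ p := by exact_mod_cast hp3
    have h7 : ((k : ℤ) + p - 1) * r ≤ k' * r := by gcongr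
    nlinarith)
  refine ⟨hw.1, fun he => ?_⟩
  obtain ⟨k0, ε, hε, hk⟩ := hw.2 he
  have hε0 : ε ≠ 0 := by omega
  have hgap : ∀ k, p ≤ k → k < q → g k = 0 := by
    intro k h1 h2
    simp only [hg]
    rw [if_neg (by omega), if_pos h2]; ring
  have hcase : k0 + (p - 2) < p ∨ q ≤ k0 := by
    by_contra hc
    push Not at hc
    rcases le_or_gt p k0 with h | h
    · have := (hk 0 (by omega)).2
      rw [hgap (k0 + 0) h (by omega)] at this; omega
    · have := (hk (p - k0) (by omega)).2
      rw [hgap (k0 + (p - k0)) (by omega) (by omega)] at this; omega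
  have hz : ∀ i : ℕ, i < p - 1 → (m : ℤ) - ((k0 + (p - 2) : ℕ) : ℤ) * r + (i : ℤ) * r =
      m - ((k0 + (p - 2 - i) : ℕ) : ℤ) * r := by
    intro i hi
    have : ((k0 + (p - 2 - i) : ℕ) : ℤ) = ((k0 + (p - 2) : ℕ) : ℤ) - i := by omega
    rw [this]; ring
  rcases hcase with h | h
  · refine ⟨(m : ℤ) - ((k0 + (p - 2) : ℕ) : ℤ) * r, -ε, by omega, fun i hi => ?_⟩
    rw [hz i hi]
    have := (hk (p - 2 - i) (by omega)).2
    simp only [hg] at this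
    rw [if_pos (by omega)] at this
    linarith
  · refine ⟨(m : ℤ) - ((k0 + (p - 2) : ℕ) : ℤ) * r, ε, by omega, fun i hi => ?_⟩
    rw [hz i hi]
    have := (hk (p - 2 - i) (by omega)).2
    simp only [hg] at this
    rw [if_neg (by omega), if_neg (by omega)] at this
    linarith

theorem psi_coeff_attain (p q r : ℕ) (hp : p.Prime) (hq : q.Prime) (hr : r.Prime) (hp3 : 3 ≤ p) (hpq : p < q)
    (hqr : q < r) (z ε : ℤ) (h0 : 0 ≤ z) (h1 : z ≤ 1) (hε : ε = 1 ∨ ε = -1)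
    (h : ∀ i, i < p - 1 → AA p q (z + (i : ℤ) * r) = ε) :
    ∃ m, |((X ^ (p * q * r) - 1 : ℤ[X]) /ₘ cyclotomic (p * q * r) ℤ).coeff m| = ((p - 2 : ℕ) : ℤ) + 1 := by
  have hm0 : 0 ≤ z + ((p - 2 : ℕ) : ℤ) * r := by positivity
  refine ⟨(z + ((p - 2 : ℕ) : ℤ) * r).toNat, ?_⟩
  rw [psi_coeff p q r hp hq hr hpq hqr, Int.toNat_of_nonneg hm0]
  have hrpos : (q : ℤ) + 1 ≤ r := by exact_mod_cast hqr
  have hpq' : (p : ℤ) < q := by exact_mod_cast hpq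
  have e1 : ∑ j ∈ Finset.range p, AA p q (z + ((p - 2 : ℕ) : ℤ) * r - ((q + j : ℕ) : ℤ) * r) = 0 := by
    apply Finset.sum_eq_zero
    intro j _
    apply AA_neg
    have h2 : ((p - 2 : ℕ) : ℤ) + 1 ≤ ((q + j : ℕ) : ℤ) := by omega
    nlinarith
  have e2 : ∑ j ∈ Finset.range p, AA p q (z + ((p - 2 : ℕ) : ℤ) * r - (j : ℤ) * r) = ((p - 1 : ℕ) : ℤ) * ε := by
    rw [show Finset.range p = Finset.range ((p - 1) + 1) by congr 1; omega, Finset.sum_range_succ]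
    rw [Finset.sum_congr rfl (g := fun _ => ε), Finset.sum_const, Finset.card_range, nsmul_eq_mul]
    · rw [AA_neg, add_zero]
      have : ((p - 1 : ℕ) : ℤ) = ((p - 2 : ℕ) : ℤ) + 1 := by omega
      rw [this]
      nlinarith
    · intro j hj
      rw [Finset.mem_range] at hj
      rw [← h (p - 2 - j) (by omega)]
      congr 1
      have : ((p - 2 - j : ℕ) : ℤ) = ((p - 2 : ℕ) : ℤ) - j := by omega
      rw [this]; ring
  rw [e1, e2]
  rcases hε with rfl | rfl <;> simp <;> omega

theorem height_iff (p q r : ℕ) (hp : p.Prime) (hq : q.Prime) (hr : r.Prime) (hp3 : 3 ≤ p) (hpq : p < q)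
    (hqr : q < r) :
    (((X ^ (p * q * r) - 1 : ℤ[X]) /ₘ cyclotomic (p * q * r) ℤ).support.sup
      fun k => (((X ^ (p * q * r) - 1 : ℤ[X]) /ₘ cyclotomic (p * q * r) ℤ).coeff k).natAbs) = p - 1 ↔
    (((q : ZMod p) = 1 ∧ (r : ZMod p) = 1) ∨ ((q : ZMod p) = -1 ∧ (r : ZMod p) = -1)) ∧
      (p - 2) * r < (p - 1) * (q - 1) := by
  have hb := psi_coeff_bound p q r hp hq hr hp3 hpq hqr
  have hat := psi_coeff_attain p q r hp hq hr hp3 hpq hqr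
  generalize ((X ^ (p * q * r) - 1 : ℤ[X]) /ₘ cyclotomic (p * q * r) ℤ) = F at hb hat
  constructor
  · intro h
    have hne : F.support.Nonempty := by
      rw [Finset.nonempty_iff_ne_empty]
      intro he
      rw [he] at h
      simp at h
      omega
    obtain ⟨m, _, hm⟩ := Finset.exists_mem_eq_sup _ hne (fun k => (F.coeff k).natAbs)
    rw [h] at hm
    obtain ⟨z, ε, hε, hz⟩ := (hb m).2 (by rw [Int.abs_eq_natAbs, ← hm]; omega)
    exact crit_fwd p q r hp hq hr hp3 hpq hqr z ε hε hz
  · rintro ⟨h1, h2⟩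
    obtain ⟨z, hz0, hz1, ε, hε, hz⟩ := crit_bwd p q r hp hq hr hp3 hpq hqr h1 h2
    obtain ⟨m, hm⟩ := hat z ε hz0 hz1 hε hz
    apply le_antisymm
    · apply Finset.sup_le
      intro k _
      have := (hb k).1
      rw [Int.abs_eq_natAbs] at this
      omega
    · rw [Int.abs_eq_natAbs] at hm
      have h3 : p - 1 = (F.coeff m).natAbs := by omega
      rw [h3]
      exact Finset.le_sup (f := fun k => (F.coeff k).natAbs) (by
        rw [mem_support_iff]; intro h0; rw [h0] at hm; simp at hm; omega)

end NCO

namespace NCO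

theorem interval_sum (e : ℕ → ℝ) (B : ℕ) (E : ℝ) (h : ∀ u ≤ B, |∑ n ∈ Finset.Icc 2 u, e n| ≤ E) (lo hi : ℕ) :
    |∑ r ∈ Finset.Icc 2 B, if lo < r ∧ r ≤ hi then e r else 0| ≤ 2 * E := by
  have key : ∀ u ≤ B, ∑ r ∈ Finset.Icc 2 B, (if r ≤ u then e r else 0) = ∑ r ∈ Finset.Icc 2 u, e r := by
    intro u hu
    rw [← Finset.sum_filter]
    congr 1
    ext r; simp; omega
  have h1 : ∑ r ∈ Finset.Icc 2 B, (if lo < r ∧ r ≤ hi then e r else 0) =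
      ∑ r ∈ Finset.Icc 2 (min hi B), e r - ∑ r ∈ Finset.Icc 2 (min lo (min hi B)), e r := by
    rw [← key (min hi B) (min_le_right _ _), ← key (min lo (min hi B)) (by omega), ← Finset.sum_sub_distrib]
    apply Finset.sum_congr rfl
    intro r hr
    rw [Finset.mem_Icc] at hr
    split_ifs <;> first | (exfalso; omega) | simp
  rw [h1]
  refine (abs_sub _ _).trans ?_
  have := h (min hi B) (min_le_right _ _)
  have := h (min lo (min hi B)) (by omega)
  linarith

open Classical in
theorem bilinear (f w : ℕ → ℝ) (B : ℕ) (E : ℝ) (P : ℕ → ℕ → Prop)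
    (hf : ∀ n, 2 ≤ n → 0 ≤ f n) (hw : ∀ n, 2 ≤ n → 0 ≤ w n)
    (h : ∀ u ≤ B, |∑ n ∈ Finset.Icc 2 u, (f n - w n)| ≤ E)
    (hrow : ∀ q, 2 ≤ q → ∃ lo hi, ∀ r, P q r ↔ lo < r ∧ r ≤ hi)
    (hcol : ∀ r, ∃ lo hi, ∀ q, P q r ↔ lo < q ∧ q ≤ hi) :
    |∑ q ∈ Finset.Icc 2 B, ∑ r ∈ Finset.Icc 2 B, (if P q r then f q * f r else 0) -
      ∑ q ∈ Finset.Icc 2 B, ∑ r ∈ Finset.Icc 2 B, (if P q r then w q * w r else 0)| ≤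
      2 * E * (∑ n ∈ Finset.Icc 2 B, f n + ∑ n ∈ Finset.Icc 2 B, w n) := by
  have h1 : ∑ q ∈ Finset.Icc 2 B, ∑ r ∈ Finset.Icc 2 B, (if P q r then f q * f r else 0) -
      ∑ q ∈ Finset.Icc 2 B, ∑ r ∈ Finset.Icc 2 B, (if P q r then w q * w r else 0) =
      ∑ q ∈ Finset.Icc 2 B, f q * ∑ r ∈ Finset.Icc 2 B, (if P q r then f r - w r else 0) +
      ∑ r ∈ Finset.Icc 2 B, w r * ∑ q ∈ Finset.Icc 2 B, (if P q r then f q - w q else 0) := by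
    simp only [Finset.mul_sum]
    rw [Finset.sum_comm (f := fun r q => w r * (if P q r then f q - w q else 0))]
    rw [← Finset.sum_sub_distrib, ← Finset.sum_add_distrib]
    apply Finset.sum_congr rfl
    intro q _
    rw [← Finset.sum_sub_distrib, ← Finset.sum_add_distrib]
    apply Finset.sum_congr rfl
    intro r _
    split_ifs <;> ring
  have h2 : ∀ q, 2 ≤ q → |∑ r ∈ Finset.Icc 2 B, (if P q r then f r - w r else 0)| ≤ 2 * E := by
    intro q hq
    obtain ⟨lo, hi, hh⟩ := hrow q hq
    simp only [hh]
    exact interval_sum (fun n => f n - w n) B E h lo hi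
  have h3 : ∀ r, |∑ q ∈ Finset.Icc 2 B, (if P q r then f q - w q else 0)| ≤ 2 * E := by
    intro q
    obtain ⟨lo, hi, hh⟩ := hcol q
    simp only [hh]
    exact interval_sum (fun n => f n - w n) B E h lo hi
  have h4 : ∀ (g : ℕ → ℝ) (v : ℕ → ℝ), (∀ n, 2 ≤ n → 0 ≤ g n) → (∀ q, 2 ≤ q → |v q| ≤ 2 * E) →
      |∑ q ∈ Finset.Icc 2 B, g q * v q| ≤ 2 * E * ∑ n ∈ Finset.Icc 2 B, g n := by
    intro g v hg hv
    refine (Finset.abs_sum_le_sum_abs _ _).trans ?_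
    rw [Finset.mul_sum]
    apply Finset.sum_le_sum
    intro n hn
    rw [Finset.mem_Icc] at hn
    rw [abs_mul, abs_of_nonneg (hg n hn.1), mul_comm]
    exact mul_le_mul_of_nonneg_right (hv n hn.1) (hg n hn.1)
  rw [h1, mul_add]
  exact (abs_add_le _ _).trans (add_le_add (h4 f _ hf h2) (h4 w _ hw (fun r _ => h3 r)))

/-- Facts valid for all large `x`. -/
theorem big : ∃ x₀ : ℝ, 3 ≤ x₀ ∧ ∀ x ≥ x₀, 100 ≤ log x ∧ log x ^ 8 ≤ x ^ (1 / 8 : ℝ) := by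
  have h1 : ∀ᶠ x : ℝ in atTop, 100 ≤ log x := tendsto_log_atTop.eventually_ge_atTop 100
  have h2 : ∀ᶠ x : ℝ in atTop, log x ^ 8 ≤ x ^ (1 / 8 : ℝ) := by
    have := (isLittleO_log_rpow_rpow_atTop (8 : ℝ) (by norm_num : (0 : ℝ) < 1 / 8)).bound (by norm_num : (0 : ℝ) < 1)
    filter_upwards [this, eventually_ge_atTop 1] with x hx hx1
    rw [one_mul, Real.norm_eq_abs, Real.norm_eq_abs] at hx
    have h3 : log x ^ (8 : ℝ) = log x ^ 8 := by exact_mod_cast rpow_natCast (log x) 8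
    rw [h3] at hx
    rw [abs_of_nonneg (by positivity : (0 : ℝ) ≤ x ^ (1 / 8 : ℝ))] at hx
    exact (le_abs_self _).trans hx
  obtain ⟨x₀, h⟩ := (eventually_atTop.1 (h1.and h2))
  exact ⟨max x₀ 3, le_max_right _ _, fun x hx => h x ((le_max_left _ _).trans hx)⟩

/-- working package: `z = x^(1/8)`, `y = x/p`. -/
theorem big_facts (x : ℝ) (hx : 3 ≤ x) (hL : 100 ≤ log x) (h8 : log x ^ 8 ≤ x ^ (1 / 8 : ℝ)) (p : ℕ) (hp : 3 ≤ p)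
    (hpL : (p : ℝ) ≤ log x / 32) :
    (x ^ (1 / 8 : ℝ)) ^ 7 ≤ x / p ∧ (x ^ (1 / 8 : ℝ)) ^ 3 ≤ √(x / p) ∧ 100 ≤ x ^ (1 / 8 : ℝ) ∧
      log (x ^ (1 / 8 : ℝ)) = log x / 8 := by
  have hx0 : 0 < x := by linarith
  set z := x ^ (1 / 8 : ℝ) with hz
  have hz8 : z ^ 8 = x := by
    rw [hz, ← rpow_natCast, ← rpow_mul hx0.le]; norm_num
  have hp0 : (0 : ℝ) < p := by exact_mod_cast (by omega : 0 < p)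
  have hLz : log x ≤ z := by
    refine le_trans ?_ h8
    exact le_self_pow₀ (by linarith) (by norm_num)
  have hz1 : 100 ≤ z := by linarith
  have h1 : z ^ 7 ≤ x / p := by
    rw [le_div_iff₀ hp0, ← hz8]
    have : (p : ℝ) ≤ z := by linarith
    calc z ^ 7 * p ≤ z ^ 7 * z := by gcongr
      _ = z ^ 8 := by ring
  refine ⟨h1, ?_, hz1, ?_⟩
  · apply le_sqrt_of_sq_le
    refine le_trans ?_ h1
    rw [← pow_mul]
    exact pow_le_pow_right₀ (by linarith) (by norm_num)
  · rw [hz, log_rpow hx0]; ring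

theorem E_bound : ∃ C > (0 : ℝ), ∀ x : ℝ, 3 ≤ x → 100 ≤ log x → log x ^ 8 ≤ x ^ (1 / 8 : ℝ) →
    ∀ (p : ℕ) [Fact p.Prime] (a : ZMod p), IsUnit a → 3 ≤ p → (p : ℝ) ≤ log x / 32 →
    ∀ u : ℕ, u ≤ ⌊2 * √(x / p)⌋₊ → |∑ n ∈ Finset.Icc 2 u, ee p a n| ≤ C * √(x / p) / log x ^ 2 := by
  obtain ⟨C, hC, h⟩ := pnt_ap
  refine ⟨C * 128 + 1, by positivity, ?_⟩
  intro x hx hL h8 p _ a ha hp hpL u hu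
  obtain ⟨b1, b2, b3, b4⟩ := big_facts x hx hL h8 p hp hpL
  set z := x ^ (1 / 8 : ℝ) with hz
  have hs0 : 0 ≤ √(x / p) := sqrt_nonneg _
  have hu' : (u : ℝ) ≤ 2 * √(x / p) := (Nat.le_floor_iff (by positivity)).1 hu
  rcases le_or_gt z u with hzu | hzu
  · have h1 := h p a ha hp u (by linarith) (by
      have : log z ≤ log u := log_le_log (by linarith) hzu
      rw [b4] at this
      linarith)
    rw [Nat.floor_natCast] at h1
    refine h1.trans ?_
    have h2 : log x / 8 ≤ log u := by rw [← b4]; exact log_le_log (by linarith) hzu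
    calc C * u / log u ^ 2 ≤ C * (2 * √(x / p)) / (log x / 8) ^ 2 := by gcongr
      _ = C * 128 * √(x / p) / log x ^ 2 := by field_simp; ring
      _ ≤ _ := by gcongr; linarith
  · have h1 : |∑ n ∈ Finset.Icc 2 u, ee p a n| ≤ u := by
      refine (Finset.abs_sum_le_sum_abs _ _).trans ?_
      refine (Finset.sum_le_sum (g := fun _ => (1 : ℝ)) (fun n hn => ee_abs p hp a n (Finset.mem_Icc.1 hn).1)).trans ?_
      simp
    refine h1.trans (hzu.le.trans ?_)
    rw [le_div_iff₀ (by positivity)]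
    have h2 : log x ^ 2 ≤ z := le_trans (pow_le_pow_right₀ (by linarith) (by norm_num)) h8
    calc z * log x ^ 2 ≤ z * z := by gcongr
      _ ≤ z ^ 3 := by nlinarith
      _ ≤ √(x / p) := b2
      _ ≤ _ := by nlinarith

theorem wsum_bound (x : ℝ) (hx : 3 ≤ x) (hL : 100 ≤ log x) (h8 : log x ^ 8 ≤ x ^ (1 / 8 : ℝ)) (p : ℕ) (hp : 3 ≤ p)
    (hpL : (p : ℝ) ≤ log x / 32) :
    ∑ n ∈ Finset.Icc 2 ⌊2 * √(x / p)⌋₊, 1 / (((p : ℝ) - 1) * log n) ≤ 36 * √(x / p) / (p * log x) := by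
  obtain ⟨b1, b2, b3, b4⟩ := big_facts x hx hL h8 p hp hpL
  set z := x ^ (1 / 8 : ℝ) with hz
  set B := ⌊2 * √(x / p)⌋₊ with hB
  have hp3 : (3 : ℝ) ≤ p := by exact_mod_cast hp
  have hB' : (B : ℝ) ≤ 2 * √(x / p) := Nat.floor_le (by positivity)
  have h1 : ∑ n ∈ Finset.Icc 2 B, 1 / (((p : ℝ) - 1) * log n) ≤
      ∑ n ∈ Finset.Icc 2 B, 1 / ((p : ℝ) - 1) * (8 / log x + 2 * (if n ≤ ⌊z⌋₊ then 1 else 0)) := by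
    apply Finset.sum_le_sum
    intro n hn
    rw [Finset.mem_Icc] at hn
    have hn2 : (2 : ℝ) ≤ n := by exact_mod_cast hn.1
    rw [← one_div_mul_one_div]
    have : 0 < (p : ℝ) - 1 := by linarith
    gcongr
    split_ifs with hnz
    · have h2 : 1 / 2 ≤ log n := by
        have := log_two_gt_d9
        have := log_le_log (by norm_num) hn2
        linarith
      have : 1 / log n ≤ 1 / (1 / 2) := by gcongr
      have : 0 ≤ 8 / log x := by positivity
      linarith
    · have h2 : z ≤ n := by
        rw [not_le] at hnz
        exact (Nat.lt_of_floor_lt hnz).le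
      have h3 : log x / 8 ≤ log n := by rw [← b4]; exact log_le_log (by linarith) h2
      have : 1 / log n ≤ 1 / (log x / 8) := by gcongr
      have e : 1 / (log x / 8) = 8 / log x := by field_simp
      linarith
  refine h1.trans ?_
  rw [← Finset.mul_sum, Finset.sum_add_distrib, ← Finset.mul_sum]
  have h2 : ∑ n ∈ Finset.Icc 2 B, (8 / log x) ≤ 2 * √(x / p) * (8 / log x) := by
    rw [Finset.sum_const, nsmul_eq_mul]
    gcongr
    refine le_trans ?_ hB'
    simp
  have h3 : ∑ n ∈ Finset.Icc 2 B, (if n ≤ ⌊z⌋₊ then (1 : ℝ) else 0) ≤ z := by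
    rw [← Finset.sum_filter, Finset.sum_const, nsmul_eq_mul, mul_one]
    have : ((Finset.Icc 2 B).filter (fun n => n ≤ ⌊z⌋₊)).card ≤ (Finset.Icc 2 ⌊z⌋₊).card :=
      Finset.card_le_card (fun n => by simp; omega)
    have h4 : (((Finset.Icc 2 B).filter (fun n => n ≤ ⌊z⌋₊)).card : ℝ) ≤ (⌊z⌋₊ : ℝ) := by
      have h5 : (Finset.Icc 2 ⌊z⌋₊).card ≤ ⌊z⌋₊ := by simp
      exact_mod_cast this.trans h5
    exact h4.trans (Nat.floor_le (by linarith))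
  have h4 : z ≤ √(x / p) / log x := by
    rw [le_div_iff₀ (by positivity)]
    have h2 : log x ≤ z := le_trans (le_self_pow₀ (by linarith) (by norm_num)) h8
    calc z * log x ≤ z * z := by gcongr
      _ ≤ z ^ 3 := by nlinarith
      _ ≤ √(x / p) := b2
  have h5 : 1 / ((p : ℝ) - 1) ≤ 2 / p := by
    rw [div_le_div_iff₀ (by linarith) (by linarith)]; linarith
  calc 1 / ((p : ℝ) - 1) * (∑ n ∈ Finset.Icc 2 B, (8 / log x) + 2 * ∑ n ∈ Finset.Icc 2 B, (if n ≤ ⌊z⌋₊ then (1 : ℝ) else 0))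
      ≤ 2 / p * (2 * √(x / p) * (8 / log x) + 2 * (√(x / p) / log x)) := by
        gcongr
        exact h3.trans h4
    _ = _ := by field_simp; ring

/-- The region of pairs `(q, r)`. -/
def DD (p : ℕ) (y : ℝ) (q r : ℕ) : Prop := q < r ∧ (p - 2) * r < (p - 1) * (q - 1) ∧ (q : ℝ) * r ≤ y

theorem DD_row (p : ℕ) (hp : 3 ≤ p) (y : ℝ) (hy : 0 ≤ y) (q : ℕ) (hq : 1 ≤ q) (r : ℕ) :
    DD p y q r ↔ q < r ∧ r ≤ min ⌊y / q⌋₊ (((p - 1) * (q - 1) - 1) / (p - 2)) := by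
  unfold DD
  have hq0 : (0 : ℝ) < q := by exact_mod_cast hq
  rw [le_min_iff, Nat.le_floor_iff (by positivity), le_div_iff₀ hq0, Nat.le_div_iff_mul_le (by omega), mul_comm (r : ℝ),
    mul_comm r]
  constructor
  · rintro ⟨h1, h2, h3⟩
    exact ⟨h1, h3, by omega⟩
  · rintro ⟨h1, h3, h2⟩
    refine ⟨h1, ?_, h3⟩
    have h4 : 0 < (p - 2) * r := Nat.mul_pos (by omega) (by omega)
    omega

theorem DD_col (p : ℕ) (hp : 3 ≤ p) (y : ℝ) (hy : 0 ≤ y) (r : ℕ) (q : ℕ) :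
    DD p y q r ↔ (p - 2) * r / (p - 1) + 1 < q ∧ q ≤ min (r - 1) ⌊y / r⌋₊ := by
  unfold DD
  rcases Nat.eq_zero_or_pos r with rfl | hr
  · simp; omega
  have hr0 : (0 : ℝ) < r := by exact_mod_cast hr
  rw [le_min_iff, Nat.le_floor_iff (by positivity), le_div_iff₀ hr0]
  have h1 : (p - 2) * r < (p - 1) * (q - 1) ↔ (p - 2) * r / (p - 1) < q - 1 := by
    rw [Nat.div_lt_iff_lt_mul (by omega), mul_comm (q - 1)]
  rw [h1]
  generalize (p - 2) * r / (p - 1) = t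
  constructor
  · rintro ⟨h1, h2, h3⟩
    exact ⟨by omega, by omega, h3⟩
  · rintro ⟨h1, h2, h3⟩
    exact ⟨by omega, by omega, h3⟩

open Classical in
/-- weighted and unweighted sums over the region -/
noncomputable def SD (p : ℕ) (y : ℝ) (g : ℕ → ℕ → ℝ) : ℝ :=
  ∑ q ∈ Finset.Icc 2 ⌊2 * √y⌋₊, ∑ r ∈ Finset.Icc 2 ⌊2 * √y⌋₊, if DD p y q r then g q r else 0

/-- indicator of primes in a class -/
noncomputable def ff (p : ℕ) (a : ZMod p) (n : ℕ) : ℝ := if n.Prime ∧ a = (n : ZMod p) then 1 else 0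

theorem bilin_p : ∃ C > (0 : ℝ), ∀ x : ℝ, 3 ≤ x → 100 ≤ log x → log x ^ 8 ≤ x ^ (1 / 8 : ℝ) →
    ∀ (p : ℕ) [Fact p.Prime] (a : ZMod p), IsUnit a → 3 ≤ p → (p : ℝ) ≤ log x / 32 →
    |SD p (x / p) (fun q r => ff p a q * ff p a r) -
      SD p (x / p) (fun q r => 1 / (((p : ℝ) - 1) * log q) * (1 / (((p : ℝ) - 1) * log r)))| ≤
      C * (x / (p ^ 2 * log x ^ 3) + x / (p * log x ^ 4)) := by
  obtain ⟨C, hC, h⟩ := E_bound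
  refine ⟨2 * C * (72 + C), by positivity, ?_⟩
  intro x hx hL h8 p _ a ha hp hpL
  have hE := h x hx hL h8 p a ha hp hpL
  have hw := wsum_bound x hx hL h8 p hp hpL
  have hp3 : (3 : ℝ) ≤ p := by exact_mod_cast hp
  have hx0 : 0 < x := by linarith
  have hy : 0 ≤ x / p := by positivity
  set B := ⌊2 * √(x / p)⌋₊ with hB
  set w : ℕ → ℝ := fun n => 1 / (((p : ℝ) - 1) * log n) with hwdef
  set E := C * √(x / p) / log x ^ 2 with hEdef
  have hE0 : 0 ≤ E := by positivity
  have hmain := bilinear (ff p a) w B E (DD p (x / p))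
    (fun n _ => by unfold ff; split_ifs <;> norm_num) (fun n hn => (inv_log_le p hp n hn).1)
    (fun u hu => hE u hu) (fun q hq => ⟨q, _, fun r => DD_row p hp (x / p) hy q (by omega) r⟩)
    (fun r => ⟨_, _, fun q => DD_col p hp (x / p) hy r q⟩)
  refine hmain.trans ?_
  have hfsum : ∑ n ∈ Finset.Icc 2 B, ff p a n ≤ ∑ n ∈ Finset.Icc 2 B, w n + E := by
    have := (abs_le.1 (hE B le_rfl)).2
    have e : ∑ n ∈ Finset.Icc 2 B, ee p a n = ∑ n ∈ Finset.Icc 2 B, ff p a n - ∑ n ∈ Finset.Icc 2 B, w n := by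
      rw [← Finset.sum_sub_distrib]; rfl
    linarith
  have hsq : √(x / p) * √(x / p) = x / p := mul_self_sqrt hy
  calc 2 * E * (∑ n ∈ Finset.Icc 2 B, ff p a n + ∑ n ∈ Finset.Icc 2 B, w n)
      ≤ 2 * E * (2 * (36 * √(x / p) / (p * log x)) + E) := by
        apply mul_le_mul_of_nonneg_left _ (by positivity)
        have hw2 : ∑ n ∈ Finset.Icc 2 B, w n ≤ 36 * √(x / p) / (p * log x) := hw
        linarith
    _ = 2 * C * (√(x / p) * √(x / p)) * (72 / (p * log x ^ 3) + C / log x ^ 4) := by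
        rw [hEdef]; field_simp; ring
    _ = 2 * C * (72 * (x / (p ^ 2 * log x ^ 3)) + C * (x / (p * log x ^ 4))) := by
        rw [hsq]; field_simp
    _ ≤ 2 * C * ((72 + C) * (x / (p ^ 2 * log x ^ 3)) + (72 + C) * (x / (p * log x ^ 4))) := by
        gcongr <;> linarith
    _ = _ := by ring

end NCO

namespace NCO

/-- upper end of a row of the region -/
noncomputable def UU (p : ℕ) (y : ℝ) (q : ℕ) : ℕ := min ⌊y / q⌋₊ (((p - 1) * (q - 1) - 1) / (p - 2))

theorem DD_mem (p : ℕ) (hp : 3 ≤ p) (y : ℝ) (hy : 0 ≤ y) (q r : ℕ) (h : DD p y q r) :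
    2 ≤ q ∧ q ≤ ⌊√y⌋₊ ∧ 2 ≤ r ∧ r ≤ ⌊2 * √y⌋₊ ∧ r < 2 * q := by
  obtain ⟨h1, h2, h3⟩ := h
  have hq : 2 ≤ q := by
    by_contra hc
    have : q - 1 = 0 := by omega
    rw [this] at h2
    omega
  have hr : r < 2 * q := by
    have h4 : (p - 1) * (q - 1) ≤ (p - 2) * (2 * (q - 1)) := by
      rw [show (p - 2) * (2 * (q - 1)) = (2 * (p - 2)) * (q - 1) by ring]
      exact Nat.mul_le_mul_right _ (by omega)
    have h5 := lt_of_mul_lt_mul_left (h2.trans_le h4) (by omega)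
    omega
  have h1' : (q : ℝ) < r := by exact_mod_cast h1
  have hr' : (r : ℝ) < 2 * q := by exact_mod_cast hr
  have hq0 : (2 : ℝ) ≤ q := by exact_mod_cast hq
  refine ⟨hq, ?_, by omega, ?_, hr⟩
  · rw [Nat.le_floor_iff (by positivity)]
    apply le_sqrt_of_sq_le
    nlinarith
  · rw [Nat.le_floor_iff (by positivity)]
    have : (r : ℝ) / 2 ≤ √y := by
      apply le_sqrt_of_sq_le
      nlinarith
    linarith

theorem SD_eq (p : ℕ) (hp : 3 ≤ p) (y : ℝ) (hy : 0 ≤ y) (g : ℕ → ℕ → ℝ) :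
    SD p y g = ∑ q ∈ Finset.Icc 1 ⌊√y⌋₊, ∑ r ∈ Finset.Ioc q (UU p y q), g q r := by
  have h1 : ∀ q, 1 ≤ q → (∑ r ∈ Finset.Icc 2 ⌊2 * √y⌋₊, (open Classical in if DD p y q r then g q r else 0)) =
      ∑ r ∈ Finset.Ioc q (UU p y q), g q r := by
    intro q hq
    classical
    rw [← Finset.sum_filter]
    congr 1
    ext r
    rw [Finset.mem_filter, Finset.mem_Icc, Finset.mem_Ioc]
    unfold UU
    rw [← DD_row p hp y hy q hq r]
    constructor
    · exact fun h => h.2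
    · intro h
      have := DD_mem p hp y hy q r h
      exact ⟨⟨this.2.2.1, this.2.2.2.1⟩, h⟩
  have h0 : ∀ q, 1 ≤ q → ¬ (2 ≤ q ∧ q ≤ ⌊√y⌋₊) → ∑ r ∈ Finset.Ioc q (UU p y q), g q r = 0 := by
    intro q hq hc
    apply Finset.sum_eq_zero
    intro r hr
    exfalso
    apply hc
    rw [Finset.mem_Ioc] at hr
    have := DD_mem p hp y hy q r ((DD_row p hp y hy q hq r).2 hr)
    exact ⟨this.1, this.2.1⟩
  unfold SD
  rw [Finset.sum_congr rfl (fun q hq => h1 q (by have := (Finset.mem_Icc.1 hq).1; omega))]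
  have hle : ⌊√y⌋₊ ≤ ⌊2 * √y⌋₊ := Nat.floor_mono (by linarith [sqrt_nonneg y])
  rw [← Finset.sum_subset (s₁ := Finset.Icc 2 ⌊√y⌋₊) (s₂ := Finset.Icc 2 ⌊2 * √y⌋₊),
    ← Finset.sum_subset (s₁ := Finset.Icc 2 ⌊√y⌋₊) (s₂ := Finset.Icc 1 ⌊√y⌋₊)]
  · intro q; simp; omega
  · intro q hq hq2
    rw [Finset.mem_Icc] at hq hq2
    exact h0 q hq.1 hq2
  · intro q; simp; omega
  · intro q hq hq2
    rw [Finset.mem_Icc] at hq hq2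
    exact h0 q (by omega) hq2

theorem harm (a b : ℕ) (ha : 1 ≤ a) (hab : a ≤ b) :
    log (b + 1) - log (a + 1) ≤ ∑ q ∈ Finset.Ioc a b, (1 : ℝ) / q ∧
      ∑ q ∈ Finset.Ioc a b, (1 : ℝ) / q ≤ log b - log a := by
  induction b, hab using Nat.le_induction with
  | base => simp
  | succ b hb ih =>
    rw [Finset.sum_Ioc_succ_top (by omega)]
    have hb0 : (0 : ℝ) < b := by exact_mod_cast (by omega : 0 < b)
    push_cast
    have e1 : log ((b : ℝ) + 1 + 1) - log (b + 1) ≤ 1 / (b + 1) := by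
      rw [← log_div (by positivity) (by positivity)]
      have := log_le_sub_one_of_pos (x := ((b : ℝ) + 1 + 1) / (b + 1)) (by positivity)
      have e : ((b : ℝ) + 1 + 1) / (b + 1) - 1 = 1 / (b + 1) := by field_simp; ring
      linarith
    have e2 : 1 / ((b : ℝ) + 1) ≤ log (b + 1) - log b := by
      rw [← log_div (by positivity) (by positivity)]
      have := one_sub_inv_le_log_of_pos (x := ((b : ℝ) + 1) / b) (by positivity)
      have e : 1 - (((b : ℝ) + 1) / b)⁻¹ = 1 / (b + 1) := by field_simp; ring
      linarith
    constructor <;> linarith [ih.1, ih.2]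

theorem row_count (p : ℕ) (hp : 3 ≤ p) (y : ℝ) (hy : 0 ≤ y) (q : ℕ) (hq : 1 ≤ q) (hqy : (q : ℝ) * q ≤ y) :
    |((UU p y q - q : ℕ) : ℝ) - (min (((p : ℝ) - 1) / (p - 2) * q) (y / q) - q)| ≤ 4 := by
  have hp3 : (3 : ℝ) ≤ p := by exact_mod_cast hp
  have hp2 : 0 < (p : ℝ) - 2 := by linarith
  have hq0 : (1 : ℝ) ≤ q := by exact_mod_cast hq
  set l := ((p : ℝ) - 1) / (p - 2) with hl
  have hl1 : 1 ≤ l := by rw [hl, le_div_iff₀ hp2]; linarith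
  have hl2 : l ≤ 2 := by rw [hl, div_le_iff₀ hp2]; linarith
  have hlp : l * (p - 2) = p - 1 := by rw [hl]; field_simp
  have hyq : (q : ℝ) ≤ y / q := by rw [le_div_iff₀ (by linarith)]; exact hqy
  set m := (p - 1) * (q - 1) - 1 with hm
  have hmr : (m : ℝ) ≤ (p - 1) * q := by
    have h1 : m ≤ (p - 1) * q := (Nat.sub_le _ _).trans (Nat.mul_le_mul_left _ (by omega))
    have h2 : ((p - 1 : ℕ) : ℝ) = p - 1 := by rw [Nat.cast_sub (by omega)]; simp
    rw [← h2]; exact_mod_cast h1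
  have hml : ((p : ℝ) - 1) * (q - 1) ≤ m + 1 := by
    have h1 : (p - 1) * (q - 1) ≤ m + 1 := by omega
    have h2 : ((p - 1 : ℕ) : ℝ) = p - 1 := by rw [Nat.cast_sub (by omega)]; simp
    have h3 : ((q - 1 : ℕ) : ℝ) = q - 1 := by rw [Nat.cast_sub (by omega)]; simp
    rw [← h2, ← h3]; exact_mod_cast h1
  have hc : ((p - 2 : ℕ) : ℝ) = p - 2 := by rw [Nat.cast_sub (by omega)]; simp
  have hU1 : ((m / (p - 2) : ℕ) : ℝ) ≤ l * q := by
    refine (Nat.cast_div_le).trans ?_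
    rw [hc, div_le_iff₀ hp2]
    calc (m : ℝ) ≤ (p - 1) * q := hmr
      _ = l * q * (p - 2) := by rw [← hlp]; ring
  have hU2 : l * q - 4 ≤ ((m / (p - 2) : ℕ) : ℝ) := by
    have h1 : m < (p - 2) * (m / (p - 2) + 1) := Nat.lt_mul_div_succ _ (by omega)
    have h2 : (m : ℝ) < (p - 2) * (((m / (p - 2) : ℕ) : ℝ) + 1) := by
      rw [← hc]; exact_mod_cast h1
    have h3 : ((p : ℝ) - 2) * (l * q - 4) ≤ (p - 2) * ((m / (p - 2) : ℕ) : ℝ) := by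
      have : ((p : ℝ) - 2) * (l * q) = (p - 1) * q := by rw [← hlp]; ring
      nlinarith
    exact le_of_mul_le_mul_left h3 hp2
  have hf1 : (⌊y / q⌋₊ : ℝ) ≤ y / q := Nat.floor_le (by positivity)
  have hf2 : y / q - 1 < ⌊y / q⌋₊ := Nat.sub_one_lt_floor _
  have hUc : (UU p y q : ℝ) = min (⌊y / q⌋₊ : ℝ) ((m / (p - 2) : ℕ) : ℝ) := by
    unfold UU; rw [Nat.cast_min]
  have hup : (UU p y q : ℝ) ≤ min (l * q) (y / q) := by
    rw [hUc]
    exact le_min ((min_le_right _ _).trans hU1) ((min_le_left _ _).trans hf1)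
  have hlow : min (l * q) (y / q) - 4 ≤ (UU p y q : ℝ) := by
    rw [hUc]
    apply le_min
    · have := min_le_right (l * q) (y / q); linarith
    · have := min_le_left (l * q) (y / q); linarith
  have hge : (q : ℝ) ≤ min (l * q) (y / q) := le_min (by nlinarith) hyq
  rw [abs_le]
  rcases le_or_gt q (UU p y q) with h | h
  · rw [Nat.cast_sub h]; constructor <;> linarith
  · have h' : (UU p y q : ℝ) < q := by exact_mod_cast h
    rw [Nat.sub_eq_zero_of_le h.le]
    push_cast
    constructor <;> linarith

theorem sum_id_Ioc (b : ℕ) : ∑ q ∈ Finset.Ioc 0 b, (q : ℝ) = b * (b + 1) / 2 := by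
  induction b with
  | zero => simp
  | succ b ih => rw [Finset.sum_Ioc_succ_top (by omega), ih]; push_cast; ring

theorem tri_bound (a s : ℝ) (ha : 0 ≤ a) (h1 : a ≤ s) (h2 : s < a + 1) :
    -(s + 1) ≤ a * (a + 1) - s * s ∧ a * (a + 1) - s * s ≤ s := by
  constructor <;> nlinarith

set_option maxHeartbeats 1000000 in
theorem D_count (p : ℕ) (hp : 3 ≤ p) (y : ℝ) (hy : 16 ≤ y) :
    |SD p y (fun _ _ => 1) - y / 2 * log (((p : ℝ) - 1) / (p - 2))| ≤ 20 * √y := by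
  have hp3 : (3 : ℝ) ≤ p := by exact_mod_cast hp
  have hp2 : 0 < (p : ℝ) - 2 := by linarith
  set l := ((p : ℝ) - 1) / (p - 2) with hl
  have hl1 : 1 ≤ l := by rw [hl, le_div_iff₀ hp2]; linarith
  have hl2 : l ≤ 2 := by rw [hl, div_le_iff₀ hp2]; linarith
  have hy0 : 0 < y := by linarith
  set t := √y with ht
  set s := √(y / l) with hs
  have ht2 : t * t = y := mul_self_sqrt hy0.le
  have hs2 : l * (s * s) = y := by rw [hs, mul_self_sqrt (by positivity)]; field_simp
  have ht4 : 4 ≤ t := by apply le_sqrt_of_sq_le; linarith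
  have hst : s ≤ t := sqrt_le_sqrt (div_le_self hy0.le hl1)
  have hs2' : 2 ≤ s := by
    apply le_sqrt_of_sq_le
    rw [le_div_iff₀ (by linarith)]; linarith
  have hlogs : log s = log t - log l / 2 := by
    rw [hs, ht, log_sqrt (by positivity), log_sqrt hy0.le, log_div (by positivity) (by positivity)]; ring
  set a := ⌊s⌋₊ with ha
  set b := ⌊t⌋₊ with hb
  have hab : a ≤ b := Nat.floor_mono hst
  have ha1 : 1 ≤ a := Nat.le_floor (by push_cast; linarith)
  have has : (a : ℝ) ≤ s := Nat.floor_le (by linarith)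
  have hsa : s < a + 1 := Nat.lt_floor_add_one s
  have hbt : (b : ℝ) ≤ t := Nat.floor_le (by linarith)
  have htb : t < b + 1 := Nat.lt_floor_add_one t
  have ha1' : (1 : ℝ) ≤ a := by exact_mod_cast ha1
  have hSD : SD p y (fun _ _ => 1) = ∑ q ∈ Finset.Ioc 0 b, ((UU p y q - q : ℕ) : ℝ) := by
    rw [SD_eq p hp y hy0.le]
    have : Finset.Icc 1 b = Finset.Ioc 0 b := by ext; simp; omega
    rw [this]
    apply Finset.sum_congr rfl
    intro q _
    simp
  have h1 : |SD p y (fun _ _ => 1) - ∑ q ∈ Finset.Ioc 0 b, (min (l * q) (y / q) - q)| ≤ 4 * t := by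
    rw [hSD, ← Finset.sum_sub_distrib]
    refine (Finset.abs_sum_le_sum_abs _ _).trans ?_
    refine (Finset.sum_le_sum (g := fun _ => (4 : ℝ)) (fun q hq => ?_)).trans ?_
    · rw [Finset.mem_Ioc] at hq
      apply row_count p hp y hy0.le q hq.1
      have h2 : (q : ℝ) ≤ t := le_trans (by exact_mod_cast hq.2) hbt
      rw [← ht2]; gcongr
    · simp; linarith
  have h2 : ∑ q ∈ Finset.Ioc 0 b, (min (l * q) (y / q) - (q : ℝ)) =
      l * (a * (a + 1) / 2) + y * ∑ q ∈ Finset.Ioc a b, (1 : ℝ) / q - b * (b + 1) / 2 := by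
    rw [Finset.sum_sub_distrib, sum_id_Ioc b, ← Finset.sum_Ioc_consecutive _ (Nat.zero_le a) hab, ← sum_id_Ioc a,
      Finset.mul_sum, Finset.mul_sum]
    congr 2
    · apply Finset.sum_congr rfl
      intro q hq
      rw [Finset.mem_Ioc] at hq
      have hq1 : (1 : ℝ) ≤ q := by exact_mod_cast hq.1
      have hq2 : (q : ℝ) ≤ s := le_trans (by exact_mod_cast hq.2) has
      apply min_eq_left
      rw [le_div_iff₀ (by linarith), ← hs2, mul_assoc]
      gcongr
    · apply Finset.sum_congr rfl
      intro q hq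
      rw [Finset.mem_Ioc] at hq
      have hq1 : (a : ℝ) + 1 ≤ q := by exact_mod_cast hq.1
      rw [min_eq_right]
      · ring
      · rw [div_le_iff₀ (by linarith), ← hs2, mul_assoc]
        have : s ≤ q := by linarith
        gcongr
  have h3 := harm a b ha1 hab
  set H := ∑ q ∈ Finset.Ioc a b, (1 : ℝ) / q with hH
  have hlt1 : log t ≤ log (b + 1) := log_le_log (by linarith) htb.le
  have hlt2 : log b ≤ log t := log_le_log (by exact_mod_cast (by omega : 0 < b)) hbt
  have hla1 : log (a + 1) ≤ log (s + 1) := log_le_log (by linarith) (by linarith)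
  have hla2 : log (s / 2) ≤ log a := log_le_log (by linarith) (by linarith)
  have hs0 : 0 < s := by linarith
  have hls1 : log (s + 1) - log s ≤ 1 / s := by
    rw [← log_div (by positivity) (by positivity)]
    have := log_le_sub_one_of_pos (x := (s + 1) / s) (by positivity)
    have e : (s + 1) / s - 1 = 1 / s := by field_simp; ring
    linarith
  have hls2 : log s - log a ≤ 2 / s := by
    rw [← log_div (by positivity) (by positivity)]
    have h5 := log_le_sub_one_of_pos (x := s / a) (by positivity)
    refine h5.trans ?_
    rw [div_sub_one (by positivity), div_le_div_iff₀ (by linarith) hs0]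
    nlinarith
  have hys : y / s = l * s := by rw [← hs2]; field_simp
  have hls : l * s ≤ 2 * t := by nlinarith
  have e1 : y * H - y * (log l / 2) ≤ 4 * t := by
    have : H - log l / 2 ≤ 2 / s := by linarith [h3.2]
    calc y * H - y * (log l / 2) = y * (H - log l / 2) := by ring
      _ ≤ y * (2 / s) := by gcongr
      _ = 2 * (y / s) := by ring
      _ ≤ 4 * t := by rw [hys]; linarith
  have e2 : y * (log l / 2) - y * H ≤ 4 * t := by
    have : log l / 2 - H ≤ 1 / s := by linarith [h3.1]
    calc y * (log l / 2) - y * H = y * (log l / 2 - H) := by ring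
      _ ≤ y * (1 / s) := by gcongr
      _ = (y / s) := by ring
      _ ≤ 4 * t := by rw [hys]; linarith
  have e3 : |l * (a * (a + 1) / 2) - y / 2| ≤ 2 * t := by
    rw [← hs2, abs_le]
    obtain ⟨f2, f1⟩ := tri_bound a s (by linarith) has hsa
    have e : l * (a * (a + 1) / 2) - l * (s * s) / 2 = l / 2 * (a * (a + 1 : ℝ) - s * s) := by ring
    rw [e]
    have hl0 : 0 ≤ l / 2 := by linarith
    have hl3 : l / 2 * (s + 1) ≤ 1 * (s + 1) := mul_le_mul_of_nonneg_right (by linarith) (by linarith)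
    constructor
    · have := mul_le_mul_of_nonneg_left f2 hl0
      linarith
    · have := mul_le_mul_of_nonneg_left f1 hl0
      linarith
  have e4 : |b * (b + 1) / 2 - y / 2| ≤ 2 * t := by
    rw [← ht2, abs_le]
    obtain ⟨f2, f1⟩ := tri_bound b t (by positivity) hbt htb
    constructor <;> linarith
  rw [h2] at h1
  rw [abs_le] at *
  constructor <;> linarith [h1.1, h1.2, e3.1, e3.2, e4.1, e4.2]

end NCO

namespace NCO

theorem pt_bound (L A B δ : ℝ) (hL : 100 ≤ L) (hA : L / 8 ≤ A) (hA2 : 2 * A ≤ L) (hAB : A ≤ B) (hB : B ≤ A + 1)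
    (hδ : L - 2 * A ≤ δ) : |1 / (A * B) - 4 / L ^ 2| ≤ 256 * (δ + 1) / L ^ 3 := by
  have hA0 : 0 < A := by linarith
  have hB0 : 0 < B := by linarith
  have hL0 : 0 < L := by linarith
  have hδ0 : 0 ≤ δ := by linarith
  have h1 : 1 / (A * B) - 4 / L ^ 2 = (L ^ 2 - 4 * (A * B)) / (L ^ 2 * (A * B)) := by field_simp
  have h2 : |L ^ 2 - 4 * (A * B)| ≤ 4 * L * (δ + 1) := by
    have e : L ^ 2 - 4 * (A * B) = (L - 2 * A) * (L + 2 * A) - 4 * (A * (B - A)) := by ring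
    have f1 : (L - 2 * A) * (L + 2 * A) ≤ δ * (2 * L) := by
      apply mul_le_mul hδ (by linarith) (by linarith) hδ0
    have f2 : 0 ≤ (L - 2 * A) * (L + 2 * A) := mul_nonneg (by linarith) (by linarith)
    have f3 : 0 ≤ A * (B - A) := mul_nonneg hA0.le (by linarith)
    have f4 : A * (B - A) ≤ A * 1 := mul_le_mul_of_nonneg_left (by linarith) hA0.le
    have f5 : 0 ≤ δ * L := by positivity
    rw [e, abs_le]
    constructor <;> linarith
  have h3 : L ^ 2 * (L / 8 * (L / 8)) ≤ L ^ 2 * (A * B) := by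
    gcongr; linarith
  rw [h1, abs_div, abs_of_pos (by positivity : 0 < L ^ 2 * (A * B))]
  calc |L ^ 2 - 4 * (A * B)| / (L ^ 2 * (A * B)) ≤ 4 * L * (δ + 1) / (L ^ 2 * (L / 8 * (L / 8))) := by gcongr
    _ = _ := by field_simp; ring

theorem main_sum (x : ℝ) (hx : 3 ≤ x) (hL : 100 ≤ log x) (h8 : log x ^ 8 ≤ x ^ (1 / 8 : ℝ)) (p : ℕ) (hp : 3 ≤ p)
    (hpL : (p : ℝ) ≤ log x / 32) :
    |SD p (x / p) (fun q r => 1 / (log q * log r)) - SD p (x / p) (fun _ _ => 4 / log x ^ 2)| ≤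
      2000 * x / log x ^ 3 := by
  obtain ⟨b1, b2, b3, b4⟩ := big_facts x hx hL h8 p hp hpL
  set z := x ^ (1 / 8 : ℝ) with hz
  set L := log x with hLdef
  have hx0 : 0 < x := by linarith
  have hp3 : (3 : ℝ) ≤ p := by exact_mod_cast hp
  have hy0 : 0 < x / p := by positivity
  rw [SD_eq p hp _ hy0.le, SD_eq p hp _ hy0.le, ← Finset.sum_sub_distrib]
  set y := x / p with hy
  set t := √y with ht
  have ht2 : t * t = y := mul_self_sqrt hy0.le
  have ht0 : 0 < t := sqrt_pos.2 hy0
  have hlogp : 0 ≤ log p := log_nonneg (by linarith)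
  have hlogt : log t = (L - log p) / 2 := by
    rw [ht, log_sqrt hy0.le, hy, log_div (by positivity) (by positivity)]
  have hL0 : 0 < L := by linarith
  have hrow : ∀ q ∈ Finset.Icc 1 ⌊t⌋₊, |∑ r ∈ Finset.Ioc q (UU p y q), 1 / (log q * log r) -
      ∑ r ∈ Finset.Ioc q (UU p y q), 4 / L ^ 2| ≤ 256 * (3 + log p) * t / L ^ 3 + 5 * z := by
    intro q hq
    rw [Finset.mem_Icc] at hq
    have hqt : (q : ℝ) ≤ t := (Nat.le_floor_iff ht0.le).1 hq.2
    have hq1 : (1 : ℝ) ≤ q := by exact_mod_cast hq.1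
    rw [← Finset.sum_sub_distrib]
    refine (Finset.abs_sum_le_sum_abs _ _).trans ?_
    have hcard : ((Finset.Ioc q (UU p y q)).card : ℝ) ≤ q := by
      have : Finset.Ioc q (UU p y q) ⊆ Finset.Ioc q (q + q) := by
        intro r hr
        rw [Finset.mem_Ioc] at hr
        have := DD_mem p hp y hy0.le q r ((DD_row p hp y hy0.le q hq.1 r).2 hr)
        rw [Finset.mem_Ioc]; omega
      have := Finset.card_le_card this
      rw [Nat.card_Ioc, Nat.card_Ioc] at this
      rw [Nat.card_Ioc]
      exact_mod_cast (by omega : UU p y q - q ≤ q)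
    rcases lt_or_ge (q : ℝ) z with hqz | hqz
    · have hb : ∀ r ∈ Finset.Ioc q (UU p y q), |1 / (log q * log r) - 4 / L ^ 2| ≤ 5 := by
        intro r hr
        rw [Finset.mem_Ioc] at hr
        have hd := DD_mem p hp y hy0.le q r ((DD_row p hp y hy0.le q hq.1 r).2 hr)
        have g2 : ∀ n : ℕ, 2 ≤ n → 1 / 2 ≤ log n := by
          intro n hn
          have := log_two_gt_d9
          have := log_le_log (by norm_num) (by exact_mod_cast hn : (2 : ℝ) ≤ n)
          linarith
        have g3 := g2 q hd.1
        have g4 := g2 r hd.2.2.1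
        have g5 : 1 / (log q * log r) ≤ 1 / (1 / 2 * (1 / 2)) := by gcongr
        have g6 : 0 < 1 / (log q * log r) := by positivity
        have g7 : 4 / L ^ 2 ≤ 1 := by rw [div_le_one (by positivity)]; nlinarith
        have g8 : 0 < 4 / L ^ 2 := by positivity
        rw [abs_le]
        constructor <;> linarith
      refine (Finset.sum_le_sum hb).trans ?_
      rw [Finset.sum_const, nsmul_eq_mul]
      have : 0 ≤ 256 * (3 + log p) * t / L ^ 3 := by positivity
      nlinarith
    · have hlogq : L / 8 ≤ log q := by rw [← b4]; exact log_le_log (by linarith) hqz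
      have hlq2 : log q ≤ log t := log_le_log (by linarith) hqt
      have hb : ∀ r ∈ Finset.Ioc q (UU p y q), |1 / (log q * log r) - 4 / L ^ 2| ≤
          256 * ((log p + 2 * (t / q)) + 1) / L ^ 3 := by
        intro r hr
        rw [Finset.mem_Ioc] at hr
        have hd := DD_mem p hp y hy0.le q r ((DD_row p hp y hy0.le q hq.1 r).2 hr)
        have hqr : (q : ℝ) < r := by exact_mod_cast hr.1
        have hr2 : (r : ℝ) ≤ 2 * q := by exact_mod_cast hd.2.2.2.2.le
        apply pt_bound L _ _ _ hL hlogq (by linarith) (log_le_log (by linarith) hqr.le)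
        · have h5 := log_le_log (by linarith) hr2
          rw [log_mul (by norm_num) (by linarith)] at h5
          have := log_two_lt_d9
          linarith
        · have h5 := log_le_sub_one_of_pos (x := t / q) (by positivity)
          rw [log_div (by positivity) (by positivity), hlogt] at h5
          linarith
      refine (Finset.sum_le_sum hb).trans ?_
      rw [Finset.sum_const, nsmul_eq_mul]
      calc ((Finset.Ioc q (UU p y q)).card : ℝ) * (256 * ((log p + 2 * (t / q)) + 1) / L ^ 3)
          ≤ q * (256 * ((log p + 2 * (t / q)) + 1) / L ^ 3) := by gcongr
        _ = 256 * (q * log p + 2 * t + q) / L ^ 3 := by field_simp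
        _ ≤ 256 * (t * log p + 2 * t + t) / L ^ 3 := by gcongr
        _ = 256 * (3 + log p) * t / L ^ 3 := by ring
        _ ≤ _ := by linarith
  refine (Finset.abs_sum_le_sum_abs _ _).trans ((Finset.sum_le_sum hrow).trans ?_)
  rw [Finset.sum_const, nsmul_eq_mul]
  have hcard : ((Finset.Icc 1 ⌊t⌋₊).card : ℝ) ≤ t := by
    rw [Nat.card_Icc]; simpa using Nat.floor_le ht0.le
  have hzt : z ≤ t / L ^ 3 := by
    rw [le_div_iff₀ (by positivity)]
    have h2 : L ^ 3 ≤ z := le_trans (pow_le_pow_right₀ (by linarith) (by norm_num)) h8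
    calc z * L ^ 3 ≤ z * z := by gcongr
      _ ≤ z ^ 3 := by nlinarith
      _ ≤ t := b2
  have hlp : log p ≤ p := (log_le_sub_one_of_pos (by linarith)).trans (by linarith)
  calc ((Finset.Icc 1 ⌊t⌋₊).card : ℝ) * (256 * (3 + log p) * t / L ^ 3 + 5 * z)
      ≤ t * (256 * (p + p) * t / L ^ 3 + 5 * (p * (t / L ^ 3))) := by
        gcongr
        have : 0 ≤ t / L ^ 3 := by positivity
        nlinarith
    _ = 517 * p * (t * t) / L ^ 3 := by field_simp; ring
    _ = 517 * x / L ^ 3 := by rw [ht2, hy]; field_simp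
    _ ≤ _ := by gcongr; norm_num

theorem SD_mul (p : ℕ) (y c : ℝ) (g : ℕ → ℕ → ℝ) : SD p y (fun q r => c * g q r) = c * SD p y g := by
  unfold SD
  rw [Finset.mul_sum]
  apply Finset.sum_congr rfl
  intro q _
  rw [Finset.mul_sum]
  apply Finset.sum_congr rfl
  intro r _
  split_ifs <;> simp

theorem small_p : ∃ C > (0 : ℝ), ∀ x : ℝ, 3 ≤ x → 100 ≤ log x → log x ^ 8 ≤ x ^ (1 / 8 : ℝ) →
    ∀ (p : ℕ) [Fact p.Prime] (a : ZMod p), IsUnit a → 3 ≤ p → (p : ℝ) ≤ log x / 32 →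
    |SD p (x / p) (fun q r => ff p a q * ff p a r) -
      2 * (1 / ((p : ℝ) * ((p : ℝ) - 1) ^ 2) * log (((p : ℝ) - 1) / (p - 2))) * x / log x ^ 2| ≤
      C * (x / (p ^ 2 * log x ^ 3) + x / (p * log x ^ 4)) := by
  obtain ⟨C, hC, h⟩ := bilin_p
  refine ⟨C + 9000, by positivity, ?_⟩
  intro x hx hL h8 p _ a ha hp hpL
  have h1 := h x hx hL h8 p a ha hp hpL
  have h2 := main_sum x hx hL h8 p hp hpL
  obtain ⟨b1, b2, b3, b4⟩ := big_facts x hx hL h8 p hp hpL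
  set z := x ^ (1 / 8 : ℝ) with hz
  set L := log x with hLdef
  have hx0 : 0 < x := by linarith
  have hp3 : (3 : ℝ) ≤ p := by exact_mod_cast hp
  have hL0 : 0 < L := by linarith
  have hz7 : z ≤ z ^ 7 := le_self_pow₀ (by linarith) (by norm_num)
  have h3 := D_count p hp (x / p) (by linarith)
  have hp1 : 0 < (p : ℝ) - 1 := by linarith
  have e1 : SD p (x / p) (fun q r => 1 / (((p : ℝ) - 1) * log q) * (1 / (((p : ℝ) - 1) * log r))) =
      1 / ((p : ℝ) - 1) ^ 2 * SD p (x / p) (fun q r => 1 / (log q * log r)) := by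
    rw [← SD_mul]
    congr 1
    funext q r
    rw [one_div_mul_one_div, one_div_mul_one_div]
    congr 1; ring
  have e2 : SD p (x / p) (fun _ _ => 4 / L ^ 2) = 4 / L ^ 2 * SD p (x / p) (fun _ _ => 1) := by
    rw [← SD_mul]; simp
  rw [e1] at h1
  rw [e2] at h2
  set S1 := SD p (x / p) (fun q r => ff p a q * ff p a r)
  set S2 := SD p (x / p) (fun q r => 1 / (log q * log r))
  set S3 := SD p (x / p) (fun _ _ => 1)
  set l := log (((p : ℝ) - 1) / (p - 2))
  have hdec : S1 - 2 * (1 / ((p : ℝ) * ((p : ℝ) - 1) ^ 2) * l) * x / L ^ 2 =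
      (S1 - 1 / ((p : ℝ) - 1) ^ 2 * S2) + 1 / ((p : ℝ) - 1) ^ 2 * (S2 - 4 / L ^ 2 * S3) +
      1 / ((p : ℝ) - 1) ^ 2 * (4 / L ^ 2) * (S3 - x / p / 2 * l) := by
    field_simp; ring
  have hpp : 1 / ((p : ℝ) - 1) ^ 2 ≤ 4 / p ^ 2 := by
    rw [div_le_div_iff₀ (by positivity) (by positivity)]; nlinarith
  have hsq : √(x / p) ≤ x / L := by
    have hy0 : 0 < x / p := by positivity
    have f1 : √(x / p) * √(x / p) = x / p := mul_self_sqrt hy0.le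
    have f2 : L ≤ √(x / p) := by
      refine le_trans ?_ b2
      refine le_trans (le_trans (le_self_pow₀ (by linarith) (by norm_num)) h8) (le_self_pow₀ (by linarith) (by norm_num))
    rw [le_div_iff₀ hL0]
    calc √(x / p) * L ≤ √(x / p) * √(x / p) := by gcongr
      _ = x / p := f1
      _ ≤ x := div_le_self hx0.le (by linarith)
  have t2 : |1 / ((p : ℝ) - 1) ^ 2 * (S2 - 4 / L ^ 2 * S3)| ≤ 4 / p ^ 2 * (2000 * x / L ^ 3) := by
    rw [abs_mul, abs_of_pos (by positivity)]
    gcongr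
  have t3 : |1 / ((p : ℝ) - 1) ^ 2 * (4 / L ^ 2) * (S3 - x / p / 2 * l)| ≤ 4 / p ^ 2 * (4 / L ^ 2) * (20 * (x / L)) := by
    rw [abs_mul, abs_of_pos (by positivity)]
    gcongr
    exact h3.trans (by gcongr)
  rw [hdec]
  refine (abs_add_le _ _).trans ((add_le_add (abs_add_le _ _) le_rfl).trans ?_)
  have e5 : 4 / (p : ℝ) ^ 2 * (2000 * x / L ^ 3) + 4 / p ^ 2 * (4 / L ^ 2) * (20 * (x / L)) = 8320 * (x / (p ^ 2 * L ^ 3)) := by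
    field_simp; norm_num
  have p1 : 0 ≤ x / (p ^ 2 * L ^ 3) := by positivity
  have p2 : 0 ≤ x / (p * L ^ 4) := by positivity
  rw [add_mul, mul_add 9000]
  linarith

end NCO

namespace NCO

open Classical in
/-- the admissible pairs `(q, r)` in the class `a` -/
noncomputable def TT (p : ℕ) (a : ZMod p) (y : ℝ) : Finset (ℕ × ℕ) :=
  (Finset.Icc 2 ⌊2 * √y⌋₊ ×ˢ Finset.Icc 2 ⌊2 * √y⌋₊).filter
    (fun t => DD p y t.1 t.2 ∧ (t.1.Prime ∧ a = (t.1 : ZMod p)) ∧ (t.2.Prime ∧ a = (t.2 : ZMod p)))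

theorem mem_TT (p : ℕ) (hp : 3 ≤ p) (a : ZMod p) (y : ℝ) (hy : 0 ≤ y) (q r : ℕ) :
    (q, r) ∈ TT p a y ↔ DD p y q r ∧ (q.Prime ∧ a = (q : ZMod p)) ∧ (r.Prime ∧ a = (r : ZMod p)) := by
  classical
  unfold TT
  rw [Finset.mem_filter, Finset.mem_product]
  constructor
  · exact fun h => h.2
  · intro h
    refine ⟨?_, h⟩
    obtain ⟨h1, h2, h3, h4, h5⟩ := DD_mem p hp y hy q r h.1
    have hle : ⌊√y⌋₊ ≤ ⌊2 * √y⌋₊ := Nat.floor_mono (by linarith [sqrt_nonneg y])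
    simp only [Finset.mem_Icc]
    omega

theorem SD_card (p : ℕ) (a : ZMod p) (y : ℝ) :
    SD p y (fun q r => ff p a q * ff p a r) = ((TT p a y).card : ℝ) := by
  classical
  unfold SD TT ff
  rw [← Finset.sum_product', Finset.card_filter]
  push_cast
  apply Finset.sum_congr rfl
  rintro ⟨q, r⟩ _
  by_cases h1 : DD p y q r <;> by_cases h2 : (q.Prime ∧ a = (q : ZMod p)) <;>
    by_cases h3 : (r.Prime ∧ a = (r : ZMod p)) <;> simp [h1, h2, h3]

theorem p_lt_q (p : ℕ) (hp : p.Prime) (hp3 : 3 ≤ p) (y : ℝ) (q r : ℕ) (hD : DD p y q r) (hq : q.Prime)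
    (h : (q : ZMod p) = 1 ∨ (q : ZMod p) = -1) : p < q := by
  obtain ⟨h1, h2, h3⟩ := hD
  have hq2 := hq.two_le
  by_contra hc
  have hm : p - 1 = q ∨ p = q ∨ q < p - 1 := by omega
  have : Fact p.Prime := ⟨hp⟩
  rcases hm with hm | hm | hm
  · have e : q - 1 = p - 2 := by omega
    rw [e, mul_comm] at h2
    have := lt_of_mul_lt_mul_right h2 (Nat.zero_le _)
    omega
  · subst hm
    simp at h
  · rcases h with h | h
    · have h' : ((q : ℕ) : ZMod p) = ((1 : ℕ) : ZMod p) := by simpa using h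
      rw [ZMod.natCast_eq_natCast_iff'] at h'
      rw [Nat.mod_eq_of_lt (by omega), Nat.mod_eq_of_lt (by omega)] at h'
      omega
    · have h' : ((q + 1 : ℕ) : ZMod p) = 0 := by push_cast; rw [h]; simp
      rw [ZMod.natCast_eq_zero_iff] at h'
      have := Nat.le_of_dvd (by omega) h'
      omega

theorem large_p (p : ℕ) (hp : p.Prime) (hp3 : 3 ≤ p) (a : ZMod p) (ha : a = 1 ∨ a = -1) (x : ℝ) (hx : 0 ≤ x) :
    ((TT p a (x / p)).card : ℝ) ≤ 3 * x / (p : ℝ) ^ 4 := by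
  have hp0 : (3 : ℝ) ≤ p := by exact_mod_cast hp3
  set y := x / p with hy
  have hy0 : 0 ≤ y := by positivity
  have hcard : (TT p a y).card ≤ (Finset.Icc 1 ⌊√y / p⌋₊ ×ˢ Finset.Icc 1 ⌊√y / (p * (p - 2))⌋₊).card := by
    apply Finset.card_le_card_of_injOn (fun t => (t.1 / p, (t.2 - t.1) / p))
    · rintro ⟨q, r⟩ ht
      have ht' := (mem_TT p hp3 a y hy0 q r).1 ht
      obtain ⟨hD, ⟨hq, hqa⟩, ⟨hr, hra⟩⟩ := ht'
      have hpq := p_lt_q p hp hp3 y q r hD hq (by rw [← hqa]; exact ha)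
      obtain ⟨-, hqs, -, -, -⟩ := DD_mem p hp3 y hy0 q r hD
      obtain ⟨h1, h2, h3⟩ := hD
      have hqs' : (q : ℝ) ≤ √y := (Nat.le_floor_iff (sqrt_nonneg y)).1 hqs
      have hdv : p ∣ r - q := by
        have : ((q : ℕ) : ZMod p) = (r : ℕ) := by rw [← hqa, ← hra]
        rw [ZMod.natCast_eq_natCast_iff] at this
        exact (Nat.modEq_iff_dvd' h1.le).1 this
      obtain ⟨j, hj⟩ := hdv
      have hj' : r = q + p * j := by omega
      have hj1 : 1 ≤ j := by
        rcases Nat.eq_zero_or_pos j with h | h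
        · subst h; omega
        · exact h
      have hjj : (r - q) / p = j := by rw [hj]; exact Nat.mul_div_cancel_left _ (by omega)
      show (q / p, (r - q) / p) ∈ _
      rw [hjj, Finset.mem_coe, Finset.mem_product, Finset.mem_Icc, Finset.mem_Icc]
      refine ⟨⟨(Nat.one_le_div_iff (by omega)).2 hpq.le, ?_⟩, hj1, ?_⟩
      · apply Nat.le_floor
        refine Nat.cast_div_le.trans ?_
        gcongr
      · apply Nat.le_floor
        rw [le_div_iff₀ (by nlinarith)]
        obtain ⟨m, rfl⟩ : ∃ m, p = m + 2 := ⟨p - 2, by omega⟩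
        obtain ⟨k, rfl⟩ : ∃ k, q = k + 1 := ⟨q - 1, by omega⟩
        have e1 : m + 2 - 2 = m := by omega
        have e2 : m + 2 - 1 = m + 1 := by omega
        have e3 : k + 1 - 1 = k := by omega
        rw [e1, e2, e3, hj'] at h2
        have h2' : (m : ℝ) * (k + 1 + (m + 2) * j) < (m + 1) * k := by exact_mod_cast h2
        push_cast at hqs' ⊢
        have : (0 : ℝ) ≤ m := by positivity
        nlinarith
    · rintro ⟨q, r⟩ ht ⟨q', r'⟩ ht' he
      obtain ⟨hD, ⟨hq, hqa⟩, ⟨hr, hra⟩⟩ := (mem_TT p hp3 a y hy0 q r).1 ht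
      obtain ⟨hD', ⟨hq', hqa'⟩, ⟨hr', hra'⟩⟩ := (mem_TT p hp3 a y hy0 q' r').1 ht'
      simp only [Prod.mk.injEq] at he ⊢
      have e1 : q = q' := by
        have : ((q : ℕ) : ZMod p) = (q' : ℕ) := by rw [← hqa, ← hqa']
        rw [ZMod.natCast_eq_natCast_iff'] at this
        rw [← Nat.div_add_mod q p, ← Nat.div_add_mod q' p, this, he.1]
      subst e1
      refine ⟨rfl, ?_⟩
      have hdv : ∀ s : ℕ, q < s → a = (s : ZMod p) → p ∣ s - q := by
        intro s hs hsa
        have : ((q : ℕ) : ZMod p) = (s : ℕ) := by rw [← hqa, ← hsa]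
        rw [ZMod.natCast_eq_natCast_iff] at this
        exact (Nat.modEq_iff_dvd' hs.le).1 this
      obtain ⟨j, hj⟩ := hdv r hD.1 hra
      obtain ⟨j', hj'⟩ := hdv r' hD'.1 hra'
      rw [hj, hj', Nat.mul_div_cancel_left _ (by omega), Nat.mul_div_cancel_left _ (by omega)] at he
      have := hD.1
      have := hD'.1
      rw [he.2] at hj
      omega
  have hc2 : ((TT p a y).card : ℝ) ≤ (⌊√y / p⌋₊ : ℝ) * ⌊√y / (p * (p - 2))⌋₊ := by
    have : (TT p a y).card ≤ ⌊√y / p⌋₊ * ⌊√y / (p * (p - 2))⌋₊ := by simpa using hcard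
    exact_mod_cast this
  have hpp : (0 : ℝ) < p * (p - 2) := by nlinarith
  refine hc2.trans ?_
  calc (⌊√y / p⌋₊ : ℝ) * ⌊√y / (p * (p - 2))⌋₊ ≤ (√y / p) * (√y / (p * (p - 2))) := by
        gcongr
        · exact Nat.floor_le (by positivity)
        · exact Nat.floor_le (by positivity)
    _ = x / (p ^ 3 * (p - 2)) := by
        have h2 : (p : ℝ) - 2 ≠ 0 := by linarith
        have : √y * √y = x / p := mul_self_sqrt hy0
        rw [div_mul_div_comm, this]
        field_simp
    _ ≤ 3 * x / (p : ℝ) ^ 4 := by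
        have h2 : (0 : ℝ) < p - 2 := by linarith
        rw [div_le_div_iff₀ (by positivity) (by positivity)]
        have : (p : ℝ) ^ 4 ≤ 3 * (p ^ 3 * (p - 2)) := by
          have : (0 : ℝ) < p ^ 3 := by positivity
          nlinarith
        nlinarith

theorem triple_inj (p q r p' q' r' : ℕ) (hp : p.Prime) (hq : q.Prime) (hr : r.Prime)
    (hp' : p'.Prime) (hq' : q'.Prime) (hr' : r'.Prime) (h1 : p < q) (h2 : q < r) (h1' : p' < q') (h2' : q' < r')
    (h : p * q * r = p' * q' * r') : p = p' ∧ q = q' ∧ r = r' := by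
  have key : ∀ s : ℕ, s.Prime → s ∣ p' * q' * r' → s = p' ∨ s = q' ∨ s = r' := by
    intro s hs hd
    rcases (Nat.Prime.dvd_mul hs).1 hd with hd | hd
    · rcases (Nat.Prime.dvd_mul hs).1 hd with hd | hd
      · exact Or.inl ((Nat.prime_dvd_prime_iff_eq hs hp').1 hd)
      · exact Or.inr (Or.inl ((Nat.prime_dvd_prime_iff_eq hs hq').1 hd))
    · exact Or.inr (Or.inr ((Nat.prime_dvd_prime_iff_eq hs hr').1 hd))
  have a1 := key p hp (h ▸ ⟨q * r, by ring⟩)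
  have a2 := key q hq (h ▸ ⟨p * r, by ring⟩)
  have a3 := key r hr (h ▸ ⟨p * q, by ring⟩)
  omega

theorem count_eq (x : ℝ) (hx : 0 ≤ x) :
    ({n : ℕ | ∃ p q r : ℕ, p.Prime ∧ q.Prime ∧ r.Prime ∧
    3 ≤ p ∧ p < q ∧ q < r ∧ n = p * q * r ∧ (n : ℝ) ≤ x ∧
    (((X ^ n - 1 : ℤ[X]) /ₘ cyclotomic n ℤ).support.sup
      fun k => (((X ^ n - 1 : ℤ[X]) /ₘ cyclotomic n ℤ).coeff k).natAbs) = p - 1}.ncard : ℝ) =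
    ∑ p ∈ (Finset.Icc 3 ⌊x⌋₊).filter Nat.Prime,
      (((TT p 1 (x / p)).card : ℝ) + ((TT p (-1) (x / p)).card : ℝ)) := by
  classical
  set P := (Finset.Icc 3 ⌊x⌋₊).filter Nat.Prime with hP
  set W : Finset (Σ _ : ℕ, ℕ × ℕ) := P.sigma (fun p => TT p 1 (x / p) ∪ TT p (-1) (x / p)) with hW
  have hmemW : ∀ p q r : ℕ, (⟨p, (q, r)⟩ : Σ _ : ℕ, ℕ × ℕ) ∈ W → p.Prime ∧ q.Prime ∧ r.Prime ∧ 3 ≤ p ∧ p < q ∧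
      q < r ∧ ((p * q * r : ℕ) : ℝ) ≤ x ∧
      (((q : ZMod p) = 1 ∧ (r : ZMod p) = 1) ∨ ((q : ZMod p) = -1 ∧ (r : ZMod p) = -1)) ∧
      (p - 2) * r < (p - 1) * (q - 1) := by
    intro p q r h
    rw [hW, Finset.mem_sigma, hP, Finset.mem_filter, Finset.mem_Icc, Finset.mem_union] at h
    obtain ⟨⟨⟨hp3, hpx⟩, hp⟩, h⟩ := h
    simp only at hp3 hpx hp h
    have hp0 : (0 : ℝ) < p := by exact_mod_cast hp.pos
    have hy0 : 0 ≤ x / p := by positivity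
    rw [mem_TT p hp3 _ _ hy0, mem_TT p hp3 _ _ hy0] at h
    have hD : DD p (x / p) q r := by tauto
    have hq : q.Prime := by tauto
    have hr : r.Prime := by tauto
    have hcl : (((q : ZMod p) = 1 ∧ (r : ZMod p) = 1) ∨ ((q : ZMod p) = -1 ∧ (r : ZMod p) = -1)) := by
      rcases h with h | h
      · exact Or.inl ⟨h.2.1.2.symm, h.2.2.2.symm⟩
      · exact Or.inr ⟨h.2.1.2.symm, h.2.2.2.symm⟩
    have hpq := p_lt_q p hp hp3 _ q r hD hq (by tauto)
    refine ⟨hp, hq, hr, hp3, hpq, hD.1, ?_, hcl, hD.2.1⟩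
    have := hD.2.2
    rw [le_div_iff₀ hp0] at this
    push_cast
    linarith
  have hset : {n : ℕ | ∃ p q r : ℕ, p.Prime ∧ q.Prime ∧ r.Prime ∧
    3 ≤ p ∧ p < q ∧ q < r ∧ n = p * q * r ∧ (n : ℝ) ≤ x ∧
    (((X ^ n - 1 : ℤ[X]) /ₘ cyclotomic n ℤ).support.sup
      fun k => (((X ^ n - 1 : ℤ[X]) /ₘ cyclotomic n ℤ).coeff k).natAbs) = p - 1} =
      ((W.image (fun t => t.1 * t.2.1 * t.2.2) : Finset ℕ) : Set ℕ) := by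
    ext n
    rw [Set.mem_setOf_eq, Finset.mem_coe, Finset.mem_image]
    constructor
    · rintro ⟨p, q, r, hp, hq, hr, hp3, hpq, hqr, rfl, hnx, hh⟩
      rw [height_iff p q r hp hq hr hp3 hpq hqr] at hh
      have hp0 : (0 : ℝ) < p := by exact_mod_cast hp.pos
      have hy0 : 0 ≤ x / p := by positivity
      refine ⟨⟨p, (q, r)⟩, ?_, rfl⟩
      rw [hW, Finset.mem_sigma, hP, Finset.mem_filter, Finset.mem_Icc, Finset.mem_union]
      refine ⟨⟨⟨hp3, ?_⟩, hp⟩, ?_⟩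
      · apply Nat.le_floor
        refine le_trans ?_ hnx
        have : p ≤ p * q * r := by
          rw [mul_assoc]
          exact Nat.le_mul_of_pos_right _ (Nat.mul_pos hq.pos hr.pos)
        exact_mod_cast this
      · have hD : DD p (x / p) q r := by
          refine ⟨hqr, hh.2, ?_⟩
          rw [le_div_iff₀ hp0]
          push_cast at hnx
          linarith
        rcases hh.1 with h | h
        · left
          exact (mem_TT p hp3 _ _ hy0 q r).2 ⟨hD, ⟨hq, h.1.symm⟩, ⟨hr, h.2.symm⟩⟩
        · right
          exact (mem_TT p hp3 _ _ hy0 q r).2 ⟨hD, ⟨hq, h.1.symm⟩, ⟨hr, h.2.symm⟩⟩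
    · rintro ⟨⟨p, ⟨q, r⟩⟩, hm, rfl⟩
      obtain ⟨hp, hq, hr, hp3, hpq, hqr, hle, hcl, hlt⟩ := hmemW p q r hm
      exact ⟨p, q, r, hp, hq, hr, hp3, hpq, hqr, rfl, hle, (height_iff p q r hp hq hr hp3 hpq hqr).2 ⟨hcl, hlt⟩⟩
  rw [hset, Set.ncard_coe_finset, Finset.card_image_of_injOn, hW, Finset.card_sigma]
  · push_cast
    apply Finset.sum_congr rfl
    intro p hpP
    rw [hP, Finset.mem_filter, Finset.mem_Icc] at hpP
    obtain ⟨⟨hp3, -⟩, hp⟩ := hpP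
    have hy0 : 0 ≤ x / p := by positivity
    rw [Finset.card_union_of_disjoint]
    · push_cast; rfl
    · rw [Finset.disjoint_left]
      rintro ⟨q, r⟩ h1 h2
      have e1 := ((mem_TT p hp3 _ _ hy0 q r).1 h1).2.1.2
      have e2 := ((mem_TT p hp3 _ _ hy0 q r).1 h2).2.1.2
      have : Fact (2 < p) := ⟨by omega⟩
      exact ZMod.neg_one_ne_one (e2.trans e1.symm)
  · rintro ⟨p, ⟨q, r⟩⟩ hm ⟨p', ⟨q', r'⟩⟩ hm' he
    obtain ⟨hp, hq, hr, hp3, hpq, hqr, -⟩ := hmemW p q r hm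
    obtain ⟨hp', hq', hr', hp3', hpq', hqr', -⟩ := hmemW p' q' r' hm'
    obtain ⟨rfl, rfl, rfl⟩ := triple_inj p q r p' q' r' hp hq hr hp' hq' hr' hpq hqr hpq' hqr' he
    rfl

end NCO

namespace NCO

/-- the summand of the constant -/
noncomputable def kk (p : ℕ) : ℝ := 1 / ((p : ℝ) * ((p : ℝ) - 1) ^ 2) * log (((p : ℝ) - 1) / ((p : ℝ) - 2))

theorem kk_bound (p : ℕ) (hp : 3 ≤ p) : 0 ≤ kk p ∧ kk p ≤ 1 / (p : ℝ) ^ 2 := by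
  have hp0 : (3 : ℝ) ≤ p := by exact_mod_cast hp
  have h2 : (0 : ℝ) < p - 2 := by linarith
  have h1 : 1 ≤ ((p : ℝ) - 1) / ((p : ℝ) - 2) := by
    rw [le_div_iff₀ h2]; linarith
  have hl0 := log_nonneg h1
  have hl1 : log (((p : ℝ) - 1) / ((p : ℝ) - 2)) ≤ 1 := by
    refine (log_le_sub_one_of_pos (by linarith)).trans ?_
    have : ((p : ℝ) - 1) / ((p : ℝ) - 2) ≤ 2 := by
      rw [div_le_iff₀ h2]; linarith
    linarith
  have hpos : (0 : ℝ) < (p : ℝ) * ((p : ℝ) - 1) ^ 2 := by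
    have : (0 : ℝ) < (p : ℝ) - 1 := by linarith
    positivity
  unfold kk
  refine ⟨by positivity, ?_⟩
  calc 1 / ((p : ℝ) * ((p : ℝ) - 1) ^ 2) * log (((p : ℝ) - 1) / ((p : ℝ) - 2)) ≤
      1 / ((p : ℝ) * ((p : ℝ) - 1) ^ 2) * 1 := by gcongr
    _ ≤ 1 / (p : ℝ) ^ 2 := by
      rw [mul_one]
      apply one_div_le_one_div_of_le (by positivity)
      nlinarith

/-- the summand extended by zero -/
noncomputable def FF (n : ℕ) : ℝ := {p : ℕ | p.Prime ∧ 3 ≤ p}.indicator kk n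

theorem FF_nonneg (n : ℕ) : 0 ≤ FF n := by
  unfold FF
  apply Set.indicator_nonneg
  intro p hp
  exact (kk_bound p hp.2).1

theorem FF_le (n : ℕ) : FF n ≤ 1 / (n : ℝ) ^ 2 := by
  unfold FF
  by_cases h : n ∈ {p : ℕ | p.Prime ∧ 3 ≤ p}
  · rw [Set.indicator_of_mem h]
    exact (kk_bound n h.2).2
  · rw [Set.indicator_of_notMem h]
    positivity

theorem inv_sq_tail (M N : ℕ) (hM : 1 ≤ M) : ∑ n ∈ Finset.Ioc M N, 1 / (n : ℝ) ^ 2 ≤ (1 : ℝ) / (M : ℝ) := by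
  rcases le_total M N with h | h
  · have := sum_Ioc_inv_sq_le_sub (α := ℝ) (by omega : M ≠ 0) h
    simp only [one_div]
    refine this.trans ?_
    have : (0 : ℝ) ≤ (N : ℝ)⁻¹ := by positivity
    linarith
  · rw [Finset.Ioc_eq_empty (by omega)]
    simp

theorem FF_range (M N : ℕ) (hM : 1 ≤ M) :
    ∑ n ∈ Finset.range N, FF n ≤ ∑ n ∈ Finset.range (M + 1), FF n + (1 : ℝ) / (M : ℝ) := by
  have h1 : ∑ n ∈ Finset.range N, FF n ≤ ∑ n ∈ Finset.range (M + 1) ∪ Finset.Ioc M N, FF n := by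
    apply Finset.sum_le_sum_of_subset_of_nonneg
    · intro n hn
      simp at hn ⊢
      omega
    · intro n _ _
      exact FF_nonneg n
  rw [Finset.sum_union] at h1
  · have h2 : ∑ n ∈ Finset.Ioc M N, FF n ≤ ∑ n ∈ Finset.Ioc M N, 1 / (n : ℝ) ^ 2 :=
      Finset.sum_le_sum (fun n _ => FF_le n)
    linarith [inv_sq_tail M N hM]
  · rw [Finset.disjoint_left]
    intro n h1 h2
    simp at h1 h2
    omega

theorem FF_tsum (M : ℕ) (hM : 1 ≤ M) :
    |∑' p : {p : ℕ // p.Prime ∧ 3 ≤ p}, kk p.1 - ∑ n ∈ Finset.range (M + 1), FF n| ≤ (1 : ℝ) / (M : ℝ) := by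
  have hs : Summable FF := summable_of_sum_range_le FF_nonneg (fun n => FF_range 1 n le_rfl)
  have e : ∑' p : {p : ℕ // p.Prime ∧ 3 ≤ p}, kk p.1 = ∑' n, FF n := 
    tsum_subtype {p : ℕ | p.Prime ∧ 3 ≤ p} kk
  rw [e]
  have h1 : ∑ n ∈ Finset.range (M + 1), FF n ≤ ∑' n, FF n := hs.sum_le_tsum _ (fun n _ => FF_nonneg n)
  have h2 : ∑' n, FF n ≤ ∑ n ∈ Finset.range (M + 1), FF n + (1 : ℝ) / (M : ℝ) :=
    Real.tsum_le_of_sum_range_le FF_nonneg (fun n => FF_range M n hM)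
  rw [abs_of_nonneg (by linarith)]
  linarith

theorem FF_sum (M : ℕ) : ∑ p ∈ (Finset.Icc 3 M).filter Nat.Prime, kk p = ∑ n ∈ Finset.range (M + 1), FF n := by
  classical
  unfold FF
  rw [Finset.sum_indicator_eq_sum_filter]
  apply Finset.sum_congr _ (fun _ _ => rfl)
  ext p
  simp
  constructor
  · rintro ⟨⟨h1, h2⟩, h3⟩
    exact ⟨by omega, h3, h1⟩
  · rintro ⟨h1, h2, h3⟩
    exact ⟨⟨h3, by omega⟩, h2⟩

theorem final_count : ∃ C > (0 : ℝ), ∀ x : ℝ, 3 ≤ x → 100 ≤ log x → log x ^ 8 ≤ x ^ (1 / 8 : ℝ) →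
    |∑ p ∈ (Finset.Icc 3 ⌊x⌋₊).filter Nat.Prime,
      (((TT p 1 (x / p)).card : ℝ) + ((TT p (-1) (x / p)).card : ℝ)) -
      4 * (∑' p : {p : ℕ // p.Prime ∧ 3 ≤ p}, kk p.1) * x / log x ^ 2| ≤ C * (x / log x ^ 3) := by
  obtain ⟨C, hC, h⟩ := small_p
  refine ⟨4 * C + 6 * 64 ^ 3 + 256, by positivity, ?_⟩
  intro x hx hL h8
  have hlx : log x ≤ x := (log_le_sub_one_of_pos (by linarith)).trans (by linarith)
  set L := log x with hLd
  set M := ⌊L / 32⌋₊ with hM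
  set S := ∑' p : {p : ℕ // p.Prime ∧ 3 ≤ p}, kk p.1 with hS
  set g : ℕ → ℝ := fun p => ((TT p 1 (x / p)).card : ℝ) + ((TT p (-1) (x / p)).card : ℝ) with hg
  have hM1 : (M : ℝ) ≤ L / 32 := Nat.floor_le (by positivity)
  have hM2 : L / 32 < M + 1 := Nat.lt_floor_add_one _
  have hM3 : L / 64 ≤ M := by linarith
  have hMpos : (1 : ℝ) ≤ M := by linarith
  have hMn : 1 ≤ M := by exact_mod_cast hMpos
  have hMN : M ≤ ⌊x⌋₊ := Nat.le_floor (by linarith)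
  have hL0 : 0 < L := by linarith
  have hx0 : 0 < x := by linarith
  have hsplit : ∑ p ∈ (Finset.Icc 3 ⌊x⌋₊).filter Nat.Prime, g p =
      ∑ p ∈ (Finset.Icc 3 M).filter Nat.Prime, g p + ∑ p ∈ ((Finset.Icc 3 ⌊x⌋₊).filter Nat.Prime).filter (fun p => ¬ p ≤ M), g p := by
    rw [← Finset.sum_filter_add_sum_filter_not ((Finset.Icc 3 ⌊x⌋₊).filter Nat.Prime) (fun p => p ≤ M)]
    congr 1
    apply Finset.sum_congr _ (fun _ _ => rfl)
    ext p
    simp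
    constructor
    · rintro ⟨⟨⟨h1, h2⟩, h3⟩, h4⟩
      exact ⟨⟨h1, h4⟩, h3⟩
    · rintro ⟨⟨h1, h2⟩, h3⟩
      exact ⟨⟨⟨h1, by omega⟩, h3⟩, h2⟩
  have hlarge0 : 0 ≤ ∑ p ∈ ((Finset.Icc 3 ⌊x⌋₊).filter Nat.Prime).filter (fun p => ¬ p ≤ M), g p :=
    Finset.sum_nonneg (fun p _ => by simp only [hg]; positivity)
  have hlarge : ∑ p ∈ ((Finset.Icc 3 ⌊x⌋₊).filter Nat.Prime).filter (fun p => ¬ p ≤ M), g p ≤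
      6 * 64 ^ 3 * (x / L ^ 3) := by
    have s1 : ∑ p ∈ ((Finset.Icc 3 ⌊x⌋₊).filter Nat.Prime).filter (fun p => ¬ p ≤ M), g p ≤
        ∑ p ∈ ((Finset.Icc 3 ⌊x⌋₊).filter Nat.Prime).filter (fun p => ¬ p ≤ M), 6 * x / (M : ℝ) ^ 2 * (1 / (p : ℝ) ^ 2) := by
      apply Finset.sum_le_sum
      intro p hp
      simp only [Finset.mem_filter, Finset.mem_Icc, not_le] at hp
      obtain ⟨⟨⟨hp3, -⟩, hpp⟩, hpM⟩ := hp
      have b1 := large_p p hpp hp3 1 (Or.inl rfl) x hx0.le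
      have b2 := large_p p hpp hp3 (-1) (Or.inr rfl) x hx0.le
      have hpM' : (M : ℝ) ≤ p := by exact_mod_cast hpM.le
      have hp0 : (0 : ℝ) < p := by linarith
      calc g p ≤ 6 * x / (p : ℝ) ^ 4 := by
            simp only [hg]
            calc _ ≤ 3 * x / (p : ℝ) ^ 4 + 3 * x / (p : ℝ) ^ 4 := add_le_add b1 b2
              _ = _ := by ring
        _ = 6 * x / (p : ℝ) ^ 2 * (1 / (p : ℝ) ^ 2) := by field_simp
        _ ≤ _ := by gcongr
    have s2 : ∑ p ∈ ((Finset.Icc 3 ⌊x⌋₊).filter Nat.Prime).filter (fun p => ¬ p ≤ M), 6 * x / (M : ℝ) ^ 2 * (1 / (p : ℝ) ^ 2) ≤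
        ∑ p ∈ Finset.Ioc M ⌊x⌋₊, 6 * x / (M : ℝ) ^ 2 * (1 / (p : ℝ) ^ 2) := by
      apply Finset.sum_le_sum_of_subset_of_nonneg
      · intro p hp
        simp at hp ⊢
        omega
      · intro p _ _
        positivity
    rw [← Finset.mul_sum (Finset.Ioc M ⌊x⌋₊)] at s2
    have s3 := inv_sq_tail M ⌊x⌋₊ hMn
    calc _ ≤ _ := s1.trans s2
      _ ≤ 6 * x / (M : ℝ) ^ 2 * ((1 : ℝ) / (M : ℝ)) := by gcongr
      _ = 6 * x / (M : ℝ) ^ 3 := by field_simp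
      _ ≤ 6 * x / (L / 64) ^ 3 := by gcongr
      _ = _ := by field_simp
  have hsmall : |∑ p ∈ (Finset.Icc 3 M).filter Nat.Prime, g p -
      4 * (∑ n ∈ Finset.range (M + 1), FF n) * x / L ^ 2| ≤ 4 * C * (x / L ^ 3) := by
    have e : ∑ p ∈ (Finset.Icc 3 M).filter Nat.Prime, g p -
      4 * (∑ n ∈ Finset.range (M + 1), FF n) * x / L ^ 2 =
        ∑ p ∈ (Finset.Icc 3 M).filter Nat.Prime, (g p - 4 * kk p * x / L ^ 2) := by
      rw [← FF_sum, Finset.sum_sub_distrib, Finset.mul_sum, Finset.sum_mul, Finset.sum_div]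
    rw [e]
    refine (Finset.abs_sum_le_sum_abs _ _).trans ?_
    have s1 : ∑ p ∈ (Finset.Icc 3 M).filter Nat.Prime, |g p - 4 * kk p * x / L ^ 2| ≤
        ∑ p ∈ (Finset.Icc 3 M).filter Nat.Prime, (2 * C * (x / L ^ 3) * (1 / (p : ℝ) ^ 2) + 2 * C * (x / L ^ 4)) := by
      apply Finset.sum_le_sum
      intro p hp
      simp only [Finset.mem_filter, Finset.mem_Icc] at hp
      obtain ⟨⟨hp3, hpM⟩, hpp⟩ := hp
      have : Fact p.Prime := ⟨hpp⟩
      have hpM' : (p : ℝ) ≤ M := by exact_mod_cast hpM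
      have hp0 : (3 : ℝ) ≤ p := by exact_mod_cast hp3
      have b1 := h x hx hL h8 p 1 isUnit_one hp3 (by linarith)
      have b2 := h x hx hL h8 p (-1) isUnit_one.neg hp3 (by linarith)
      rw [SD_card] at b1 b2
      have ec : 1 / ((p : ℝ) * ((p : ℝ) - 1) ^ 2) * log (((p : ℝ) - 1) / (p - 2)) = kk p := rfl
      rw [ec] at b1 b2
      have e2 : g p - 4 * kk p * x / L ^ 2 = (((TT p 1 (x / p)).card : ℝ) - 2 * kk p * x / L ^ 2) +
        (((TT p (-1) (x / p)).card : ℝ) - 2 * kk p * x / L ^ 2) := by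
        simp only [hg]; ring
      rw [e2]
      refine (abs_add_le _ _).trans ((add_le_add b1 b2).trans ?_)
      have t1 : x / ((p : ℝ) ^ 2 * L ^ 3) = (x / L ^ 3) * (1 / (p : ℝ) ^ 2) := by field_simp
      have t2 : x / ((p : ℝ) * L ^ 4) ≤ x / L ^ 4 := by
        apply div_le_div_of_nonneg_left hx0.le (by positivity)
        have : (0 : ℝ) < L ^ 4 := by positivity
        nlinarith
      rw [t1]
      have := mul_le_mul_of_nonneg_left t2 hC.le
      linarith
    have s2 : ∑ p ∈ (Finset.Icc 3 M).filter Nat.Prime, (2 * C * (x / L ^ 3) * (1 / (p : ℝ) ^ 2) + 2 * C * (x / L ^ 4)) ≤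
        ∑ p ∈ Finset.Ioc 1 M, (2 * C * (x / L ^ 3) * (1 / (p : ℝ) ^ 2) + 2 * C * (x / L ^ 4)) := by
      apply Finset.sum_le_sum_of_subset_of_nonneg
      · intro p hp
        simp at hp ⊢
        omega
      · intro p _ _
        positivity
    refine s1.trans (s2.trans ?_)
    rw [Finset.sum_add_distrib, ← Finset.mul_sum, Finset.sum_const, nsmul_eq_mul, Nat.card_Ioc]
    have s3 := inv_sq_tail 1 M le_rfl
    have s4 : ((M - 1 : ℕ) : ℝ) ≤ L := by
      have : ((M - 1 : ℕ) : ℝ) ≤ M := by exact_mod_cast Nat.sub_le M 1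
      linarith
    calc _ ≤ 2 * C * (x / L ^ 3) * (1 / (1 : ℕ)) + L * (2 * C * (x / L ^ 4)) := by gcongr
      _ = 4 * C * (x / L ^ 3) := by field_simp; norm_num
  have hconst : |4 * S * x / L ^ 2 - 4 * (∑ n ∈ Finset.range (M + 1), FF n) * x / L ^ 2| ≤ 256 * (x / L ^ 3) := by
    have t := FF_tsum M hMn
    have e : 4 * S * x / L ^ 2 - 4 * (∑ n ∈ Finset.range (M + 1), FF n) * x / L ^ 2 =
      (4 * x / L ^ 2) * (S - ∑ n ∈ Finset.range (M + 1), FF n) := by ring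
    rw [e, abs_mul, abs_of_nonneg (by positivity : 0 ≤ 4 * x / L ^ 2)]
    calc _ ≤ (4 * x / L ^ 2) * ((1 : ℝ) / (M : ℝ)) := by gcongr
      _ ≤ (4 * x / L ^ 2) * (1 / (L / 64)) := by gcongr
      _ = _ := by field_simp; norm_num
  rw [hsplit]
  rw [abs_le] at hsmall hconst ⊢
  constructor <;> nlinarith [hsmall.1, hsmall.2, hconst.1, hconst.2]

end NCO

theorem NCOcount_asymptotic :
    ∃ C > (0 : ℝ), ∃ x₀ : ℝ, ∀ x ≥ x₀,
      |(NCOcount x : ℝ) - C1 * x / (Real.log x) ^ 2| ≤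
        C * x * Real.log (Real.log x) / (Real.log x) ^ 3 := by
  obtain ⟨C, hC, h⟩ := NCO.final_count
  obtain ⟨x₀, hx₀, hb⟩ := NCO.big
  refine ⟨C, hC, x₀, ?_⟩
  intro x hx
  obtain ⟨hL, h8⟩ := hb x hx
  have hx3 : 3 ≤ x := le_trans hx₀ hx
  have h1 := h x hx3 hL h8
  have hc := NCO.count_eq x (by linarith)
  have e1 : (NCOcount x : ℝ) = ∑ p ∈ (Finset.Icc 3 ⌊x⌋₊).filter Nat.Prime,
      (((NCO.TT p 1 (x / p)).card : ℝ) + ((NCO.TT p (-1) (x / p)).card : ℝ)) := by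
    rw [← hc]
    rfl
  have e2 : C1 = 4 * ∑' p : {p : ℕ // p.Prime ∧ 3 ≤ p}, NCO.kk p.1 := rfl
  rw [e1, e2]
  refine h1.trans ?_
  have hll : 1 ≤ log (log x) := by
    rw [Real.le_log_iff_exp_le (by linarith)]
    have := Real.exp_one_lt_d9
    linarith
  have hpos : 0 ≤ C * (x / log x ^ 3) := by
    have : 0 < log x := by linarith
    positivity
  calc C * (x / log x ^ 3) ≤ C * (x / log x ^ 3) * log (log x) := le_mul_of_one_le_right hpos hll
    _ = C * x * log (log x) / log x ^ 3 := by ring
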